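/- arXiv:math/0411165 — 2 statements merged into one kernel-verified Lean document; each statement's English description precedes it below -/
import Mathlib

section
/- Let m ≥ 2 and let F¹, …, F^m be real-analytic functions on a neighborhood of 0 in ℝ^{1+2m} (variables (x, y¹, …, y^m, p¹, …, p^m)). The following are equivalent. (1) There exist real-analytic functions X, Y¹, …, Y^m on a neighborhood of 0 in ℝ^{1+m}, whose Jacobian matrix at the origin is the identity, mapping the system y_xx^j = F^j(x, y, y_x) to the free-particle system Y_XX^j = 0 (in the jet sense of the context). (3) There exist real-analytic functions G^j, H^j_{l₁}, L^j_{l₁,l₂} = L^j_{l₂,l₁}, M_{l₁,l₂} = M_{l₂,l₁} of (x, y¹, …, y^m) defined near 0 (indices in {1, …, m}) such that, for all (x, y, p) near 0 and all j, F^j(x, y, p) = G^j + Σ_{l₁=1}^m p^{l₁}H^j_{l₁} + Σ_{l₁=1}^m Σ_{l₂=1}^m p^{l₁}p^{l₂}L^j_{l₁,l₂} + p^j·Σ_{l₁=1}^m Σ_{l₂=1}^m p^{l₁}p^{l₂}M_{l₁,l₂}, and such that (G, H, L, M) satisfies conditions (I)–(IV). -/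
/-- Partial derivative in the direction of the `i`-th coordinate `y^i`
(with the convention `y⁰ ≡ x`) of a function on `ℝ^{1+m}`. -/
noncomputable def pd (m : ℕ) (i : Fin (m + 1)) (f : (Fin (m + 1) → ℝ) → ℝ) :
    (Fin (m + 1) → ℝ) → ℝ :=
  fun z => fderiv ℝ f z (Pi.single i 1)

/-- Kronecker delta with real values. -/
def kd {n : ℕ} (i j : Fin n) : ℝ := if i = j then 1 else 0

/-- `DX = X_x + Σ_l p^l X_{y^l}`. -/
noncomputable def Dop (m : ℕ) (X : (Fin (m + 1) → ℝ) → ℝ) (z : Fin (m + 1) → ℝ)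
    (p : Fin m → ℝ) : ℝ :=
  pd m 0 X z + ∑ l : Fin m, p l * pd m l.succ X z

/-- `DDX = X_xx + 2 Σ_l p^l X_{x y^l} + Σ_{l₁,l₂} p^{l₁} p^{l₂} X_{y^{l₁}y^{l₂}}
  + Σ_l q^l X_{y^l}`. -/
noncomputable def DDop (m : ℕ) (X : (Fin (m + 1) → ℝ) → ℝ) (z : Fin (m + 1) → ℝ)
    (p q : Fin m → ℝ) : ℝ :=
  pd m 0 (pd m 0 X) z + 2 * ∑ l : Fin m, p l * pd m l.succ (pd m 0 X) z
    + ∑ l₁ : Fin m, ∑ l₂ : Fin m, p l₁ * p l₂ * pd m l₂.succ (pd m l₁.succ X) z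
    + ∑ l : Fin m, q l * pd m l.succ X z

/-- `(X, Y¹, …, Y^m) = (Z 0, Z 1, …, Z m)` maps the system `y_xx^j = F^j(x,y,y_x)`
to the free-particle system `Y_XX^j = 0`. -/
def MapsToFree (m : ℕ) (F : Fin m → ((Fin (m + 1) → ℝ) × (Fin m → ℝ)) → ℝ)
    (Z : Fin (m + 1) → (Fin (m + 1) → ℝ) → ℝ) : Prop :=
  (∀ i j : Fin (m + 1), pd m j (Z i) 0 = if i = j then 1 else 0) ∧
  ∃ V ∈ nhds (0 : (Fin (m + 1) → ℝ) × (Fin m → ℝ)), ∀ w ∈ V, ∀ j : Fin m,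
    Dop m (Z 0) w.1 w.2 * DDop m (Z j.succ) w.1 w.2 (fun l => F l w)
      - Dop m (Z j.succ) w.1 w.2 * DDop m (Z 0) w.1 w.2 (fun l => F l w) = 0

/-- Conditions (I)–(IV) of Theorem 1.7 (3) for the data `(G, H, L, M)` on a set `U`. -/
def CondsItoIV (m : ℕ) (U : Set (Fin (m + 1) → ℝ))
    (G : Fin m → (Fin (m + 1) → ℝ) → ℝ)
    (H : Fin m → Fin m → (Fin (m + 1) → ℝ) → ℝ)
    (L : Fin m → Fin m → Fin m → (Fin (m + 1) → ℝ) → ℝ)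
    (M : Fin m → Fin m → (Fin (m + 1) → ℝ) → ℝ) : Prop :=
  -- (I)
  (∀ (j l₁ l₂ : Fin m), ∀ z ∈ U, (0 : ℝ) =
    -2 * pd m l₁.succ (G j) z + 2 * kd j l₁ * pd m l₂.succ (G l₂) z
      + pd m 0 (H j l₁) z - kd j l₁ * pd m 0 (H l₂ l₂) z
      + 2 * ∑ k : Fin m, G k z * L j l₁ k z
      - 2 * kd j l₁ * ∑ k : Fin m, G k z * L l₂ l₂ k z
      + (1/2) * kd j l₁ * ∑ k : Fin m, H k l₂ z * H l₂ k z
      - (1/2) * ∑ k : Fin m, H k l₁ z * H j k z) ∧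
  -- (II)
  (∀ (j l₁ l₂ : Fin m), ∀ z ∈ U, (0 : ℝ) =
    -(1/2) * pd m l₂.succ (H j l₁) z + (1/6) * kd j l₁ * pd m l₂.succ (H l₂ l₂) z
      + (1/3) * kd j l₂ * pd m l₁.succ (H l₁ l₁) z
      + pd m 0 (L j l₁ l₂) z - (1/3) * kd j l₁ * pd m 0 (L l₂ l₂ l₂) z
      - (2/3) * kd j l₂ * pd m 0 (L l₁ l₁ l₁) z
      + G j z * M l₁ l₂ z - (1/3) * kd j l₁ * G l₂ z * M l₂ l₂ z
      - (2/3) * kd j l₂ * G l₁ z * M l₁ l₁ z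
      + (1/3) * kd j l₁ * ∑ k : Fin m, G k z * M l₂ k z
      - (1/3) * kd j l₂ * ∑ k : Fin m, G k z * M l₁ k z
      - (1/2) * ∑ k : Fin m, H j k z * L k l₁ l₂ z
      + (1/2) * ∑ k : Fin m, H k l₁ z * L j l₂ k z
      + kd j l₁ * ((1/6) * ∑ k : Fin m, H l₂ k z * L k l₂ l₂ z
          - (1/6) * ∑ k : Fin m, H k l₂ z * L l₂ l₂ k z)
      + kd j l₂ * ((1/3) * ∑ k : Fin m, H l₁ k z * L k l₁ l₁ z
          - (1/3) * ∑ k : Fin m, H k l₁ z * L l₁ l₁ k z)) ∧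
  -- (III)
  (∀ (j l₁ l₂ l₃ : Fin m), ∀ z ∈ U, (0 : ℝ) =
    pd m l₃.succ (L j l₁ l₂) z - pd m l₂.succ (L j l₁ l₃) z
      + kd j l₃ * pd m 0 (M l₁ l₂) z - kd j l₂ * pd m 0 (M l₁ l₃) z
      + (1/2) * H j l₃ z * M l₁ l₂ z - (1/2) * H j l₂ z * M l₁ l₃ z
      + (1/2) * kd j l₁ * ∑ k : Fin m, H k l₃ z * M l₂ k z
      - (1/2) * kd j l₁ * ∑ k : Fin m, H k l₂ z * M l₃ k z
      + (1/2) * kd j l₃ * ∑ k : Fin m, H k l₁ z * M l₂ k z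
      - (1/2) * kd j l₂ * ∑ k : Fin m, H k l₁ z * M l₃ k z
      + ∑ k : Fin m, L k l₁ l₃ z * L j l₂ k z
      - ∑ k : Fin m, L k l₁ l₂ z * L j l₃ k z) ∧
  -- (IV)
  (∀ (l₁ l₂ l₃ : Fin m), ∀ z ∈ U, (0 : ℝ) =
    pd m l₃.succ (M l₁ l₂) z - pd m l₂.succ (M l₁ l₃) z
      - ∑ k : Fin m, L k l₁ l₂ z * M l₃ k z
      + ∑ k : Fin m, L k l₁ l₃ z * M l₂ k z)

open Filter Topology

/-- The curve `s ↦ s ^ n • w` on the unit interval, as a bounded linear function of `w`. -/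
noncomputable def powCurve (F : Type*) [NormedAddCommGroup F] [NormedSpace ℝ F] (n : ℕ) :
    F →L[ℝ] C(unitInterval, F) :=
  LinearMap.mkContinuous
    { toFun := fun w => ⟨fun s => (s : ℝ) ^ n • w, by fun_prop⟩
      map_add' := fun v w => by ext s; simp
      map_smul' := fun c w => by ext s; exact smul_comm _ _ _ } 1 (fun w => by
    rw [one_mul, ContinuousMap.norm_le _ (norm_nonneg w)]
    intro s
    have hs : ‖(s : ℝ) ^ n‖ ≤ 1 := by
      rw [norm_pow, Real.norm_of_nonneg s.2.1]
      exact pow_le_one₀ s.2.1 s.2.2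
    calc ‖(s : ℝ) ^ n • w‖ = ‖(s : ℝ) ^ n‖ * ‖w‖ := norm_smul _ _
      _ ≤ 1 * ‖w‖ := by gcongr
      _ = ‖w‖ := one_mul _)

theorem norm_powCurve_le (F : Type*) [NormedAddCommGroup F] [NormedSpace ℝ F] (n : ℕ) :
    ‖powCurve F n‖ ≤ 1 := LinearMap.mkContinuous_norm_le _ zero_le_one _

/-- Restricting an analytic function to rays is analytic with values in curves. -/
theorem exists_analyticAt_ray {E F : Type*} [NormedAddCommGroup E] [NormedSpace ℝ E]
    [NormedAddCommGroup F] [NormedSpace ℝ F] [CompleteSpace F] {f : E → F}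
    (hf : AnalyticAt ℝ f 0) :
    ∃ q : E → C(unitInterval, F), AnalyticAt ℝ q 0 ∧
      ∀ᶠ z in 𝓝 0, ∀ s : unitInterval, q z s = f ((s : ℝ) • z) := by
  obtain ⟨p, r, hp⟩ := hf
  obtain ⟨Q, hQdef⟩ : ∃ Q : FormalMultilinearSeries ℝ E C(unitInterval, F),
      ∀ n, Q n = (powCurve F n).compContinuousMultilinearMap (p n) := ⟨_, fun _ => rfl⟩
  have hQ : p.radius ≤ Q.radius := by
    apply FormalMultilinearSeries.radius_le_of_le
    intro n
    have h := (powCurve F n).norm_compContinuousMultilinearMap_le (p n)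
    have h1 := norm_powCurve_le F n
    calc ‖Q n‖ ≤ ‖powCurve F n‖ * ‖p n‖ := by rw [hQdef]; exact h
      _ ≤ 1 * ‖p n‖ := by gcongr
      _ = ‖p n‖ := one_mul _
  have hrad : 0 < Q.radius := lt_of_lt_of_le hp.r_pos (hp.r_le.trans hQ)
  refine ⟨Q.sum, (Q.hasFPowerSeriesOnBall hrad).analyticAt, ?_⟩
  filter_upwards [Metric.eball_mem_nhds (0 : E) hp.r_pos] with z hz s
  have hzQ : z ∈ Metric.eball (0 : E) Q.radius :=
    Metric.eball_subset_eball (hp.r_le.trans hQ) hz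
  have h1 : HasSum (fun n => (s : ℝ) ^ n • (p n) fun _ => z) (Q.sum z s) := by
    have h := (Q.hasSum hzQ).mapL (ContinuousMap.evalCLM ℝ s)
    simp only [hQdef] at h
    exact h
  have hsz : (s : ℝ) • z ∈ Metric.eball (0 : E) r := by
    rw [mem_eball_zero_iff] at hz ⊢
    refine lt_of_le_of_lt ?_ hz
    rw [enorm_smul]
    have : ‖(s : ℝ)‖ₑ ≤ 1 := by
      rw [Real.enorm_of_nonneg s.2.1]
      exact ENNReal.ofReal_le_one.2 s.2.2
    calc ‖(s : ℝ)‖ₑ * ‖z‖ₑ ≤ 1 * ‖z‖ₑ := by gcongr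
      _ = _ := one_mul _
  have h2 := hp.hasSum hsz
  rw [zero_add] at h2
  have h3 : (fun n => (p n) fun _ => (s : ℝ) • z) = fun n => (s : ℝ) ^ n • (p n) fun _ => z := by
    funext n
    rw [(p n).map_smul_univ (fun _ => (s : ℝ)) (fun _ => z)]
    simp
  rw [h3] at h2
  exact h1.unique h2

/-- Integration of curves from `0`. -/
noncomputable def curvePrimitive (W : Type*) [NormedAddCommGroup W] [NormedSpace ℝ W]
    [CompleteSpace W] : C(unitInterval, W) →L[ℝ] C(unitInterval, W) :=
  LinearMap.mkContinuous
    { toFun := fun u => ⟨fun t => ∫ s in (0 : ℝ)..t, u (Set.projIcc 0 1 zero_le_one s), by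
        have hc : Continuous fun s : ℝ => u (Set.projIcc 0 1 zero_le_one s) :=
          u.continuous.comp continuous_projIcc
        exact (intervalIntegral.continuous_primitive
          (fun a b => hc.intervalIntegrable a b) 0).comp continuous_subtype_val⟩
      map_add' := fun u v => by
        have hc (u : C(unitInterval, W)) :
          Continuous fun s : ℝ => u (Set.projIcc 0 1 zero_le_one s) :=
          u.continuous.comp continuous_projIcc
        ext t
        simp only [ContinuousMap.add_apply, ContinuousMap.coe_mk]
        exact intervalIntegral.integral_add ((hc u).intervalIntegrable _ _)
          ((hc v).intervalIntegrable _ _)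
      map_smul' := fun c u => by
        ext t
        simp } 1 (fun u => by
    rw [one_mul, ContinuousMap.norm_le _ (norm_nonneg u)]
    intro t
    have := intervalIntegral.norm_integral_le_of_norm_le_const (a := 0) (b := (t : ℝ))
      (f := fun s => u (Set.projIcc 0 1 zero_le_one s)) (C := ‖u‖)
      (fun x _ => u.norm_coe_le_norm _)
    refine this.trans ?_
    have ht : |(t : ℝ) - 0| ≤ 1 := by
      rw [sub_zero, abs_of_nonneg t.2.1]; exact t.2.2
    exact mul_le_of_le_one_right (norm_nonneg u) ht)

/-- Pointwise evaluation of a curve of linear maps at a fixed vector. -/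
noncomputable def curveApply (E F : Type*) [NormedAddCommGroup E] [NormedSpace ℝ E]
    [NormedAddCommGroup F] [NormedSpace ℝ F] :
    E →L[ℝ] C(unitInterval, E →L[ℝ] F) →L[ℝ] C(unitInterval, F) :=
  LinearMap.mkContinuous₂
    (LinearMap.mk₂ ℝ
      (fun (z : E) (q : C(unitInterval, E →L[ℝ] F)) =>
        (⟨fun s => q s z, by fun_prop⟩ : C(unitInterval, F)))
      (fun z w q => by ext s; simp) (fun c z q => by ext s; simp)
      (fun z q r => by ext s; simp) (fun c z q => by ext s; simp)) 1 (fun z q => by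
    rw [one_mul]
    refine (ContinuousMap.norm_le _ (by positivity)).2 ?_
    intro s
    calc ‖q s z‖ ≤ ‖q s‖ * ‖z‖ := (q s).le_opNorm z
      _ ≤ ‖q‖ * ‖z‖ := by gcongr; exact q.norm_coe_le_norm s
      _ = ‖z‖ * ‖q‖ := mul_comm _ _)

theorem curveApply_apply {E F : Type*} [NormedAddCommGroup E] [NormedSpace ℝ E]
    [NormedAddCommGroup F] [NormedSpace ℝ F] (z : E) (q : C(unitInterval, E →L[ℝ] F))
    (s : unitInterval) : curveApply E F z q s = q s z := rfl

/-- Analytic dependence of the solution of `u = 1 + J (a * u)` on the small coefficient `a`. -/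
theorem exists_analyticAt_one_add_mul {E X : Type*} [NormedAddCommGroup E] [NormedSpace ℝ E]
    [NormedRing X] [NormedAlgebra ℝ X] [CompleteSpace X] (J : X →L[ℝ] X)
    {a : E → X} (ha : AnalyticAt ℝ a 0) (ha0 : a 0 = 0) :
    ∃ U : E → X, AnalyticAt ℝ U 0 ∧ U 0 = 1 ∧
      ∀ᶠ z in 𝓝 0, U z = 1 + J (a z * U z) ∧ ∀ v, v = 1 + J (a z * v) → v = U z := by
  let K : X →L[ℝ] X →L[ℝ] X :=
    (ContinuousLinearMap.compL ℝ _ _ _ J).comp (ContinuousLinearMap.mul ℝ X)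
  obtain ⟨S, hS_def⟩ : ∃ S : E → (X →L[ℝ] X), ∀ z, S z = 1 - K (a z) := ⟨_, fun _ => rfl⟩
  have hS : AnalyticAt ℝ S 0 := by
    have h := (K.analyticAt (a 0)).comp ha
    exact (analyticAt_const.sub h).congr (Eventually.of_forall fun z => (hS_def z).symm)
  have hS0 : S 0 = 1 := by rw [hS_def, ha0, map_zero, sub_zero]
  have hSu : ∀ᶠ z in 𝓝 0, IsUnit (S z) := by
    have : {T : X →L[ℝ] X | IsUnit T} ∈ 𝓝 (S 0) := by
      rw [hS0]; exact Units.isOpen.mem_nhds isUnit_one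
    exact hS.continuousAt this
  have hU : AnalyticAt ℝ (fun z => Ring.inverse (S z) 1) 0 := by
    have h1 : AnalyticAt ℝ Ring.inverse (S 0) := by
      rw [hS0]; exact analyticAt_inverse 1
    have h2 := h1.comp hS
    exact ((ContinuousLinearMap.apply ℝ X (1 : X)).analyticAt _).comp h2
  refine ⟨_, hU, by simp [hS0], ?_⟩
  filter_upwards [hSu] with z hz
  have hSv : ∀ v, S z v = v - J (a z * v) := fun v => by rw [hS_def]; rfl
  constructor
  · have h : S z (Ring.inverse (S z) 1) = 1 :=
      DFunLike.congr_fun (Ring.mul_inverse_cancel _ hz) (1 : X)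
    rw [hSv] at h
    exact sub_eq_iff_eq_add.1 h
  · intro v hv
    have h := DFunLike.congr_fun (Ring.inverse_mul_cancel _ hz) v
    have h2 : S z v = 1 := by
      rw [hSv]
      exact sub_eq_iff_eq_add.2 hv
    have h3 : Ring.inverse (S z) (S z v) = v := h
    rw [← h3, h2]

/-- The radial part `∂u(z)·z = A(z)(z) u(z)`, `u(0) = 1`, of a linear total differential equation
with analytic coefficients has an analytic solution. -/
theorem exists_analyticAt_radial {E W : Type*} [NormedAddCommGroup E] [NormedSpace ℝ E]
    [NormedRing W] [NormedAlgebra ℝ W] [CompleteSpace W]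
    {A : E → E →L[ℝ] W} (hA : AnalyticAt ℝ A 0) :
    ∃ u : E → W, AnalyticAt ℝ u 0 ∧ u 0 = 1 ∧
      ∀ᶠ z in 𝓝 0, fderiv ℝ u z z = A z z * u z := by
  obtain ⟨q, hq, hqA⟩ := exists_analyticAt_ray hA
  obtain ⟨a, ha_def⟩ : ∃ a : E → C(unitInterval, W), ∀ z, a z = curveApply E W z (q z) :=
    ⟨_, fun _ => rfl⟩
  have ha : AnalyticAt ℝ a 0 := by
    have h := ((curveApply E W).analyticAt_bilinear ((0 : E), q 0)).comp₂
      (f := fun z : E => z) (g := q) analyticAt_id hq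
    exact h.congr (Eventually.of_forall fun z => (ha_def z).symm)
  have haA : ∀ᶠ z in 𝓝 0, ∀ s : unitInterval, a z s = A ((s : ℝ) • z) z := by
    filter_upwards [hqA] with z hz s
    rw [ha_def, curveApply_apply, hz]
  have ha0 : a 0 = 0 := by rw [ha_def]; simp
  obtain ⟨U, hU, hU0, hUJ⟩ := exists_analyticAt_one_add_mul (curvePrimitive W) ha ha0
  obtain ⟨u, hu_def⟩ : ∃ u : E → W, ∀ z, u z = U z 1 := ⟨_, fun _ => rfl⟩
  have hu : AnalyticAt ℝ u 0 := by
    have h := ((ContinuousMap.evalCLM ℝ (1 : unitInterval)).analyticAt (U 0)).comp hU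
    exact h.congr (Eventually.of_forall fun z => (hu_def z).symm)
  refine ⟨u, hu, ?_, ?_⟩
  · rw [hu_def, hU0]; rfl
  obtain ⟨r, hr, hball⟩ := Metric.eventually_nhds_iff_ball.1
    (haA.and (hUJ.and hu.eventually_analyticAt))
  filter_upwards [Metric.ball_mem_nhds (0 : E) hr] with z hz
  have hmem : ∀ t : unitInterval, (t : ℝ) • z ∈ Metric.ball (0 : E) r := by
    intro t
    rw [mem_ball_zero_iff] at hz ⊢
    refine lt_of_le_of_lt ?_ hz
    rw [norm_smul, Real.norm_of_nonneg t.2.1]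
    exact mul_le_of_le_one_left (norm_nonneg z) t.2.2
  obtain ⟨hz1, hz2, hz3⟩ := hball z hz
  have hUeq : ∀ t : unitInterval, U z t = 1 + ∫ s in (0 : ℝ)..t,
      a z (Set.projIcc 0 1 zero_le_one s) * U z (Set.projIcc 0 1 zero_le_one s) := fun t =>
    DFunLike.congr_fun hz2.1 t
  have hscale : ∀ t : unitInterval, u ((t : ℝ) • z) = U z t := by
    intro t
    obtain ⟨ht1, ht2, -⟩ := hball _ (hmem t)
    let v : C(unitInterval, W) := (U z).comp ⟨fun s => t * s, by fun_prop⟩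
    have hv : v = U ((t : ℝ) • z) := by
      apply ht2.2
      ext s
      change U z (t * s) = 1 + ∫ r in (0 : ℝ)..s, a ((t : ℝ) • z)
        (Set.projIcc 0 1 zero_le_one r) * v (Set.projIcc 0 1 zero_le_one r)
      have e2 : (∫ r in (0 : ℝ)..s, a ((t : ℝ) • z) (Set.projIcc 0 1 zero_le_one r) *
          v (Set.projIcc 0 1 zero_le_one r)) = (t : ℝ) • ∫ r in (0 : ℝ)..s,
          (fun r => a z (Set.projIcc 0 1 zero_le_one r) *
            U z (Set.projIcc 0 1 zero_le_one r)) ((t : ℝ) * r) := by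
        rw [← intervalIntegral.integral_smul]
        apply intervalIntegral.integral_congr
        intro r hr
        rw [Set.uIcc_of_le s.2.1] at hr
        have hr1 : r ∈ Set.Icc (0 : ℝ) 1 := ⟨hr.1, hr.2.trans s.2.2⟩
        have hr2 : (t : ℝ) * r ∈ Set.Icc (0 : ℝ) 1 := (t * ⟨r, hr1⟩ : unitInterval).2
        simp only
        rw [Set.projIcc_of_mem _ hr1, Set.projIcc_of_mem _ hr2, ht1, hz1, map_smul,
          smul_mul_assoc, smul_smul]
        simp only [mul_comm r]
        rfl
      rw [hUeq, e2, intervalIntegral.smul_integral_comp_mul_left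
        (f := fun r => a z (Set.projIcc 0 1 zero_le_one r) * U z (Set.projIcc 0 1 zero_le_one r)),
        mul_zero]
      rfl
    rw [hu_def, ← hv]
    simp [v]
  have hc : Continuous fun s : ℝ => a z (Set.projIcc 0 1 zero_le_one s) *
      U z (Set.projIcc 0 1 zero_le_one s) :=
    ((a z).continuous.comp continuous_projIcc).mul ((U z).continuous.comp continuous_projIcc)
  have hg : HasDerivAt (fun t : ℝ => 1 + ∫ s in (0 : ℝ)..t,
      a z (Set.projIcc 0 1 zero_le_one s) * U z (Set.projIcc 0 1 zero_le_one s))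
      (A z z * u z) 1 := by
    have := (hc.integral_hasStrictDerivAt 0 1).hasDerivAt.const_add (1 : W)
    rw [Set.projIcc_of_mem _ (⟨zero_le_one, le_rfl⟩ : (1 : ℝ) ∈ Set.Icc (0 : ℝ) 1), hz1] at this
    simp only [one_smul] at this
    rw [hu_def]
    exact this
  have hf : HasDerivAt (fun t : ℝ => u (t • z)) (fderiv ℝ u z z) 1 := by
    have h1 : HasFDerivAt u (fderiv ℝ u z) ((1 : ℝ) • z) := by
      rw [one_smul]; exact hz3.differentiableAt.hasFDerivAt
    have h2 : HasDerivAt (fun t : ℝ => t • z) z 1 := by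
      simpa using (hasDerivAt_id (1 : ℝ)).smul_const z
    exact h1.comp_hasDerivAt 1 h2
  have hf' := hf.hasDerivWithinAt (s := Set.Icc 0 1)
  have hg' := hg.hasDerivWithinAt (s := Set.Icc 0 1)
  have hone : (1 : ℝ) ∈ Set.Icc (0 : ℝ) 1 := ⟨zero_le_one, le_rfl⟩
  refine ((uniqueDiffOn_Icc zero_lt_one 1 hone).eq_deriv _ hf' (hg'.congr_of_mem ?_ hone))
  intro t ht
  rw [hscale ⟨t, ht⟩, hUeq]

/-- **Frobenius theorem** for linear total differential equations with analytic coefficients. -/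
theorem exists_analyticAt_fundamental {E W : Type*} [NormedAddCommGroup E] [NormedSpace ℝ E]
    [NormedRing W] [NormedAlgebra ℝ W] [CompleteSpace W]
    {A : E → E →L[ℝ] W} (hA : AnalyticAt ℝ A 0)
    (hflat : ∀ᶠ z in 𝓝 0, ∀ v w, fderiv ℝ A z v w - fderiv ℝ A z w v
      + A z w * A z v - A z v * A z w = 0) :
    ∃ u : E → W, AnalyticAt ℝ u 0 ∧ u 0 = 1 ∧
      ∀ᶠ z in 𝓝 0, ∀ v, fderiv ℝ u z v = A z v * u z := by
  obtain ⟨u, hu, hu0, hrad⟩ := exists_analyticAt_radial hA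
  refine ⟨u, hu, hu0, ?_⟩
  obtain ⟨r, hr, hball⟩ := Metric.eventually_nhds_iff_ball.1
    (hflat.and (hrad.eventually_nhds.and (hu.eventually_analyticAt.and hA.eventually_analyticAt)))
  filter_upwards [Metric.ball_mem_nhds (0 : E) hr] with z hz v
  have hmem : ∀ t ∈ Set.Icc (0 : ℝ) 1, t • z ∈ Metric.ball (0 : E) r := by
    intro t ht
    rw [mem_ball_zero_iff] at hz ⊢
    refine lt_of_le_of_lt ?_ hz
    rw [norm_smul, Real.norm_of_nonneg ht.1]
    exact mul_le_of_le_one_left (norm_nonneg z) ht.2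
  let V : E → W := fun y => fderiv ℝ u y v - A y v * u y
  have hVd : ∀ y ∈ Metric.ball (0 : E) r,
      fderiv ℝ V y y = - V y + A y y * V y ∧ DifferentiableAt ℝ V y := by
    intro y hy
    obtain ⟨hfl, hra, hua, hAa⟩ := hball y hy
    have hu1 : HasFDerivAt u (fderiv ℝ u y) y := hua.differentiableAt.hasFDerivAt
    have hu2 : HasFDerivAt (fderiv ℝ u) (fderiv ℝ (fderiv ℝ u) y) y :=
      hua.fderiv.differentiableAt.hasFDerivAt
    have hA1 : HasFDerivAt A (fderiv ℝ A y) y := hAa.differentiableAt.hasFDerivAt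
    have hsymm : fderiv ℝ (fderiv ℝ u) y v y = fderiv ℝ (fderiv ℝ u) y y v :=
      (ContDiffAt.isSymmSndFDerivAt (n := 2) hua.contDiffAt (by simp)) v y
    have h1 := hu2.clm_apply (hasFDerivAt_id y)
    have h2 := (hA1.clm_apply (hasFDerivAt_id y)).mul' hu1
    have h3 := (h1.unique (h2.congr_of_eventuallyEq hra))
    have h4 := DFunLike.congr_fun h3 v
    have h5 := (hu2.clm_apply (hasFDerivAt_const v y)).sub
      ((hA1.clm_apply (hasFDerivAt_const v y)).mul' hu1)
    refine ⟨?_, h5.differentiableAt⟩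
    have h6 : fderiv ℝ V y = _ := h5.fderiv
    rw [h6]
    have h7 := hfl y v
    have h8 := hra.self_of_nhds
    simp [smul_eq_mul] at h4 h8 ⊢
    simp only [V]
    rw [← hsymm]
    have h9 : fderiv ℝ (fderiv ℝ u) y v y = A y y * (fderiv ℝ u y) v + A y v * u y
      + (fderiv ℝ A y) v y * u y - fderiv ℝ u y v := by
      rw [eq_sub_iff_add_eq, ← add_comm, h4]; abel
    rw [h9, h8]
    have h10 : fderiv ℝ A y y v = fderiv ℝ A y v y - A y v * A y y + A y y * A y v := by
      rw [← sub_eq_zero, ← h7]; noncomm_ring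
    rw [h10]
    noncomm_ring
  have hcurve : ∀ t ∈ Set.Icc (0 : ℝ) 1,
      HasDerivAt (fun t : ℝ => t • V (t • z)) (A (t • z) z * (t • V (t • z))) t := by
    intro t ht
    obtain ⟨h1, h2⟩ := hVd _ (hmem t ht)
    have h3 : HasDerivAt (fun t : ℝ => t • z) z t := by
      simpa using (hasDerivAt_id t).smul_const z
    have h4 := (hasDerivAt_id t).smul (h2.hasFDerivAt.comp_hasDerivAt t h3)
    refine h4.congr_deriv ?_
    have h5 : t • fderiv ℝ V (t • z) z = - V (t • z) + t • (A (t • z) z * V (t • z)) := by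
      rw [← map_smul, h1, map_smul, smul_mul_assoc]
    simp only [id, Function.comp, one_smul, h5, mul_smul_comm]
    abel
  obtain ⟨C, hC⟩ : ∃ C, ∀ t ∈ Set.Icc (0 : ℝ) 1, ‖A (t • z) z‖ ≤ C := by
    apply isCompact_Icc.exists_bound_of_continuousOn
    intro t ht
    have h1 : ContinuousAt A (t • z) := (hball _ (hmem t ht)).2.2.2.continuousAt
    have h2 : ContinuousAt (fun t : ℝ => t • z) t := by fun_prop
    have h3 : ContinuousAt (fun t : ℝ => A (t • z)) t := ContinuousAt.comp (g := A) h1 h2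
    exact (h3.clm_apply continuousAt_const).continuousWithinAt
  have hzero := eq_zero_of_abs_deriv_le_mul_abs_self_of_eq_zero_right
    (f := fun t : ℝ => t • V (t • z)) (f' := fun t => A (t • z) z * (t • V (t • z)))
    (a := 0) (b := 1) (K := C)
    (fun t ht => (hcurve t ht).continuousAt.continuousWithinAt)
    (fun t ht => (hcurve t ⟨ht.1, ht.2.le⟩).hasDerivWithinAt) (by simp)
    (fun t ht => (norm_mul_le _ _).trans (by gcongr; exact hC t ⟨ht.1, ht.2.le⟩))
    1 ⟨zero_le_one, le_rfl⟩
  simp only [one_smul] at hzero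
  exact sub_eq_zero.1 hzero

theorem fderiv_apply_eq_sum {ι W : Type*} [Fintype ι] [DecidableEq ι] [NormedAddCommGroup W]
    [NormedSpace ℝ W] (f : (ι → ℝ) → W) (z v : ι → ℝ) :
    fderiv ℝ f z v = ∑ i, v i • fderiv ℝ f z (Pi.single i 1) := by
  conv_lhs => rw [pi_eq_sum_univ' v]
  simp only [map_sum, map_smul]

/-- Frobenius theorem for `∂ᵢ u = αᵢ u` in a Banach algebra. -/
theorem exists_analyticAt_fundamental_coord {ι W : Type*} [Fintype ι] [DecidableEq ι]
    [NormedRing W] [NormedAlgebra ℝ W] [CompleteSpace W] {α : ι → (ι → ℝ) → W}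
    (hα : ∀ i, AnalyticAt ℝ (α i) 0)
    (hflat : ∀ᶠ z in 𝓝 0, ∀ i j, fderiv ℝ (α j) z (Pi.single i 1)
      - fderiv ℝ (α i) z (Pi.single j 1) + α j z * α i z - α i z * α j z = 0) :
    ∃ u : (ι → ℝ) → W, AnalyticAt ℝ u 0 ∧ u 0 = 1 ∧
      ∀ᶠ z in 𝓝 0, ∀ i, fderiv ℝ u z (Pi.single i 1) = α i z * u z := by
  let T : ι → W →L[ℝ] (ι → ℝ) →L[ℝ] W := fun i =>
    ContinuousLinearMap.smulRightL ℝ (ι → ℝ) W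
      (ContinuousLinearMap.proj (R := ℝ) (φ := fun _ : ι => ℝ) i)
  have hT : ∀ i w v, T i w v = v i • w := fun _ _ _ => rfl
  obtain ⟨A, hA_def⟩ : ∃ A : (ι → ℝ) → (ι → ℝ) →L[ℝ] W, A = fun z => ∑ i, T i (α i z) :=
    ⟨_, rfl⟩
  have hA : AnalyticAt ℝ A 0 := by
    rw [hA_def]
    exact Finset.analyticAt_fun_sum _ fun i _ => ((T i).analyticAt _).comp (hα i)
  have hAz : ∀ z v, A z v = ∑ i, v i • α i z := by
    intro z v
    simp only [hA_def, _root_.sum_apply, hT]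
  obtain ⟨u, hu, hu0, hueq⟩ := exists_analyticAt_fundamental hA (by
    have han : ∀ᶠ z in 𝓝 0, ∀ i, AnalyticAt ℝ (α i) z :=
      eventually_all.2 fun i => (hα i).eventually_analyticAt
    filter_upwards [hflat, han] with z hz hd v w
    have h1 : HasFDerivAt A (∑ i, (T i).comp (fderiv ℝ (α i) z)) z := by
      rw [hA_def]
      exact HasFDerivAt.fun_sum fun i _ =>
        (T i).hasFDerivAt.comp z (hd i).differentiableAt.hasFDerivAt
    have h2 : ∀ v w, fderiv ℝ A z v w
        = ∑ i, ∑ j, (v i * w j) • fderiv ℝ (α j) z (Pi.single i 1) := by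
      intro v w
      rw [h1.fderiv, Finset.sum_comm]
      simp only [_root_.sum_apply, ContinuousLinearMap.comp_apply, hT]
      refine Finset.sum_congr rfl fun j _ => ?_
      rw [fderiv_apply_eq_sum, Finset.smul_sum]
      simp only [smul_smul, mul_comm]
    have h3 : ∀ v w, A z w * A z v = ∑ i, ∑ j, (v i * w j) • (α j z * α i z) := by
      intro v w
      rw [hAz, hAz, Finset.sum_mul_sum, Finset.sum_comm]
      simp only [smul_mul_smul_comm, mul_comm (w _)]
    have h4 : fderiv ℝ A z w v = ∑ i, ∑ j, (v i * w j) • fderiv ℝ (α i) z (Pi.single j 1) := by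
      rw [h2, Finset.sum_comm]
      simp only [mul_comm (w _)]
    have h5 : A z v * A z w = ∑ i, ∑ j, (v i * w j) • (α i z * α j z) := by
      rw [h3, Finset.sum_comm]
      simp only [mul_comm (w _)]
    rw [h2, h4, h3, h5]
    simp only [← Finset.sum_sub_distrib, ← Finset.sum_add_distrib, ← smul_sub, ← smul_add, hz,
      smul_zero, Finset.sum_const_zero])
  refine ⟨u, hu, hu0, ?_⟩
  filter_upwards [hueq] with z hz i
  rw [hz, hAz, Finset.sum_eq_single i (fun j _ hj => by simp [hj]) (by simp)]
  simp

/-- Coordinate form of the Frobenius theorem for linear total differential systems. -/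
theorem exists_analyticAt_linear_system {m : ℕ} {κ : Type*} [Fintype κ] [DecidableEq κ]
    {a : Fin (m + 1) → κ → κ → (Fin (m + 1) → ℝ) → ℝ}
    (ha : ∀ i b c, AnalyticAt ℝ (a i b c) 0)
    (hflat : ∀ᶠ z in 𝓝 0, ∀ i j b c, pd m i (a j b c) z - pd m j (a i b c) z
      + ∑ d, a j b d z * a i d c z - ∑ d, a i b d z * a j d c z = 0)
    (u₀ : κ → ℝ) :
    ∃ u : κ → (Fin (m + 1) → ℝ) → ℝ, (∀ b, AnalyticAt ℝ (u b) 0) ∧ (∀ b, u b 0 = u₀ b) ∧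
      ∀ᶠ z in 𝓝 0, ∀ i b, pd m i (u b) z = ∑ c, a i b c z * u c z := by
  let N : κ → κ → (κ → ℝ) →L[ℝ] (κ → ℝ) := fun b c =>
    (ContinuousLinearMap.proj (R := ℝ) (φ := fun _ : κ => ℝ) c).smulRight (Pi.single b 1)
  have hN : ∀ b c x d, N b c x d = if d = b then x c else 0 := by
    intro b c x d
    simp [N, Pi.single_apply]
  obtain ⟨α, hα_def⟩ : ∃ α : Fin (m + 1) → (Fin (m + 1) → ℝ) → ((κ → ℝ) →L[ℝ] (κ → ℝ)),
      α = fun i z => ∑ b, ∑ c, a i b c z • N b c := ⟨_, rfl⟩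
  have hαa : ∀ i, AnalyticAt ℝ (α i) 0 := fun i => by
    rw [hα_def]
    exact Finset.analyticAt_fun_sum _ fun b _ => Finset.analyticAt_fun_sum _ fun c _ =>
      (ha i b c).smul analyticAt_const
  have hα : ∀ i z x b, α i z x b = ∑ c, a i b c z * x c := by
    intro i z x b
    simp [hα_def, Finset.sum_apply, hN]
  obtain ⟨u, hu, hu0, hueq⟩ := exists_analyticAt_fundamental_coord hαa (by
    have han : ∀ᶠ z in 𝓝 0, ∀ i b c, AnalyticAt ℝ (a i b c) z := by
      simp only [eventually_all]
      exact fun i b c => (ha i b c).eventually_analyticAt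
    filter_upwards [hflat, han] with z hz hd i j
    have h1 : ∀ i v x b, fderiv ℝ (α i) z v x b = ∑ c, fderiv ℝ (a i b c) z v * x c := by
      intro i v x b
      have h : HasFDerivAt (α i)
          (∑ b, ∑ c, (fderiv ℝ (a i b c) z).smulRight (N b c)) z := by
        rw [hα_def]
        exact HasFDerivAt.fun_sum fun b _ => HasFDerivAt.fun_sum fun c _ =>
          (hd i b c).differentiableAt.hasFDerivAt.smul_const (N b c)
      rw [h.fderiv]
      simp [Finset.sum_apply, hN]
    have h2 : ∀ i j x b, (α j z * α i z) x b = ∑ c, (∑ d, a j b d z * a i d c z) * x c := by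
      intro i j x b
      rw [mul_apply_eq_comp, hα]
      simp only [hα, Finset.mul_sum, Finset.sum_mul]
      rw [Finset.sum_comm]
      simp only [mul_assoc]
    ext x b
    simp only [_root_.add_apply, _root_.sub_apply, Pi.add_apply,
      Pi.sub_apply, h1, h2, ← Finset.sum_sub_distrib, ← Finset.sum_add_distrib, ← add_mul,
      ← sub_mul]
    refine Finset.sum_eq_zero fun c _ => ?_
    have := hz i j b c
    simp only [pd] at this
    rw [this, zero_mul])
  let ev : κ → ((κ → ℝ) →L[ℝ] (κ → ℝ)) →L[ℝ] ℝ := fun b =>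
    (ContinuousLinearMap.proj (R := ℝ) (φ := fun _ : κ => ℝ) b).comp
      (ContinuousLinearMap.apply ℝ (κ → ℝ) u₀)
  have hev : ∀ b T, ev b T = T u₀ b := fun _ _ => rfl
  refine ⟨fun b z => u z u₀ b, fun b => ((ev b).analyticAt _).comp hu, fun b => by simp [hu0], ?_⟩
  filter_upwards [hueq, hu.eventually_analyticAt] with z hz hd i b
  have h : HasFDerivAt (fun z => u z u₀ b) ((ev b).comp (fderiv ℝ u z)) z :=
    (ev b).hasFDerivAt.comp z hd.differentiableAt.hasFDerivAt
  rw [pd, h.fderiv, ContinuousLinearMap.comp_apply, hz, hev, mul_apply_eq_comp, hα]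

theorem pd_add {m : ℕ} {i : Fin (m + 1)} {f g : (Fin (m + 1) → ℝ) → ℝ} {z : Fin (m + 1) → ℝ}
    (hf : AnalyticAt ℝ f z) (hg : AnalyticAt ℝ g z) :
    pd m i (fun w => f w + g w) z = pd m i f z + pd m i g z := by
  simp only [pd]
  rw [fderiv_fun_add hf.differentiableAt hg.differentiableAt]; rfl

theorem pd_sub {m : ℕ} {i : Fin (m + 1)} {f g : (Fin (m + 1) → ℝ) → ℝ} {z : Fin (m + 1) → ℝ}
    (hf : AnalyticAt ℝ f z) (hg : AnalyticAt ℝ g z) :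
    pd m i (fun w => f w - g w) z = pd m i f z - pd m i g z := by
  simp only [pd]
  rw [fderiv_fun_sub hf.differentiableAt hg.differentiableAt]; rfl

theorem pd_neg {m : ℕ} {i : Fin (m + 1)} {f : (Fin (m + 1) → ℝ) → ℝ} {z : Fin (m + 1) → ℝ} :
    pd m i (fun w => -f w) z = -pd m i f z := by
  simp only [pd]
  rw [fderiv_fun_neg]; rfl

theorem pd_mul {m : ℕ} {i : Fin (m + 1)} {f g : (Fin (m + 1) → ℝ) → ℝ} {z : Fin (m + 1) → ℝ}
    (hf : AnalyticAt ℝ f z) (hg : AnalyticAt ℝ g z) :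
    pd m i (fun w => f w * g w) z = pd m i f z * g z + f z * pd m i g z := by
  simp only [pd]
  rw [fderiv_fun_mul hf.differentiableAt hg.differentiableAt]
  simp [add_comm, mul_comm]

theorem pd_const {m : ℕ} {i : Fin (m + 1)} {c : ℝ} {z : Fin (m + 1) → ℝ} :
    pd m i (fun _ => c) z = 0 := by
  simp [pd]

theorem pd_const_mul {m : ℕ} {i : Fin (m + 1)} {f : (Fin (m + 1) → ℝ) → ℝ}
    {z : Fin (m + 1) → ℝ} (hf : AnalyticAt ℝ f z) (c : ℝ) :
    pd m i (fun w => c * f w) z = c * pd m i f z := by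
  rw [pd_mul analyticAt_const hf, pd_const]; ring

theorem pd_sum {m : ℕ} {κ : Type*} {s : Finset κ} {i : Fin (m + 1)}
    {f : κ → (Fin (m + 1) → ℝ) → ℝ} {z : Fin (m + 1) → ℝ} (hf : ∀ k, AnalyticAt ℝ (f k) z) :
    pd m i (fun w => ∑ k ∈ s, f k w) z = ∑ k ∈ s, pd m i (f k) z := by
  simp only [pd]
  rw [fderiv_fun_sum fun k _ => (hf k).differentiableAt]
  simp

theorem AnalyticAt.pd {m : ℕ} {i : Fin (m + 1)} {f : (Fin (m + 1) → ℝ) → ℝ}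
    {z : Fin (m + 1) → ℝ} (hf : AnalyticAt ℝ f z) : AnalyticAt ℝ (pd m i f) z :=
  ((ContinuousLinearMap.apply ℝ ℝ (Pi.single i 1 : Fin (m + 1) → ℝ)).analyticAt _).comp hf.fderiv

theorem pd_comm {m : ℕ} (i j : Fin (m + 1)) {f : (Fin (m + 1) → ℝ) → ℝ}
    {z : Fin (m + 1) → ℝ} (hf : AnalyticAt ℝ f z) :
    pd m i (pd m j f) z = pd m j (pd m i f) z := by
  have h (a b : Fin (m + 1)) : pd m a (pd m b f) z =
      fderiv ℝ (fderiv ℝ f) z (Pi.single a 1) (Pi.single b 1) := by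
    have := hf.fderiv.differentiableAt.hasFDerivAt.clm_apply
      (hasFDerivAt_const (Pi.single b 1 : Fin (m + 1) → ℝ) z)
    change fderiv ℝ (fun w => fderiv ℝ f w (Pi.single b 1)) z _ = _
    rw [this.fderiv]; simp
  rw [h, h]
  exact ContDiffAt.isSymmSndFDerivAt (n := 2) hf.contDiffAt (by simp) _ _

theorem pd_congr {m : ℕ} {i : Fin (m + 1)} {f g : (Fin (m + 1) → ℝ) → ℝ}
    {z : Fin (m + 1) → ℝ} (h : ∀ᶠ w in 𝓝 z, f w = g w) : pd m i f z = pd m i g z := by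
  simp only [pd]
  rw [Filter.EventuallyEq.fderiv_eq h]

theorem analyticAt_sum {m : ℕ} {κ : Type*} {s : Finset κ}
    {f : κ → (Fin (m + 1) → ℝ) → ℝ} {z : Fin (m + 1) → ℝ} (hf : ∀ k, AnalyticAt ℝ (f k) z) :
    AnalyticAt ℝ (fun w => ∑ k ∈ s, f k w) z :=
  s.analyticAt_fun_sum fun k _ => hf k

theorem sum_kd_mul {n : ℕ} (a : Fin n) (f : Fin n → ℝ) : ∑ k, kd k a * f k = f a := by
  simp [kd]

theorem sum_kd_mul' {n : ℕ} (a : Fin n) (f : Fin n → ℝ) : ∑ k, kd a k * f k = f a := by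
  simp [kd]

theorem kd_comm {n : ℕ} (a b : Fin n) : kd a b = kd b a := by
  simp [kd, eq_comm]

theorem kd_self {n : ℕ} (a : Fin n) : kd a a = 1 := by simp [kd]

theorem kd_of_ne {n : ℕ} {a b : Fin n} (h : a ≠ b) : kd a b = 0 := by simp [kd, h]

/-- Curvature of the connection `Γ k i j`. -/
noncomputable def curv (m : ℕ) (Γ : Fin (m + 1) → Fin (m + 1) → Fin (m + 1) → (Fin (m + 1) → ℝ) → ℝ)
    (k j l i : Fin (m + 1)) (z : Fin (m + 1) → ℝ) : ℝ :=
  pd m l (Γ k i j) z - pd m i (Γ k l j) z + ∑ r, Γ r i j z * Γ k r l z - ∑ r, Γ r l j z * Γ k r i z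

/-- The part of a curvature tensor determined by the tensor `P`. -/
noncomputable def traceCurv {n : ℕ} (P : Fin n → Fin n → ℝ) (k j l i : Fin n) : ℝ :=
  kd k j * (P l i - P i l) + kd k i * P l j - kd k l * P i j

/-- Projective change of the connection `Γ` by the one-form `ω`. -/
noncomputable def projChange {m : ℕ}
    (Γ : Fin (m + 1) → Fin (m + 1) → Fin (m + 1) → (Fin (m + 1) → ℝ) → ℝ)
    (ω : Fin (m + 1) → (Fin (m + 1) → ℝ) → ℝ) (k i j : Fin (m + 1)) (z : Fin (m + 1) → ℝ) : ℝ :=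
  Γ k i j z + kd k i * ω j z + kd k j * ω i z

/-- The change of the tensor `P` under a projective change by `ω`. -/
noncomputable def schoutenChange (m : ℕ)
    (Γ : Fin (m + 1) → Fin (m + 1) → Fin (m + 1) → (Fin (m + 1) → ℝ) → ℝ)
    (ω : Fin (m + 1) → (Fin (m + 1) → ℝ) → ℝ) (l j : Fin (m + 1)) (z : Fin (m + 1) → ℝ) : ℝ :=
  pd m l (ω j) z - ∑ r, Γ r l j z * ω r z - ω l z * ω j z

theorem sum_projChange_mul {n : ℕ} (A B W : Fin n → ℝ) (i j k l : Fin n) (a b c : ℝ) :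
    ∑ r, (A r + kd r i * a + kd r j * b) * (B r + kd k r * c + kd k l * W r) =
      ∑ r, A r * B r + A k * c + kd k l * ∑ r, A r * W r + a * (B i + kd k i * c + kd k l * W i)
        + b * (B j + kd k j * c + kd k l * W j) := by
  have h1 : ∀ r, (A r + kd r i * a + kd r j * b) * (B r + kd k r * c + kd k l * W r) =
      A r * B r + kd k r * (A r * c) + kd k l * (A r * W r)
        + kd r i * (a * (B r + kd k r * c + kd k l * W r))
        + kd r j * (b * (B r + kd k r * c + kd k l * W r)) := fun r => by ring
  simp only [h1, Finset.sum_add_distrib, sum_kd_mul, sum_kd_mul', ← Finset.mul_sum]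

theorem curv_projChange {m : ℕ}
    {Γ : Fin (m + 1) → Fin (m + 1) → Fin (m + 1) → (Fin (m + 1) → ℝ) → ℝ}
    {ω : Fin (m + 1) → (Fin (m + 1) → ℝ) → ℝ} {z : Fin (m + 1) → ℝ}
    (hΓ : ∀ k i j, AnalyticAt ℝ (Γ k i j) z) (hω : ∀ i, AnalyticAt ℝ (ω i) z)
    (hsymm : ∀ k i j, Γ k i j z = Γ k j i z) (k j l i : Fin (m + 1)) :
    curv m (projChange Γ ω) k j l i z =
      curv m Γ k j l i z + traceCurv (fun l j => schoutenChange m Γ ω l j z) k j l i := by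
  have hpd : ∀ k i j l, pd m l (projChange Γ ω k i j) z =
      pd m l (Γ k i j) z + kd k i * pd m l (ω j) z + kd k j * pd m l (ω i) z := by
    intro k i j l
    have h (a b c : Fin (m + 1)) : AnalyticAt ℝ (fun w => kd a b * ω c w) z :=
      analyticAt_const.mul (hω c)
    change pd m l (fun w => Γ k i j w + kd k i * ω j w + kd k j * ω i w) z = _
    rw [pd_add ((hΓ k i j).fun_add (h _ _ _)) (h _ _ _), pd_add (hΓ k i j) (h _ _ _),
      pd_const_mul (hω _), pd_const_mul (hω _)]
  simp only [curv, hpd]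
  simp only [projChange, sum_projChange_mul, traceCurv, schoutenChange]
  have hs : ∑ r, Γ r i l z * ω r z = ∑ r, Γ r l i z * ω r z :=
    Finset.sum_congr rfl fun r _ => by rw [hsymm r i l]
  rw [hsymm k i l, hs]
  rw [hsymm k j l, hsymm k j i]
  ring

theorem curv_antisymm {m : ℕ} (Γ : Fin (m + 1) → Fin (m + 1) → Fin (m + 1) → (Fin (m + 1) → ℝ) → ℝ)
    (k j l i : Fin (m + 1)) (z : Fin (m + 1) → ℝ) : curv m Γ k j l i z = -curv m Γ k j i l z := by
  simp only [curv]; ring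

theorem traceCurv_antisymm {n : ℕ} (P : Fin n → Fin n → ℝ) (k j l i : Fin n) :
    traceCurv P k j l i = -traceCurv P k j i l := by
  simp only [traceCurv]; ring

theorem curv_cyclic {m : ℕ}
    {Γ : Fin (m + 1) → Fin (m + 1) → Fin (m + 1) → (Fin (m + 1) → ℝ) → ℝ} {z : Fin (m + 1) → ℝ}
    (hsymm : ∀ᶠ w in 𝓝 z, ∀ k i j, Γ k i j w = Γ k j i w) (k j l i : Fin (m + 1)) :
    curv m Γ k j l i z + curv m Γ k l i j z + curv m Γ k i j l z = 0 := by
  have h (a b c d) : pd m a (Γ b c d) z = pd m a (Γ b d c) z :=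
    pd_congr (hsymm.mono fun w hw => hw b c d)
  simp only [curv]
  rw [h l k i j, h i k l j, h j k i l]
  simp only [hsymm.self_of_nhds _ i j, hsymm.self_of_nhds _ l j, hsymm.self_of_nhds _ i l]
  ring

theorem traceCurv_cyclic {n : ℕ} (P : Fin n → Fin n → ℝ) (k j l i : Fin n) :
    traceCurv P k j l i + traceCurv P k l i j + traceCurv P k i j l = 0 := by
  simp only [traceCurv]; ring

/-- The tensor `P` of a trace-free connection is symmetric. -/
theorem symm_of_curv_eq_traceCurv {m : ℕ}
    {Γ : Fin (m + 1) → Fin (m + 1) → Fin (m + 1) → (Fin (m + 1) → ℝ) → ℝ} {z : Fin (m + 1) → ℝ}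
    {P : Fin (m + 1) → Fin (m + 1) → ℝ}
    (hΓ : ∀ k i j, AnalyticAt ℝ (Γ k i j) z) (hsymm : ∀ k i j, Γ k i j z = Γ k j i z)
    (htr : ∀ᶠ w in 𝓝 z, ∀ i, ∑ k, Γ k i k w = 0)
    (hP : ∀ k j l i, curv m Γ k j l i z = traceCurv P k j l i) (l i : Fin (m + 1)) :
    P l i = P i l := by
  have h1 : ∑ k, curv m Γ k k l i z = 0 := by
    have hd (a b) : ∑ k, pd m a (Γ k b k) z = 0 := by
      rw [← pd_sum fun k => hΓ k b k, pd_congr (htr.mono fun w hw => hw b), pd_const]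
    simp only [curv, Finset.sum_sub_distrib, Finset.sum_add_distrib, hd]
    rw [Finset.sum_comm, sub_zero, zero_add, sub_eq_zero]
    refine Finset.sum_congr rfl fun r _ => Finset.sum_congr rfl fun k _ => ?_
    rw [hsymm r i k, hsymm k r l, mul_comm]
  have h2 : ∑ k, traceCurv P k k l i = (m + 2) * (P l i - P i l) := by
    simp only [traceCurv, Finset.sum_sub_distrib, Finset.sum_add_distrib, sum_kd_mul, kd_self]
    simp
    ring
  simp only [hP] at h1
  rw [h2] at h1
  have : (m + 2 : ℝ) ≠ 0 := by positivity
  have := (mul_eq_zero.1 h1).resolve_left this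
  linarith

theorem second_bianchi {m : ℕ}
    {Γ : Fin (m + 1) → Fin (m + 1) → Fin (m + 1) → (Fin (m + 1) → ℝ) → ℝ} {z : Fin (m + 1) → ℝ}
    (hΓ : ∀ k i j, AnalyticAt ℝ (Γ k i j) z)
    (hsymm : ∀ᶠ w in 𝓝 z, ∀ k i j, Γ k i j w = Γ k j i w) (k j a b c : Fin (m + 1)) :
    pd m a (curv m Γ k j b c) z + ∑ r, Γ k a r z * curv m Γ r j b c z
        - ∑ r, curv m Γ k r b c z * Γ r a j z
      + (pd m b (curv m Γ k j c a) z + ∑ r, Γ k b r z * curv m Γ r j c a z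
        - ∑ r, curv m Γ k r c a z * Γ r b j z)
      + (pd m c (curv m Γ k j a b) z + ∑ r, Γ k c r z * curv m Γ r j a b z
        - ∑ r, curv m Γ k r a b z * Γ r c j z) = 0 := by
  let A : Fin (m + 1) → Matrix (Fin (m + 1)) (Fin (m + 1)) ℝ := fun a => .of fun k j => Γ k a j z
  let D : Fin (m + 1) → Fin (m + 1) → Matrix (Fin (m + 1)) (Fin (m + 1)) ℝ :=
    fun a b => .of fun k j => pd m a (Γ k b j) z
  let T : Fin (m + 1) → Fin (m + 1) → Fin (m + 1) → Matrix (Fin (m + 1)) (Fin (m + 1)) ℝ :=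
    fun a b c => .of fun k j => pd m a (pd m b (Γ k c j)) z
  have hT (a b c) : T a b c = T b a c := by
    ext k j; exact pd_comm a b (hΓ k c j)
  let R : Fin (m + 1) → Fin (m + 1) → Matrix (Fin (m + 1)) (Fin (m + 1)) ℝ :=
    fun b c => D b c - D c b + A b * A c - A c * A b
  have hs (k i j) : Γ k i j z = Γ k j i z := hsymm.self_of_nhds k i j
  have hds (a k i j) : pd m a (Γ k i j) z = pd m a (Γ k j i) z :=
    pd_congr (hsymm.mono fun w hw => hw k i j)
  have hR (k j b c) : curv m Γ k j b c z = R b c k j := by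
    simp only [curv, R, Matrix.sub_apply, Matrix.add_apply, Matrix.mul_apply, A, D, Matrix.of_apply]
    simp only [fun r => hs k r b, fun r => hs k r c, mul_comm]
  let S : Fin (m + 1) → Fin (m + 1) → Fin (m + 1) → Matrix (Fin (m + 1)) (Fin (m + 1)) ℝ :=
    fun a b c => T a b c - T a c b + (D a b * A c + A b * D a c) - (D a c * A b + A c * D a b)
  have hS (k j a b c) : pd m a (curv m Γ k j b c) z = S a b c k j := by
    have hm (i j k l p q) : AnalyticAt ℝ (fun w => Γ i j k w * Γ l p q w) z :=
      (hΓ i j k).fun_mul (hΓ l p q)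
    have hsum (f : Fin (m + 1) → (Fin (m + 1) → ℝ) → ℝ) (hf : ∀ r, AnalyticAt ℝ (f r) z) :
      AnalyticAt ℝ (fun w => ∑ r, f r w) z := analyticAt_sum hf
    change pd m a (fun w => pd m b (Γ k c j) w - pd m c (Γ k b j) w + ∑ r, Γ r c j w * Γ k r b w
      - ∑ r, Γ r b j w * Γ k r c w) z = _
    rw [pd_sub ((((hΓ _ _ _).pd).fun_sub (hΓ _ _ _).pd).fun_add (hsum _ fun r => hm _ _ _ _ _ _))
      (hsum _ fun r => hm _ _ _ _ _ _),
      pd_add (((hΓ _ _ _).pd).fun_sub (hΓ _ _ _).pd) (hsum _ fun r => hm _ _ _ _ _ _),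
      pd_sub (hΓ _ _ _).pd (hΓ _ _ _).pd, pd_sum fun r => hm _ _ _ _ _ _,
      pd_sum fun r => hm _ _ _ _ _ _]
    simp only [S, Matrix.sub_apply, Matrix.add_apply, Matrix.mul_apply, A, D, T, Matrix.of_apply,
      pd_mul (hΓ _ _ _) (hΓ _ _ _), Finset.sum_add_distrib]
    simp only [fun r => hs k r b, fun r => hs k r c, fun r => hds a k r b, fun r => hds a k r c,
      mul_comm]
    ring
  have key : S a b c + A a * R b c - R b c * A a + (S b c a + A b * R c a - R c a * A b)
      + (S c a b + A c * R a b - R a b * A c) = 0 := by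
    simp only [S, R, hT b a c, hT c b a, hT c a b]
    noncomm_ring
  have := congrFun (congrFun key k) j
  simp only [Matrix.sub_apply, Matrix.add_apply, Matrix.mul_apply, Matrix.zero_apply] at this
  simp only [hS, hR]
  exact this

theorem cotton_eq_zero {m : ℕ} (hm : 2 ≤ m)
    {Γ : Fin (m + 1) → Fin (m + 1) → Fin (m + 1) → (Fin (m + 1) → ℝ) → ℝ} {z : Fin (m + 1) → ℝ}
    {P : Fin (m + 1) → Fin (m + 1) → (Fin (m + 1) → ℝ) → ℝ}
    (hΓ : ∀ k i j, AnalyticAt ℝ (Γ k i j) z) (hP : ∀ i j, AnalyticAt ℝ (P i j) z)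
    (hsymm : ∀ᶠ w in 𝓝 z, ∀ k i j, Γ k i j w = Γ k j i w)
    (hPs : ∀ᶠ w in 𝓝 z, ∀ i j, P i j w = P j i w)
    (hR : ∀ᶠ w in 𝓝 z, ∀ k j l i, curv m Γ k j l i w = traceCurv (fun a b => P a b w) k j l i)
    (a b j : Fin (m + 1)) :
    pd m a (P b j) z - pd m b (P a j) z + ∑ r, P a r z * Γ r b j z
      - ∑ r, P b r z * Γ r a j z = 0 := by
  rcases eq_or_ne a b with rfl | hab
  · ring
  obtain ⟨c, hca, hcb⟩ : ∃ c : Fin (m + 1), c ≠ a ∧ c ≠ b := by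
    have : ∃ c ∈ (Finset.univ : Finset (Fin (m + 1))), c ∉ ({a, b} : Finset (Fin (m + 1))) := by
      apply Finset.exists_mem_notMem_of_card_lt_card
      rw [Finset.card_pair hab, Finset.card_fin]; omega
    obtain ⟨c, -, hc⟩ := this
    exact ⟨c, by aesop⟩
  have hR' : ∀ᶠ w in 𝓝 z, ∀ k j l i, curv m Γ k j l i w = kd k i * P l j w - kd k l * P i j w := by
    filter_upwards [hR, hPs] with w h1 h2 k j l i
    rw [h1]; simp only [traceCurv]; rw [h2 l i]; ring
  have hd (x k j l i) : pd m x (curv m Γ k j l i) z =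
      kd k i * pd m x (P l j) z - kd k l * pd m x (P i j) z := by
    rw [pd_congr (hR'.mono fun w hw => hw k j l i), pd_sub (analyticAt_const.fun_mul (hP _ _))
      (analyticAt_const.fun_mul (hP _ _)), pd_const_mul (hP _ _), pd_const_mul (hP _ _)]
  have hz := hR'.self_of_nhds
  have hs := hsymm.self_of_nhds
  have := second_bianchi hΓ hsymm c j a b c
  have e1 (x l i : Fin (m + 1)) : ∑ r, Γ c x r z * (kd r i * P l j z - kd r l * P i j z) =
      Γ c x i z * P l j z - Γ c x l z * P i j z := by
    simp only [mul_sub, Finset.sum_sub_distrib, mul_left_comm (Γ c x _ z), sum_kd_mul]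
  simp only [hd, hz, e1] at this
  simp only [kd_self, kd_of_ne hca, kd_of_ne hcb, zero_mul, one_mul, sub_zero, zero_sub, neg_mul,
    Finset.sum_neg_distrib, Finset.sum_const_zero] at this
  rw [hs c a b, hs c a c, hs c b c] at this
  linarith

/-- Coefficients of the linear system for homogeneous flat coordinates. -/
noncomputable def tractorCoeff {m : ℕ}
    (Γ : Fin (m + 1) → Fin (m + 1) → Fin (m + 1) → (Fin (m + 1) → ℝ) → ℝ)
    (P : Fin (m + 1) → Fin (m + 1) → (Fin (m + 1) → ℝ) → ℝ) (i : Fin (m + 1)) :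
    Option (Fin (m + 1)) → Option (Fin (m + 1)) → (Fin (m + 1) → ℝ) → ℝ
  | none, none => fun _ => 0
  | none, some k => fun _ => kd i k
  | some l, none => P i l
  | some l, some k => Γ k i l

theorem exists_homogeneous_coordinates {m : ℕ}
    {Γ : Fin (m + 1) → Fin (m + 1) → Fin (m + 1) → (Fin (m + 1) → ℝ) → ℝ}
    {P : Fin (m + 1) → Fin (m + 1) → (Fin (m + 1) → ℝ) → ℝ} (hm : 2 ≤ m)
    (hΓ : ∀ k i j, AnalyticAt ℝ (Γ k i j) 0) (hP : ∀ i j, AnalyticAt ℝ (P i j) 0)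
    (hsymm : ∀ᶠ w in 𝓝 0, ∀ k i j, Γ k i j w = Γ k j i w)
    (hPs : ∀ᶠ w in 𝓝 0, ∀ i j, P i j w = P j i w)
    (hR : ∀ᶠ w in 𝓝 0, ∀ k j l i, curv m Γ k j l i w = traceCurv (fun a b => P a b w) k j l i)
    (φ₀ : ℝ) (φ₁ : Fin (m + 1) → ℝ) :
    ∃ φ : (Fin (m + 1) → ℝ) → ℝ, AnalyticAt ℝ φ 0 ∧ φ 0 = φ₀ ∧ (∀ i, pd m i φ 0 = φ₁ i) ∧
      ∀ᶠ z in 𝓝 0, ∀ i j, pd m i (pd m j φ) z = P i j z * φ z + ∑ k, Γ k i j z * pd m k φ z := by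
  have ha : ∀ i b c, AnalyticAt ℝ (tractorCoeff Γ P i b c) 0 := by
    rintro i (_ | b) (_ | c)
    · exact analyticAt_const
    · exact analyticAt_const
    · exact hP _ _
    · exact hΓ _ _ _
  obtain ⟨u, hu, hu0, hud⟩ := exists_analyticAt_linear_system (a := tractorCoeff Γ P) ha (by
    filter_upwards [hsymm.eventually_nhds, hPs.eventually_nhds, hR.eventually_nhds,
      eventually_all.2 fun k => eventually_all.2 fun i => eventually_all.2 fun j =>
        (hΓ k i j).eventually_analyticAt,
      eventually_all.2 fun i => eventually_all.2 fun j => (hP i j).eventually_analyticAt]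
      with z hs hps hr ha hp i j b c
    have hs' := hs.self_of_nhds
    have hps' := hps.self_of_nhds
    rcases b with _ | l <;> rcases c with _ | k <;>
      simp only [tractorCoeff, Fintype.sum_option, pd_const, sum_kd_mul', mul_zero,
        zero_mul, zero_add, sub_self]
    · rw [hps' i j, sub_self]
    · rw [hs' k i j, sub_self]
    · have := cotton_eq_zero hm ha hp hs hps hr i j l
      simp only [mul_comm (Γ _ _ _ z)]
      linarith
    · have := hr.self_of_nhds k l i j
      simp only [curv, traceCurv] at this
      rw [hps' i j, sub_self] at this
      simp only [fun r => hs' k i r, fun r => hs' k j r]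
      rw [kd_comm i k, kd_comm j k]
      linarith) (fun o => o.elim φ₀ φ₁)
  refine ⟨u none, hu _, hu0 none, fun i => ?_, ?_⟩
  · have := hud.self_of_nhds i none
    simp only [tractorCoeff, Fintype.sum_option, sum_kd_mul', zero_mul, zero_add] at this
    rw [this, hu0]; rfl
  have h1 : ∀ᶠ z in 𝓝 0, ∀ i, pd m i (u none) z = u (some i) z := by
    filter_upwards [hud] with z hz i
    simpa only [tractorCoeff, Fintype.sum_option, sum_kd_mul', zero_mul, zero_add] using hz i none
  filter_upwards [h1.eventually_nhds, hud] with z hz1 hz2 i j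
  rw [pd_congr (hz1.mono fun w hw => hw j), hz2]
  simp only [tractorCoeff, Fintype.sum_option, hz1.self_of_nhds]

/-- Flat coordinates for a connection with vanishing projective curvature and symmetric `P`. -/
theorem exists_flat_coordinates_of_symm {m : ℕ}
    {Γ : Fin (m + 1) → Fin (m + 1) → Fin (m + 1) → (Fin (m + 1) → ℝ) → ℝ}
    {P : Fin (m + 1) → Fin (m + 1) → (Fin (m + 1) → ℝ) → ℝ} (hm : 2 ≤ m)
    (hΓ : ∀ k i j, AnalyticAt ℝ (Γ k i j) 0) (hP : ∀ i j, AnalyticAt ℝ (P i j) 0)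
    (hsymm : ∀ᶠ w in 𝓝 0, ∀ k i j, Γ k i j w = Γ k j i w)
    (hPs : ∀ᶠ w in 𝓝 0, ∀ i j, P i j w = P j i w)
    (hR : ∀ᶠ w in 𝓝 0, ∀ k j l i, curv m Γ k j l i w = traceCurv (fun a b => P a b w) k j l i) :
    ∃ (Z : Fin (m + 1) → (Fin (m + 1) → ℝ) → ℝ) (ω : Fin (m + 1) → (Fin (m + 1) → ℝ) → ℝ),
      (∀ a, AnalyticAt ℝ (Z a) 0) ∧ (∀ a j, pd m j (Z a) 0 = kd a j) ∧
      ∀ᶠ z in 𝓝 0, ∀ a i j, pd m i (pd m j (Z a)) z = ∑ k, Γ k i j z * pd m k (Z a) z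
        + ω i z * pd m j (Z a) z + ω j z * pd m i (Z a) z := by
  obtain ⟨φ, hφ, hφ0, hφ1, hφ2⟩ :=
    exists_homogeneous_coordinates hm hΓ hP hsymm hPs hR 1 (fun _ => 0)
  choose ψ hψ hψ0 hψ1 hψ2 using fun a =>
    exists_homogeneous_coordinates hm hΓ hP hsymm hPs hR 0 (fun j => kd a j)
  have hne : φ 0 ≠ 0 := by rw [hφ0]; exact one_ne_zero
  have hZ : ∀ a, AnalyticAt ℝ (fun z => ψ a z / φ z) 0 := fun a => (hψ a).fun_div hφ hne
  have hfirst : ∀ᶠ z in 𝓝 0, ∀ a i, pd m i (fun w => ψ a w / φ w) z * φ z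
      + ψ a z / φ z * pd m i φ z = pd m i (ψ a) z := by
    filter_upwards [(hφ.continuousAt.eventually_ne hne).eventually_nhds, hφ.eventually_analyticAt,
      eventually_all.2 fun a => (hZ a).eventually_analyticAt] with z h1 h2 h3 a i
    rw [← pd_mul (h3 a) h2]
    exact pd_congr (h1.mono fun w hw => div_mul_cancel₀ _ hw)
  refine ⟨fun a z => ψ a z / φ z, fun i z => - pd m i φ z / φ z, hZ, fun a j => ?_, ?_⟩
  · have := hfirst.self_of_nhds a j
    rwa [hφ0, hφ1, hψ0, hψ1, mul_one, mul_zero, add_zero] at this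
  filter_upwards [hfirst.eventually_nhds, hφ.continuousAt.eventually_ne hne,
    hφ.eventually_analyticAt, eventually_all.2 fun a => (hZ a).eventually_analyticAt, hφ2,
    eventually_all.2 hψ2] with z h1 h2 h3 h4 h5 h6 a i j
  have e1 : pd m i (pd m j (ψ a)) z =
      pd m i (pd m j (fun w => ψ a w / φ w)) z * φ z + pd m j (fun w => ψ a w / φ w) z * pd m i φ z
      + (pd m i (fun w => ψ a w / φ w) z * pd m j φ z + ψ a z / φ z * pd m i (pd m j φ) z) := by
    rw [← pd_mul (h4 a).pd h3, ← pd_mul (h4 a) h3.pd,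
      ← pd_add ((h4 a).pd.fun_mul h3) ((h4 a).fun_mul h3.pd)]
    exact pd_congr (h1.mono fun w hw => (hw a j).symm)
  have e2 : ∑ k, Γ k i j z * pd m k (ψ a) z =
      (∑ k, Γ k i j z * pd m k (fun w => ψ a w / φ w) z) * φ z
      + ψ a z / φ z * ∑ k, Γ k i j z * pd m k φ z := by
    rw [Finset.sum_mul, Finset.mul_sum, ← Finset.sum_add_distrib]
    refine Finset.sum_congr rfl fun k _ => ?_
    rw [← h1.self_of_nhds]; ring
  rw [h6, h5, e2] at e1
  have e3 : ψ a z = ψ a z / φ z * φ z := (div_mul_cancel₀ _ h2).symm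
  generalize ∑ k, Γ k i j z * pd m k (fun w => ψ a w / φ w) z = s at *
  generalize ∑ k, Γ k i j z * pd m k φ z = t at *
  generalize hq : ψ a z / φ z = q at *
  rw [e3] at e1
  field_simp
  linear_combination -e1

theorem traceCurv_add {n : ℕ} (P Q : Fin n → Fin n → ℝ) (k j l i : Fin n) :
    traceCurv P k j l i + traceCurv Q k j l i = traceCurv (fun a b => P a b + Q a b) k j l i := by
  simp only [traceCurv]; ring

theorem AnalyticAt.projChange {m : ℕ}
    {Γ : Fin (m + 1) → Fin (m + 1) → Fin (m + 1) → (Fin (m + 1) → ℝ) → ℝ}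
    {ω : Fin (m + 1) → (Fin (m + 1) → ℝ) → ℝ} {z : Fin (m + 1) → ℝ}
    (hΓ : ∀ k i j, AnalyticAt ℝ (Γ k i j) z) (hω : ∀ i, AnalyticAt ℝ (ω i) z)
    (k i j : Fin (m + 1)) : AnalyticAt ℝ (projChange Γ ω k i j) z :=
  ((hΓ k i j).fun_add (analyticAt_const.fun_mul (hω j))).fun_add
    (analyticAt_const.fun_mul (hω i))

theorem projChange_symm {m : ℕ}
    {Γ : Fin (m + 1) → Fin (m + 1) → Fin (m + 1) → (Fin (m + 1) → ℝ) → ℝ}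
    {ω : Fin (m + 1) → (Fin (m + 1) → ℝ) → ℝ} {z : Fin (m + 1) → ℝ}
    (hsymm : ∀ k i j, Γ k i j z = Γ k j i z) (k i j : Fin (m + 1)) :
    projChange Γ ω k i j z = projChange Γ ω k j i z := by
  simp only [projChange]
  rw [hsymm k i j]; ring

theorem AnalyticAt.schoutenChange {m : ℕ}
    {Γ : Fin (m + 1) → Fin (m + 1) → Fin (m + 1) → (Fin (m + 1) → ℝ) → ℝ}
    {ω : Fin (m + 1) → (Fin (m + 1) → ℝ) → ℝ} {z : Fin (m + 1) → ℝ}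
    (hΓ : ∀ k i j, AnalyticAt ℝ (Γ k i j) z) (hω : ∀ i, AnalyticAt ℝ (ω i) z)
    (l j : Fin (m + 1)) : AnalyticAt ℝ (schoutenChange m Γ ω l j) z :=
  ((hω j).pd.fun_sub (analyticAt_sum fun r => (hΓ r l j).fun_mul (hω r))).fun_sub
    ((hω l).fun_mul (hω j))

theorem exists_flat_coordinates {m : ℕ}
    {Γ : Fin (m + 1) → Fin (m + 1) → Fin (m + 1) → (Fin (m + 1) → ℝ) → ℝ}
    {P : Fin (m + 1) → Fin (m + 1) → (Fin (m + 1) → ℝ) → ℝ} (hm : 2 ≤ m)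
    (hΓ : ∀ k i j, AnalyticAt ℝ (Γ k i j) 0) (hP : ∀ i j, AnalyticAt ℝ (P i j) 0)
    (hsymm : ∀ᶠ w in 𝓝 0, ∀ k i j, Γ k i j w = Γ k j i w)
    (hR : ∀ᶠ w in 𝓝 0, ∀ k j l i, curv m Γ k j l i w = traceCurv (fun a b => P a b w) k j l i) :
    ∃ (Z : Fin (m + 1) → (Fin (m + 1) → ℝ) → ℝ) (ω : Fin (m + 1) → (Fin (m + 1) → ℝ) → ℝ),
      (∀ a, AnalyticAt ℝ (Z a) 0) ∧ (∀ a j, pd m j (Z a) 0 = kd a j) ∧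
      ∀ᶠ z in 𝓝 0, ∀ a i j, pd m i (pd m j (Z a)) z = ∑ k, Γ k i j z * pd m k (Z a) z
        + ω i z * pd m j (Z a) z + ω j z * pd m i (Z a) z := by
  obtain ⟨ω, hω⟩ : ∃ ω : Fin (m + 1) → (Fin (m + 1) → ℝ) → ℝ,
    ω = fun i z => (-1 / (m + 2 : ℝ)) * ∑ k, Γ k i k z := ⟨_, rfl⟩
  have hωa : ∀ i, AnalyticAt ℝ (ω i) 0 := by
    intro i
    rw [hω]
    exact analyticAt_const.fun_mul (analyticAt_sum fun k => hΓ k i k)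
  have htr : ∀ w i, ∑ k, projChange Γ ω k i k w = 0 := by
    intro w i
    simp only [projChange, Finset.sum_add_distrib, sum_kd_mul, kd_self]
    simp only [hω, one_mul, Finset.sum_const, Finset.card_univ, Fintype.card_fin, nsmul_eq_mul]
    field_simp
    push_cast
    ring
  have hΓ' := AnalyticAt.projChange hΓ hωa
  have hsymm' : ∀ᶠ w in 𝓝 0, ∀ k i j, projChange Γ ω k i j w = projChange Γ ω k j i w :=
    hsymm.mono fun w hw => projChange_symm hw
  have hR' : ∀ᶠ w in 𝓝 0, ∀ k j l i, curv m (projChange Γ ω) k j l i w =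
      traceCurv (fun a b => P a b w + schoutenChange m Γ ω a b w) k j l i := by
    filter_upwards [hsymm, hR, eventually_all.2 fun k => eventually_all.2 fun i =>
      eventually_all.2 fun j => (hΓ k i j).eventually_analyticAt,
      eventually_all.2 fun i => (hωa i).eventually_analyticAt] with w h1 h2 h3 h4 k j l i
    rw [curv_projChange h3 h4 h1, h2, traceCurv_add]
  obtain ⟨Z, η, hZ, hZ0, hZe⟩ := exists_flat_coordinates_of_symm
    (P := fun a b w => P a b w + schoutenChange m Γ ω a b w) hm hΓ'
    (fun a b => (hP a b).fun_add (AnalyticAt.schoutenChange hΓ hωa a b)) hsymm'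
    (by
      filter_upwards [hsymm', hR', eventually_all.2 fun k => eventually_all.2 fun i =>
        eventually_all.2 fun j => (hΓ' k i j).eventually_analyticAt] with w h1 h2 h3 i j
      exact symm_of_curv_eq_traceCurv h3 h1 (Eventually.of_forall htr) h2 i j) hR'
  refine ⟨Z, fun i z => η i z + ω i z, hZ, hZ0, ?_⟩
  filter_upwards [hZe] with z hz a i j
  rw [hz]
  have e : ∀ k, projChange Γ ω k i j z * pd m k (Z a) z = Γ k i j z * pd m k (Z a) z
      + kd k i * (ω j z * pd m k (Z a) z) + kd k j * (ω i z * pd m k (Z a) z) := by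
    intro k; simp only [projChange]; ring
  simp only [e, Finset.sum_add_distrib, sum_kd_mul]
  ring

theorem AnalyticAt.matrix_det {E : Type*} [NormedAddCommGroup E] [NormedSpace ℝ E] {n : ℕ}
    {A : E → Matrix (Fin n) (Fin n) ℝ} {z : E} (hA : ∀ i j, AnalyticAt ℝ (fun w => A w i j) z) :
    AnalyticAt ℝ (fun w => (A w).det) z := by
  simp only [Matrix.det_apply']
  exact Finset.analyticAt_fun_sum _ fun σ _ => analyticAt_const.fun_mul
    (Finset.analyticAt_fun_prod _ fun i _ => hA _ _)

theorem AnalyticAt.matrix_inv {E : Type*} [NormedAddCommGroup E] [NormedSpace ℝ E] {n : ℕ}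
    {A : E → Matrix (Fin n) (Fin n) ℝ} {z : E} (hA : ∀ i j, AnalyticAt ℝ (fun w => A w i j) z)
    (hdet : (A z).det ≠ 0) (i j : Fin n) : AnalyticAt ℝ (fun w => (A w)⁻¹ i j) z := by
  have hadj : AnalyticAt ℝ (fun w => (A w).adjugate i j) z := by
    simp only [Matrix.adjugate_apply]
    refine AnalyticAt.matrix_det fun k l => ?_
    simp only [Matrix.updateRow_apply]
    split_ifs
    · exact analyticAt_const
    · exact hA k l
  have h := ((AnalyticAt.matrix_det hA).fun_inv hdet).fun_mul hadj
  simpa only [Matrix.inv_def, Matrix.smul_apply, smul_eq_mul, Ring.inverse_eq_inv'] using h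

/-- A system of coordinates determines a flat symmetric connection. -/
theorem exists_flat_connection {m : ℕ} {Z : Fin (m + 1) → (Fin (m + 1) → ℝ) → ℝ}
    (hZ : ∀ a, AnalyticAt ℝ (Z a) 0) (hZ0 : ∀ a j, pd m j (Z a) 0 = kd a j) :
    ∃ Γ : Fin (m + 1) → Fin (m + 1) → Fin (m + 1) → (Fin (m + 1) → ℝ) → ℝ,
      (∀ k i j, AnalyticAt ℝ (Γ k i j) 0) ∧ (∀ᶠ z in 𝓝 0, ∀ k i j, Γ k i j z = Γ k j i z) ∧
      (∀ᶠ z in 𝓝 0, ∀ a i j, pd m i (pd m j (Z a)) z = ∑ k, Γ k i j z * pd m k (Z a) z) ∧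
      ∀ᶠ z in 𝓝 0, ∀ k j l i, curv m Γ k j l i z = 0 := by
  obtain ⟨J, hJ⟩ : ∃ J : (Fin (m + 1) → ℝ) → Matrix (Fin (m + 1)) (Fin (m + 1)) ℝ,
    J = fun z => .of fun a k => pd m k (Z a) z := ⟨_, rfl⟩
  have hJz (z a k) : pd m k (Z a) z = J z a k := by rw [hJ]; rfl
  have hJa (a k) : AnalyticAt ℝ (fun z => J z a k) 0 := by
    rw [hJ]; exact (hZ a).pd
  have hJ0 : J 0 = 1 := by
    ext a k; rw [← hJz, hZ0, Matrix.one_apply]; rfl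
  have hdet0 : (J 0).det ≠ 0 := by rw [hJ0, Matrix.det_one]; exact one_ne_zero
  have hdet : ∀ᶠ z in 𝓝 0, IsUnit (J z).det :=
    ((AnalyticAt.matrix_det hJa).continuousAt.eventually_ne hdet0).mono fun z hz =>
      isUnit_iff_ne_zero.2 hz
  obtain ⟨Γ, hΓ⟩ : ∃ Γ : Fin (m + 1) → Fin (m + 1) → Fin (m + 1) → (Fin (m + 1) → ℝ) → ℝ,
    Γ = fun k i j z => ∑ a, (J z)⁻¹ k a * pd m i (pd m j (Z a)) z := ⟨_, rfl⟩
  have hΓa : ∀ k i j, AnalyticAt ℝ (Γ k i j) 0 := by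
    intro k i j
    rw [hΓ]
    exact analyticAt_sum fun a => (AnalyticAt.matrix_inv hJa hdet0 k a).fun_mul (hZ a).pd.pd
  have hZa : ∀ᶠ z in 𝓝 0, ∀ a, AnalyticAt ℝ (Z a) z :=
    eventually_all.2 fun a => (hZ a).eventually_analyticAt
  have hsymm : ∀ᶠ z in 𝓝 0, ∀ k i j, Γ k i j z = Γ k j i z := by
    filter_upwards [hZa] with z hz k i j
    rw [hΓ]
    exact Finset.sum_congr rfl fun a _ => by rw [pd_comm i j (hz a)]
  have hZe : ∀ᶠ z in 𝓝 0, ∀ a i j, pd m i (pd m j (Z a)) z = ∑ k, Γ k i j z * pd m k (Z a) z := by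
    filter_upwards [hdet] with z hz a i j
    have h := congrArg (fun A => A.mulVec (fun b => pd m i (pd m j (Z b)) z) a)
      (Matrix.mul_nonsing_inv (J z) hz)
    simp only [← Matrix.mulVec_mulVec, Matrix.one_mulVec] at h
    rw [← h, hΓ]
    simp only [Matrix.mulVec, dotProduct, hJz, mul_comm]
  refine ⟨Γ, hΓa, hsymm, hZe, ?_⟩
  filter_upwards [hZe.eventually_nhds, hsymm, hZa, hdet, eventually_all.2 fun k =>
    eventually_all.2 fun i => eventually_all.2 fun j => (hΓa k i j).eventually_analyticAt]
    with z h1 h2 h3 h4 h5 k j l i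
  have hthird (a l i) : pd m l (pd m i (pd m j (Z a))) z =
      ∑ k, (pd m l (Γ k i j) z + ∑ r, Γ r i j z * Γ k r l z) * pd m k (Z a) z := by
    rw [pd_congr (h1.mono fun w hw => hw a i j), pd_sum fun k => (h5 k i j).fun_mul (h3 a).pd]
    simp only [fun k => pd_mul (i := l) (h5 k i j) ((h3 a).pd (i := k)), add_mul,
      Finset.sum_add_distrib]
    congr 1
    simp only [fun k => h1.self_of_nhds a l k, Finset.mul_sum, Finset.sum_mul]
    rw [Finset.sum_comm]
    refine Finset.sum_congr rfl fun k _ => Finset.sum_congr rfl fun r _ => ?_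
    rw [h2 k l r]; ring
  have hzero : (J z).mulVec (fun k => curv m Γ k j l i z) = 0 := by
    ext a
    have := pd_comm l i (h3 a).pd (f := pd m j (Z a))
    rw [hthird, hthird, ← sub_eq_zero, ← Finset.sum_sub_distrib] at this
    rw [Pi.zero_apply, ← this, Matrix.mulVec, dotProduct]
    refine Finset.sum_congr rfl fun k _ => ?_
    rw [← hJz]
    simp only [curv]
    ring
  have := congrArg (fun v => (J z)⁻¹.mulVec v k) hzero
  simpa [Matrix.mulVec_mulVec, Matrix.nonsing_inv_mul _ h4] using this

/-- The right-hand side of a system which is cubic in the velocities `p`. -/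
noncomputable def cubicForm {m : ℕ} (G : Fin m → (Fin (m + 1) → ℝ) → ℝ)
    (H : Fin m → Fin m → (Fin (m + 1) → ℝ) → ℝ)
    (L : Fin m → Fin m → Fin m → (Fin (m + 1) → ℝ) → ℝ)
    (M : Fin m → Fin m → (Fin (m + 1) → ℝ) → ℝ) (j : Fin m)
    (w : (Fin (m + 1) → ℝ) × (Fin m → ℝ)) : ℝ :=
  G j w.1 + ∑ l₁ : Fin m, w.2 l₁ * H j l₁ w.1
    + ∑ l₁ : Fin m, ∑ l₂ : Fin m, w.2 l₁ * w.2 l₂ * L j l₁ l₂ w.1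
    + w.2 j * ∑ l₁ : Fin m, ∑ l₂ : Fin m, w.2 l₁ * w.2 l₂ * M l₁ l₂ w.1

/-- The connection with `Γ 0 0 j = 0` whose geodesics are the solutions of the system given by
`cubicForm G H L M`. -/
noncomputable def gaugeConn {m : ℕ} (G : Fin m → (Fin (m + 1) → ℝ) → ℝ)
    (H : Fin m → Fin m → (Fin (m + 1) → ℝ) → ℝ)
    (L : Fin m → Fin m → Fin m → (Fin (m + 1) → ℝ) → ℝ)
    (M : Fin m → Fin m → (Fin (m + 1) → ℝ) → ℝ) (k i j : Fin (m + 1)) : (Fin (m + 1) → ℝ) → ℝ :=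
  Fin.cases (Fin.cases (fun _ => 0) (fun a => Fin.cases (fun _ => 0) (fun b => M a b) j) i)
    (fun d => Fin.cases
      (Fin.cases (fun z => -G d z) (fun b z => -(1 / 2) * H d b z) j)
      (fun a => Fin.cases (fun z => -(1 / 2) * H d a z) (fun b z => -L d a b z) j) i) k

section gaugeConn

variable {m : ℕ} (G : Fin m → (Fin (m + 1) → ℝ) → ℝ)
    (H : Fin m → Fin m → (Fin (m + 1) → ℝ) → ℝ)
    (L : Fin m → Fin m → Fin m → (Fin (m + 1) → ℝ) → ℝ)
    (M : Fin m → Fin m → (Fin (m + 1) → ℝ) → ℝ)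

theorem gaugeConn_zero_zero (j : Fin (m + 1)) : gaugeConn G H L M 0 0 j = fun _ => 0 := rfl

theorem gaugeConn_zero_succ_zero (a : Fin m) : gaugeConn G H L M 0 a.succ 0 = fun _ => 0 := rfl

theorem gaugeConn_zero_succ_succ (a b : Fin m) : gaugeConn G H L M 0 a.succ b.succ = M a b := rfl

theorem gaugeConn_succ_zero_zero (d : Fin m) :
    gaugeConn G H L M d.succ 0 0 = fun z => -G d z := rfl

theorem gaugeConn_succ_zero_succ (d b : Fin m) :
    gaugeConn G H L M d.succ 0 b.succ = fun z => -(1 / 2) * H d b z := rfl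

theorem gaugeConn_succ_succ_zero (d a : Fin m) :
    gaugeConn G H L M d.succ a.succ 0 = fun z => -(1 / 2) * H d a z := rfl

theorem gaugeConn_succ_succ_succ (d a b : Fin m) :
    gaugeConn G H L M d.succ a.succ b.succ = fun z => -L d a b z := rfl

variable {G H L M}

theorem gaugeConn_symm (hL : ∀ j a b, L j a b = L j b a) (hM : ∀ a b, M a b = M b a)
    (k i j : Fin (m + 1)) : gaugeConn G H L M k i j = gaugeConn G H L M k j i := by
  cases k using Fin.cases <;> cases i using Fin.cases <;> cases j using Fin.cases <;> try rfl
  · exact hM _ _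
  · simp only [gaugeConn_succ_succ_succ]
    rw [hL]

theorem AnalyticAt.gaugeConn {z : Fin (m + 1) → ℝ} (hG : ∀ j, AnalyticAt ℝ (G j) z)
    (hH : ∀ j a, AnalyticAt ℝ (H j a) z) (hL : ∀ j a b, AnalyticAt ℝ (L j a b) z)
    (hM : ∀ a b, AnalyticAt ℝ (M a b) z) (k i j : Fin (m + 1)) :
    AnalyticAt ℝ (gaugeConn G H L M k i j) z := by
  cases k using Fin.cases <;> cases i using Fin.cases <;> cases j using Fin.cases
  · exact analyticAt_const
  · exact analyticAt_const
  · exact analyticAt_const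
  · exact hM _ _
  · exact (hG _).fun_neg
  · exact analyticAt_const.fun_mul (hH _ _)
  · exact analyticAt_const.fun_mul (hH _ _)
  · exact (hL _ _ _).fun_neg

/-- Second total derivative along solutions in terms of the gauge connection. -/
theorem DDop_eq_of_gaugeConn (hM : ∀ a b, M a b = M b a) (hL : ∀ j a b, L j a b = L j b a)
    {f : (Fin (m + 1) → ℝ) → ℝ}
    {ω : Fin (m + 1) → (Fin (m + 1) → ℝ) → ℝ} {z : Fin (m + 1) → ℝ}
    (hf : ∀ i j, pd m i (pd m j f) z = ∑ k, gaugeConn G H L M k i j z * pd m k f z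
      + ω i z * pd m j f z + ω j z * pd m i f z) (p q : Fin m → ℝ) :
    DDop m f z p q = ∑ l, (q l - cubicForm G H L M l (z, p)) * pd m l.succ f z
      + (∑ a, ∑ b, p a * p b * M a b z + 2 * (ω 0 z + ∑ a, p a * ω a.succ z)) * Dop m f z p := by
  have hH : ∑ l, p l * ∑ k, H k l z * pd m k.succ f z =
      ∑ k, (∑ l, p l * H k l z) * pd m k.succ f z := by
    simp only [Finset.mul_sum, Finset.sum_mul, mul_assoc]
    exact Finset.sum_comm
  have hL' : ∑ a, ∑ b, p a * p b * ∑ k, L k a b z * pd m k.succ f z =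
      ∑ k, (∑ a, ∑ b, p a * p b * L k a b z) * pd m k.succ f z := by
    simp only [Finset.mul_sum, Finset.sum_mul, mul_assoc]
    exact (Finset.sum_congr rfl fun a _ => Finset.sum_comm).trans Finset.sum_comm
  have hW : ∑ a, ∑ b, p a * p b * (ω a.succ z * pd m b.succ f z) =
      (∑ a, p a * ω a.succ z) * ∑ b, p b * pd m b.succ f z := by
    rw [Finset.sum_mul_sum]
    exact Finset.sum_congr rfl fun a _ => Finset.sum_congr rfl fun b _ => by ring
  have hW' : ∑ a, ∑ b, p a * p b * (ω b.succ z * pd m a.succ f z) =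
      (∑ a, p a * ω a.succ z) * ∑ b, p b * pd m b.succ f z := by
    rw [← hW, Finset.sum_comm]
    exact Finset.sum_congr rfl fun a _ => Finset.sum_congr rfl fun b _ => by ring
  have h2 : ∑ a : Fin m, p a * pd m a.succ (pd m 0 f) z =
      -(1 / 2) * ∑ k, (∑ l, p l * H k l z) * pd m k.succ f z
        + (∑ a, p a * ω a.succ z) * pd m 0 f z + ω 0 z * ∑ b, p b * pd m b.succ f z := by
    rw [← hH]
    simp only [hf, Fin.sum_univ_succ, gaugeConn_zero_succ_zero, gaugeConn_succ_succ_zero, zero_mul,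
      zero_add, Finset.mul_sum, Finset.sum_mul, ← Finset.sum_add_distrib]
    refine Finset.sum_congr rfl fun a _ => ?_
    rw [mul_add, mul_add, Finset.mul_sum]
    congr 1
    · congr 1
      · exact Finset.sum_congr rfl fun k _ => by ring
      · ring
    · ring
  have h3 : ∑ a : Fin m, ∑ b : Fin m, p a * p b * pd m b.succ (pd m a.succ f) z =
      (∑ a, ∑ b, p a * p b * M a b z) * pd m 0 f z
        - ∑ k, (∑ a, ∑ b, p a * p b * L k a b z) * pd m k.succ f z
        + 2 * ((∑ a, p a * ω a.succ z) * ∑ b, p b * pd m b.succ f z) := by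
    rw [two_mul]
    nth_rewrite 1 [← hW']
    rw [← hW, ← hL']
    simp only [hf, Fin.sum_univ_succ (n := m), gaugeConn_zero_succ_succ, gaugeConn_succ_succ_succ,
      Finset.sum_mul, ← Finset.sum_add_distrib, ← Finset.sum_sub_distrib]
    refine Finset.sum_congr rfl fun a _ => Finset.sum_congr rfl fun b _ => ?_
    rw [hM b a]
    simp only [hL _ b a, neg_mul, Finset.sum_neg_distrib]
    ring
  have h1 : pd m 0 (pd m 0 f) z = -(∑ k, G k z * pd m k.succ f z) + 2 * ω 0 z * pd m 0 f z := by
    rw [hf, Fin.sum_univ_succ]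
    simp only [gaugeConn_zero_zero, gaugeConn_succ_zero_zero, neg_mul, Finset.sum_neg_distrib]
    ring
  rw [DDop, h1, h2, h3]
  simp only [cubicForm, Dop, sub_mul, add_mul (_ + _), add_mul (G _ _), Finset.sum_sub_distrib,
    Finset.sum_add_distrib]
  have h4 : ∑ l, p l * (∑ a, ∑ b, p a * p b * M a b z) * pd m l.succ f z =
      (∑ a, ∑ b, p a * p b * M a b z) * ∑ l, p l * pd m l.succ f z := by
    rw [Finset.mul_sum]
    exact Finset.sum_congr rfl fun l _ => by ring
  rw [h4]
  ring

theorem mapsToFree_iff_eq_cubicForm (hM : ∀ a b, M a b = M b a) (hL : ∀ j a b, L j a b = L j b a)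
    {F : Fin m → ((Fin (m + 1) → ℝ) × (Fin m → ℝ)) → ℝ}
    {Z : Fin (m + 1) → (Fin (m + 1) → ℝ) → ℝ} {ω : Fin (m + 1) → (Fin (m + 1) → ℝ) → ℝ}
    (hZ : ∀ a, AnalyticAt ℝ (Z a) 0) (hZ0 : ∀ a j, pd m j (Z a) 0 = kd a j)
    (hf : ∀ᶠ z in 𝓝 0, ∀ a i j, pd m i (pd m j (Z a)) z =
      ∑ k, gaugeConn G H L M k i j z * pd m k (Z a) z
        + ω i z * pd m j (Z a) z + ω j z * pd m i (Z a) z) :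
    MapsToFree m F Z ↔
      ∀ᶠ w in 𝓝 (0 : (Fin (m + 1) → ℝ) × (Fin m → ℝ)), ∀ j, F j w = cubicForm G H L M j w := by
  have hf' : ∀ᶠ w in 𝓝 (0 : (Fin (m + 1) → ℝ) × (Fin m → ℝ)), ∀ a i j,
      pd m i (pd m j (Z a)) w.1 = ∑ k, gaugeConn G H L M k i j w.1 * pd m k (Z a) w.1
        + ω i w.1 * pd m j (Z a) w.1 + ω j w.1 * pd m i (Z a) w.1 :=
    (continuous_fst.tendsto' (0 : (Fin (m + 1) → ℝ) × (Fin m → ℝ)) 0 rfl).eventually hf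
  let A : (Fin (m + 1) → ℝ) × (Fin m → ℝ) → Matrix (Fin m) (Fin m) ℝ := fun w =>
    .of fun j l => Dop m (Z 0) w.1 w.2 * pd m l.succ (Z j.succ) w.1
      - Dop m (Z j.succ) w.1 w.2 * pd m l.succ (Z 0) w.1
  have hA0 : A 0 = 1 := by
    ext j l
    simp [A, Dop, hZ0, kd, Matrix.one_apply, (Fin.succ_ne_zero _).symm]
  have hpd : ∀ a i, ContinuousAt (fun w : (Fin (m + 1) → ℝ) × (Fin m → ℝ) => pd m i (Z a) w.1) 0 :=
    fun a i => ContinuousAt.comp' (f := Prod.fst) (hZ a).pd.continuousAt continuousAt_fst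
  have hAc : ContinuousAt (fun w => (A w).det) 0 := by
    have hAa : ContinuousAt A 0 := by
      refine continuousAt_pi.2 fun j => continuousAt_pi.2 fun l => ?_
      simp only [A, Dop, Matrix.of_apply]
      fun_prop
    exact continuous_id.matrix_det.continuousAt.comp hAa
  have hdet : ∀ᶠ w in 𝓝 (0 : (Fin (m + 1) → ℝ) × (Fin m → ℝ)), (A w).det ≠ 0 :=
    hAc.eventually_ne (by rw [hA0, Matrix.det_one]; exact one_ne_zero)
  have key : ∀ᶠ w in 𝓝 (0 : (Fin (m + 1) → ℝ) × (Fin m → ℝ)),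
      (∀ j : Fin m, Dop m (Z 0) w.1 w.2 * DDop m (Z j.succ) w.1 w.2 (fun l => F l w)
        - Dop m (Z j.succ) w.1 w.2 * DDop m (Z 0) w.1 w.2 (fun l => F l w) = 0) ↔
      ∀ j, F j w = cubicForm G H L M j w := by
    filter_upwards [hf', hdet] with w h1 h2
    have e : ∀ j : Fin m, Dop m (Z 0) w.1 w.2 * DDop m (Z j.succ) w.1 w.2 (fun l => F l w)
        - Dop m (Z j.succ) w.1 w.2 * DDop m (Z 0) w.1 w.2 (fun l => F l w)
        = (A w).mulVec (fun l => F l w - cubicForm G H L M l w) j := by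
      intro j
      rw [DDop_eq_of_gaugeConn hM hL (h1 _), DDop_eq_of_gaugeConn hM hL (h1 _)]
      have e1 : (A w).mulVec (fun l => F l w - cubicForm G H L M l w) j =
          Dop m (Z 0) w.1 w.2 *
            ∑ l, (F l w - cubicForm G H L M l (w.1, w.2)) * pd m l.succ (Z j.succ) w.1
          - Dop m (Z j.succ) w.1 w.2 *
            ∑ l, (F l w - cubicForm G H L M l (w.1, w.2)) * pd m l.succ (Z 0) w.1 := by
        rw [Finset.mul_sum, Finset.mul_sum, ← Finset.sum_sub_distrib, Matrix.mulVec, dotProduct]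
        refine Finset.sum_congr rfl fun l _ => ?_
        simp only [A, Matrix.of_apply]
        ring
      rw [e1]; ring
    simp only [e]
    refine ⟨fun h j => ?_, fun h j => ?_⟩
    · have := Matrix.eq_zero_of_mulVec_eq_zero h2 (funext h)
      exact sub_eq_zero.1 (congrFun this j)
    · have : (fun l => F l w - cubicForm G H L M l w) = 0 := funext fun l => sub_eq_zero.2 (h l)
      rw [this, Matrix.mulVec_zero]; rfl
  constructor
  · rintro ⟨-, V, hV, h⟩
    filter_upwards [key, hV] with w h1 h2
    exact h1.1 (h w h2)
  · intro h
    refine ⟨hZ0, _, key.and h, fun w hw => hw.1.2 hw.2⟩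

end gaugeConn

/-- Two curvature-like tensors agree as soon as their essential components agree. -/
theorem curvature_ext {m : ℕ} {R T : Fin (m + 1) → Fin (m + 1) → Fin (m + 1) → ℝ}
    (hRa : ∀ j l i, R j l i = -R j i l) (hTa : ∀ j l i, T j l i = -T j i l)
    (hRc : ∀ j l i, R j l i + R l i j + R i j l = 0)
    (hTc : ∀ j l i, T j l i + T l i j + T i j l = 0)
    (h0 : ∀ j (a : Fin m), R j 0 a.succ = T j 0 a.succ)
    (h1 : ∀ c a b : Fin m, R c.succ a.succ b.succ = T c.succ a.succ b.succ)
    (j l i : Fin (m + 1)) : R j l i = T j l i := by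
  cases l using Fin.cases with
  | zero =>
    cases i using Fin.cases with
    | zero => linarith [hRa j 0 0, hTa j 0 0]
    | succ a => exact h0 j a
  | succ a =>
    cases i using Fin.cases with
    | zero => rw [hRa, hTa, h0]
    | succ b =>
      cases j using Fin.cases with
      | zero =>
        linarith [hRc 0 a.succ b.succ, hTc 0 a.succ b.succ, hRa a.succ b.succ 0,
          hTa a.succ b.succ 0, h0 a.succ b, h0 b.succ a]
      | succ c => exact h1 c a b

section gaugeConn

variable {m : ℕ} {G : Fin m → (Fin (m + 1) → ℝ) → ℝ}
    {H : Fin m → Fin m → (Fin (m + 1) → ℝ) → ℝ}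
    {L : Fin m → Fin m → Fin m → (Fin (m + 1) → ℝ) → ℝ}
    {M : Fin m → Fin m → (Fin (m + 1) → ℝ) → ℝ} {z : Fin (m + 1) → ℝ}

theorem curv_gaugeConn_zero_zero (hM : ∀ a b, M a b = M b a) (a : Fin m) :
    curv m (gaugeConn G H L M) 0 0 0 a.succ z = ∑ k, G k z * M a k z := by
  simp only [curv, Fin.sum_univ_succ (n := m), gaugeConn_zero_zero, gaugeConn_zero_succ_zero,
    gaugeConn_zero_succ_succ, gaugeConn_succ_zero_zero, pd_const, hM a]
  simp

theorem curv_gaugeConn_zero_succ (hM : ∀ a b, M a b = M b a) (b a : Fin m) :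
    curv m (gaugeConn G H L M) 0 b.succ 0 a.succ z =
      pd m 0 (M b a) z + 1 / 2 * ∑ k, H k b z * M a k z := by
  simp only [curv, Fin.sum_univ_succ (n := m), gaugeConn_zero_zero, gaugeConn_zero_succ_zero,
    gaugeConn_zero_succ_succ, gaugeConn_succ_zero_succ, pd_const, hM a, Finset.mul_sum]
  simp [mul_assoc]

theorem curv_gaugeConn_zero_succ_succ (hL : ∀ j a b, L j a b = L j b a)
    (hM : ∀ a b, M a b = M b a) (c a b : Fin m) :
    curv m (gaugeConn G H L M) 0 c.succ a.succ b.succ z =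
      pd m a.succ (M c b) z - pd m b.succ (M c a) z - ∑ k, L k c b z * M a k z
        + ∑ k, L k c a z * M b k z := by
  simp only [curv, Fin.sum_univ_succ (n := m), gaugeConn_zero_zero,
    gaugeConn_zero_succ_succ, gaugeConn_succ_succ_succ, hM a, hM b, hL _ a c, hL _ b c]
  simp [sub_eq_add_neg]

theorem curv_gaugeConn_succ_zero (hH : ∀ j a, AnalyticAt ℝ (H j a) z)
    (hL : ∀ j a b, L j a b = L j b a) (d a : Fin m) :
    curv m (gaugeConn G H L M) d.succ 0 0 a.succ z =
      -(1 / 2) * pd m 0 (H d a) z + pd m a.succ (G d) z + 1 / 4 * ∑ k, H k a z * H d k z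
        - ∑ k, G k z * L d a k z := by
  simp only [curv, Fin.sum_univ_succ (n := m), gaugeConn_zero_zero, gaugeConn_zero_succ_zero,
    gaugeConn_succ_zero_zero, gaugeConn_succ_succ_zero, gaugeConn_succ_succ_succ,
    pd_const_mul (hH _ _), pd_neg, Finset.mul_sum, hL _ a]
  have : ∀ k, -(1 / 2) * H k a z * (-(1 / 2) * H d k z) = 1 / 4 * (H k a z * H d k z) :=
    fun k => by ring
  simp only [this]
  simp

theorem curv_gaugeConn_succ_succ (hH : ∀ j a, AnalyticAt ℝ (H j a) z)
    (hL : ∀ j a b, L j a b = L j b a) (hM : ∀ a b, M a b = M b a) (d b a : Fin m) :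
    curv m (gaugeConn G H L M) d.succ b.succ 0 a.succ z =
      -pd m 0 (L d b a) z + 1 / 2 * pd m a.succ (H d b) z - G d z * M b a z
        + 1 / 2 * ∑ k, H d k z * L k b a z - 1 / 2 * ∑ k, H k b z * L d a k z := by
  simp only [curv, Fin.sum_univ_succ (n := m), gaugeConn_zero_zero, gaugeConn_zero_succ_succ,
    gaugeConn_succ_zero_zero, gaugeConn_succ_zero_succ, gaugeConn_succ_succ_zero,
    gaugeConn_succ_succ_succ,
    pd_const_mul (hH _ _), pd_neg, Finset.mul_sum, hL _ a, hM a]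
  have h1 : ∀ k, -L k b a z * (-(1 / 2) * H d k z) = 1 / 2 * (H d k z * L k b a z) :=
    fun k => by ring
  have h2 : ∀ k, -(1 / 2) * H k b z * -L d k a z = 1 / 2 * (H k b z * L d k a z) :=
    fun k => by ring
  simp only [h1, h2]
  ring

theorem curv_gaugeConn_succ_succ_succ (hL : ∀ j a b, L j a b = L j b a)
    (hM : ∀ a b, M a b = M b a) (d c a b : Fin m) :
    curv m (gaugeConn G H L M) d.succ c.succ a.succ b.succ z =
      pd m b.succ (L d c a) z - pd m a.succ (L d c b) z + 1 / 2 * H d b z * M c a z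
        - 1 / 2 * H d a z * M c b z + ∑ k, L k c b z * L d a k z - ∑ k, L k c a z * L d b k z := by
  simp only [curv, Fin.sum_univ_succ (n := m), gaugeConn_zero_succ_succ, gaugeConn_succ_zero_succ,
    gaugeConn_succ_succ_succ, pd_neg, neg_mul_neg, hL _ a, hL _ b, hM a, hM b]
  ring

theorem kd_succ {n : ℕ} (a b : Fin n) : kd a.succ b.succ = kd a b := by
  simp [kd, Fin.succ_inj]

theorem kd_zero_succ {n : ℕ} (a : Fin n) : kd 0 a.succ = 0 := kd_of_ne (Fin.succ_ne_zero a).symm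

theorem kd_succ_zero {n : ℕ} (a : Fin n) : kd a.succ 0 = 0 := kd_of_ne (Fin.succ_ne_zero a)

/-- Vanishing projective curvature of the gauge connection implies the compatibility conditions. -/
theorem condsItoIV_of_curv_eq_traceCurv {U : Set (Fin (m + 1) → ℝ)}
    (hH : ∀ z ∈ U, ∀ j a, AnalyticAt ℝ (H j a) z) (hL : ∀ j a b, L j a b = L j b a)
    (hM : ∀ a b, M a b = M b a) {P : Fin (m + 1) → Fin (m + 1) → (Fin (m + 1) → ℝ) → ℝ}
    (hR : ∀ z ∈ U, ∀ k j l i, curv m (gaugeConn G H L M) k j l i z =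
      traceCurv (fun a b => P a b z) k j l i) : CondsItoIV m U G H L M := by
  refine ⟨fun j l₁ l₂ z hz => ?_, fun j l₁ l₂ z hz => ?_, fun j l₁ l₂ l₃ z hz => ?_,
    fun l₁ l₂ l₃ z hz => ?_⟩
  · have h := fun d a => hR z hz (Fin.succ d) 0 0 (Fin.succ a)
    simp only [curv_gaugeConn_succ_zero (hH z hz) hL, traceCurv, kd_succ,
      kd_succ_zero] at h
    have h2 := h l₂ l₂
    rw [kd_self] at h2
    linear_combination 2 * h j l₁ - 2 * kd j l₁ * h2
  · have h := fun d b a => hR z hz (Fin.succ d) (Fin.succ b) 0 (Fin.succ a)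
    have hN := fun a => hR z hz 0 0 0 (Fin.succ a)
    simp only [curv_gaugeConn_succ_succ (hH z hz) hL hM, traceCurv, kd_succ,
      kd_succ_zero] at h
    simp only [curv_gaugeConn_zero_zero hM, traceCurv, kd_zero_succ, kd_self] at hN
    have h1 := h l₁ l₁ l₁
    have h2 := h l₂ l₂ l₂
    rw [kd_self] at h1 h2
    linear_combination h j l₁ l₂ - kd j l₁ * (h2 + hN l₂) / 3 - kd j l₂ * (2 * h1 - hN l₁) / 3
  · have h := hR z hz (Fin.succ j) (Fin.succ l₁) (Fin.succ l₂) (Fin.succ l₃)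
    have hP := fun b a => hR z hz 0 (Fin.succ b) 0 (Fin.succ a)
    simp only [curv_gaugeConn_succ_succ_succ hL hM, traceCurv, kd_succ] at h
    simp only [curv_gaugeConn_zero_succ hM, traceCurv, kd_zero_succ, kd_self] at hP
    have h3 := hP l₃ l₂
    rw [hM l₃ l₂] at h3
    linear_combination -h - kd j l₁ * (h3 - hP l₂ l₃) - kd j l₃ * hP l₁ l₂ + kd j l₂ * hP l₁ l₃
  · have h := hR z hz 0 (Fin.succ l₁) (Fin.succ l₃) (Fin.succ l₂)
    simp only [curv_gaugeConn_zero_succ_succ hL hM, traceCurv, kd_zero_succ] at h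
    linear_combination -h

/-- The tensor `P` determined by the curvature of a connection with `Γ 0 0 j = 0`. -/
noncomputable def gaugeSchouten (o : Fin m)
    (Γ : Fin (m + 1) → Fin (m + 1) → Fin (m + 1) → (Fin (m + 1) → ℝ) → ℝ) (l j : Fin (m + 1)) :
    (Fin (m + 1) → ℝ) → ℝ :=
  Fin.cases
    (Fin.cases (fun z => curv m Γ o.succ 0 0 o.succ z)
      (fun a z => (2 * curv m Γ a.succ a.succ 0 a.succ z - curv m Γ 0 0 0 a.succ z) / 3) j)
    (fun a => Fin.cases
      (fun z => (curv m Γ a.succ a.succ 0 a.succ z - 2 * curv m Γ 0 0 0 a.succ z) / 3)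
      (fun b z => -curv m Γ 0 b.succ 0 a.succ z) j) l

theorem gaugeSchouten_zero_zero (o : Fin m)
    (Γ : Fin (m + 1) → Fin (m + 1) → Fin (m + 1) → (Fin (m + 1) → ℝ) → ℝ) :
    gaugeSchouten o Γ 0 0 z = curv m Γ o.succ 0 0 o.succ z := rfl

theorem gaugeSchouten_zero_succ (o a : Fin m)
    (Γ : Fin (m + 1) → Fin (m + 1) → Fin (m + 1) → (Fin (m + 1) → ℝ) → ℝ) :
    gaugeSchouten o Γ 0 a.succ z =
      (2 * curv m Γ a.succ a.succ 0 a.succ z - curv m Γ 0 0 0 a.succ z) / 3 := rfl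

theorem gaugeSchouten_succ_zero (o a : Fin m)
    (Γ : Fin (m + 1) → Fin (m + 1) → Fin (m + 1) → (Fin (m + 1) → ℝ) → ℝ) :
    gaugeSchouten o Γ a.succ 0 z =
      (curv m Γ a.succ a.succ 0 a.succ z - 2 * curv m Γ 0 0 0 a.succ z) / 3 := rfl

theorem gaugeSchouten_succ_succ (o a b : Fin m)
    (Γ : Fin (m + 1) → Fin (m + 1) → Fin (m + 1) → (Fin (m + 1) → ℝ) → ℝ) :
    gaugeSchouten o Γ a.succ b.succ z = -curv m Γ 0 b.succ 0 a.succ z := rfl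

theorem AnalyticAt.curv {Γ : Fin (m + 1) → Fin (m + 1) → Fin (m + 1) → (Fin (m + 1) → ℝ) → ℝ}
    (hΓ : ∀ k i j, AnalyticAt ℝ (Γ k i j) z) (k j l i : Fin (m + 1)) :
    AnalyticAt ℝ (curv m Γ k j l i) z :=
  (((hΓ _ _ _).pd.fun_sub (hΓ _ _ _).pd).fun_add
    (analyticAt_sum fun _ => (hΓ _ _ _).fun_mul (hΓ _ _ _))).fun_sub
    (analyticAt_sum fun _ => (hΓ _ _ _).fun_mul (hΓ _ _ _))

theorem AnalyticAt.gaugeSchouten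
    {Γ : Fin (m + 1) → Fin (m + 1) → Fin (m + 1) → (Fin (m + 1) → ℝ) → ℝ}
    (hΓ : ∀ k i j, AnalyticAt ℝ (Γ k i j) z) (o : Fin m) (l j : Fin (m + 1)) :
    AnalyticAt ℝ (gaugeSchouten o Γ l j) z := by
  have h := AnalyticAt.curv hΓ
  cases l using Fin.cases <;> cases j using Fin.cases
  · exact h _ _ _ _
  · exact ((analyticAt_const.fun_mul (h _ _ _ _)).fun_sub (h _ _ _ _)).fun_div analyticAt_const
      three_ne_zero
  · exact ((h _ _ _ _).fun_sub (analyticAt_const.fun_mul (h _ _ _ _))).fun_div analyticAt_const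
      three_ne_zero
  · exact (h _ _ _ _).fun_neg

/-- The compatibility conditions imply vanishing projective curvature of the gauge connection. -/
theorem curv_eq_traceCurv_of_condsItoIV {U : Set (Fin (m + 1) → ℝ)}
    (hH : ∀ j a, AnalyticAt ℝ (H j a) z) (hL : ∀ j a b, L j a b = L j b a)
    (hM : ∀ a b, M a b = M b a) (hz : z ∈ U) (h : CondsItoIV m U G H L M) (o : Fin m)
    (k j l i : Fin (m + 1)) : curv m (gaugeConn G H L M) k j l i z =
      traceCurv (fun a b => gaugeSchouten o (gaugeConn G H L M) a b z) k j l i := by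
  obtain ⟨h1, h2, h3, h4⟩ := h
  refine curvature_ext (R := fun j l i => curv m (gaugeConn G H L M) k j l i z)
    (T := fun j l i => traceCurv (fun a b => gaugeSchouten o (gaugeConn G H L M) a b z) k j l i)
    (fun j l i => curv_antisymm _ _ _ _ _ _) (fun j l i => traceCurv_antisymm _ _ _ _ _)
    (fun j l i => curv_cyclic (Eventually.of_forall fun w k i j =>
      congrFun (gaugeConn_symm hL hM k i j) w) _ _ _ _) (fun j l i => traceCurv_cyclic _ _ _ _ _)
    (fun j a => ?_) (fun c a b => ?_) j l i
  · cases k using Fin.cases with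
    | zero =>
      cases j using Fin.cases with
      | zero =>
        simp only [traceCurv, gaugeSchouten_zero_succ, gaugeSchouten_succ_zero, kd_zero_succ,
          kd_self]
        ring
      | succ b => simp [traceCurv, gaugeSchouten_succ_succ, kd_zero_succ, kd_self]
    | succ d =>
      cases j using Fin.cases with
      | zero =>
        simp only [traceCurv, gaugeSchouten_zero_zero, kd_succ_zero, kd_succ,
          curv_gaugeConn_succ_zero hH hL]
        linear_combination (1 / 2) * h1 d a o z hz
      | succ b =>
        simp only [traceCurv, gaugeSchouten_zero_succ, gaugeSchouten_succ_zero, kd_succ_zero,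
          kd_succ, curv_gaugeConn_succ_succ hH hL hM, curv_gaugeConn_zero_zero hM]
        linear_combination h2 d b a z hz
  · cases k using Fin.cases with
    | zero =>
      simp only [traceCurv, kd_zero_succ, curv_gaugeConn_zero_succ_succ hL hM]
      linear_combination -h4 c b a z hz
    | succ d =>
      simp only [traceCurv, gaugeSchouten_succ_succ, kd_succ, curv_gaugeConn_zero_succ hM,
        curv_gaugeConn_succ_succ_succ hL hM, hM b a]
      linear_combination -h3 d c a b z hz

end gaugeConn

/-- A torsion-free connection has, after a projective change, the form of a gauge connection. -/
theorem exists_gaugeConn {m : ℕ}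
    {Γ : Fin (m + 1) → Fin (m + 1) → Fin (m + 1) → (Fin (m + 1) → ℝ) → ℝ}
    (hΓ : ∀ k i j, AnalyticAt ℝ (Γ k i j) 0)
    (hsymm : ∀ᶠ z in 𝓝 0, ∀ k i j, Γ k i j z = Γ k j i z) :
    ∃ (G : Fin m → (Fin (m + 1) → ℝ) → ℝ) (H : Fin m → Fin m → (Fin (m + 1) → ℝ) → ℝ)
      (L : Fin m → Fin m → Fin m → (Fin (m + 1) → ℝ) → ℝ)
      (M : Fin m → Fin m → (Fin (m + 1) → ℝ) → ℝ) (ω : Fin (m + 1) → (Fin (m + 1) → ℝ) → ℝ),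
      (∀ j a b, L j a b = L j b a) ∧ (∀ a b, M a b = M b a) ∧
      (∀ j, AnalyticAt ℝ (G j) 0) ∧ (∀ j a, AnalyticAt ℝ (H j a) 0) ∧
      (∀ j a b, AnalyticAt ℝ (L j a b) 0) ∧ (∀ a b, AnalyticAt ℝ (M a b) 0) ∧
      (∀ i, AnalyticAt ℝ (ω i) 0) ∧
      ∀ᶠ z in 𝓝 0, ∀ k i j, gaugeConn G H L M k i j z = projChange Γ ω k i j z := by
  let ω : Fin (m + 1) → (Fin (m + 1) → ℝ) → ℝ := fun i =>
    Fin.cases (fun z => -(1 / 2) * Γ 0 0 0 z) (fun b z => -Γ 0 0 b.succ z) i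
  have hω0 : ω 0 = fun z => -(1 / 2) * Γ 0 0 0 z := rfl
  have hωs (b : Fin m) : ω b.succ = fun z => -Γ 0 0 b.succ z := rfl
  have hω : ∀ i, AnalyticAt ℝ (ω i) 0 := by
    intro i
    cases i using Fin.cases with
    | zero => exact analyticAt_const.fun_mul (hΓ _ _ _)
    | succ b => exact (hΓ _ _ _).fun_neg
  have hΔ := AnalyticAt.projChange hΓ hω
  refine ⟨fun d z => -projChange Γ ω d.succ 0 0 z,
    fun d b z => -2 * projChange Γ ω d.succ 0 b.succ z,
    fun d a b z => -(1 / 2) * (projChange Γ ω d.succ a.succ b.succ z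
      + projChange Γ ω d.succ b.succ a.succ z),
    fun a b z => 1 / 2 * (projChange Γ ω 0 a.succ b.succ z
      + projChange Γ ω 0 b.succ a.succ z), ω,
    fun j a b => by simp only [add_comm], fun a b => by simp only [add_comm],
    fun j => (hΔ _ _ _).fun_neg, fun j a => analyticAt_const.fun_mul (hΔ _ _ _),
    fun j a b => analyticAt_const.fun_mul ((hΔ _ _ _).fun_add (hΔ _ _ _)),
    fun a b => analyticAt_const.fun_mul ((hΔ _ _ _).fun_add (hΔ _ _ _)), hω, ?_⟩
  filter_upwards [hsymm] with z hz
  have hs := fun k i j => projChange_symm (ω := ω) hz k i j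
  have h0 : ∀ j, projChange Γ ω 0 0 j z = 0 := by
    intro j
    cases j using Fin.cases with
    | zero => simp only [projChange, hω0, kd_self]; ring
    | succ b => simp only [projChange, hωs, kd_self, kd_zero_succ]; ring
  intro k i j
  cases k using Fin.cases with
  | zero =>
    cases i using Fin.cases with
    | zero => rw [gaugeConn_zero_zero, h0]
    | succ a =>
      cases j using Fin.cases with
      | zero => rw [gaugeConn_zero_succ_zero, hs, h0]
      | succ b => rw [gaugeConn_zero_succ_succ, hs 0 b.succ a.succ]; ring
  | succ d =>
    cases i using Fin.cases with
    | zero =>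
      cases j using Fin.cases with
      | zero => simp only [gaugeConn_succ_zero_zero, neg_neg]
      | succ b => rw [gaugeConn_succ_zero_succ]; ring
    | succ a =>
      cases j using Fin.cases with
      | zero => rw [gaugeConn_succ_succ_zero, hs d.succ a.succ 0]; ring
      | succ b => simp only [gaugeConn_succ_succ_succ]; rw [hs d.succ b.succ a.succ]; ring

theorem curv_congr {m : ℕ}
    {Γ Γ' : Fin (m + 1) → Fin (m + 1) → Fin (m + 1) → (Fin (m + 1) → ℝ) → ℝ}
    {z : Fin (m + 1) → ℝ} (h : ∀ᶠ w in 𝓝 z, ∀ k i j, Γ k i j w = Γ' k i j w)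
    (k j l i : Fin (m + 1)) : curv m Γ k j l i z = curv m Γ' k j l i z := by
  have h1 (a b c d) : pd m a (Γ b c d) z = pd m a (Γ' b c d) z :=
    pd_congr (h.mono fun w hw => hw b c d)
  simp only [curv, h1, h.self_of_nhds]

/-- **Theorem 1.7, (1) ⟺ (3)**: for `m ≥ 2`, a system `y_xx^j = F^j(x, y, y_x)` is
equivalent under a point transformation to the free-particle system `Y_XX^j = 0`
if and only if the `F^j` have the specific cubic form in `y_x` with coefficients
`(G, H, L, M)` satisfying the four families (I)–(IV) of first-order PDEs. -/
theorem newtonian_free_particle_characterization (m : ℕ) (hm : 2 ≤ m)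
    (F : Fin m → ((Fin (m + 1) → ℝ) × (Fin m → ℝ)) → ℝ)
    (VF : Set ((Fin (m + 1) → ℝ) × (Fin m → ℝ)))
    (hVF : VF ∈ nhds (0 : (Fin (m + 1) → ℝ) × (Fin m → ℝ)))
    (hF : ∀ j, AnalyticOnNhd ℝ (F j) VF) :
    (∃ Z : Fin (m + 1) → (Fin (m + 1) → ℝ) → ℝ,
      (∃ W ∈ nhds (0 : Fin (m + 1) → ℝ), ∀ i, AnalyticOnNhd ℝ (Z i) W) ∧
      MapsToFree m F Z)
    ↔
    (∃ (G : Fin m → (Fin (m + 1) → ℝ) → ℝ)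
       (H : Fin m → Fin m → (Fin (m + 1) → ℝ) → ℝ)
       (L : Fin m → Fin m → Fin m → (Fin (m + 1) → ℝ) → ℝ)
       (M : Fin m → Fin m → (Fin (m + 1) → ℝ) → ℝ),
      (∀ j a b, L j a b = L j b a) ∧ (∀ a b, M a b = M b a) ∧
      ∃ W ∈ nhds (0 : Fin (m + 1) → ℝ),
        (∀ j, AnalyticOnNhd ℝ (G j) W) ∧
        (∀ j a, AnalyticOnNhd ℝ (H j a) W) ∧
        (∀ j a b, AnalyticOnNhd ℝ (L j a b) W) ∧
        (∀ a b, AnalyticOnNhd ℝ (M a b) W) ∧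
        (∃ V ∈ nhds (0 : (Fin (m + 1) → ℝ) × (Fin m → ℝ)), ∀ w ∈ V, ∀ j : Fin m,
          F j w = G j w.1 + ∑ l₁ : Fin m, w.2 l₁ * H j l₁ w.1
            + ∑ l₁ : Fin m, ∑ l₂ : Fin m, w.2 l₁ * w.2 l₂ * L j l₁ l₂ w.1
            + w.2 j * ∑ l₁ : Fin m, ∑ l₂ : Fin m, w.2 l₁ * w.2 l₂ * M l₁ l₂ w.1) ∧
        CondsItoIV m W G H L M) := by
  constructor
  · rintro ⟨Z, ⟨W, hW, hZW⟩, hZF⟩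
    have hZ : ∀ a, AnalyticAt ℝ (Z a) 0 := fun a => hZW a 0 (mem_of_mem_nhds hW)
    obtain ⟨Γ, hΓ, hsymm, hZΓ, hR⟩ := exists_flat_connection hZ hZF.1
    obtain ⟨G, H, L, M, ω, hL, hM, hGa, hHa, hLa, hMa, hω, hg⟩ := exists_gaugeConn hΓ hsymm
    have hf : ∀ᶠ z in 𝓝 0, ∀ a i j, pd m i (pd m j (Z a)) z =
        ∑ k, gaugeConn G H L M k i j z * pd m k (Z a) z
          + -ω i z * pd m j (Z a) z + -ω j z * pd m i (Z a) z := by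
      filter_upwards [hZΓ, hg] with z h1 h2 a i j
      simp only [h1, h2, projChange, add_mul, Finset.sum_add_distrib, mul_assoc, sum_kd_mul]
      ring
    have hR' : ∀ᶠ z in 𝓝 0, ∀ k j l i, curv m (gaugeConn G H L M) k j l i z =
        traceCurv (fun a b => schoutenChange m Γ ω a b z) k j l i := by
      filter_upwards [hg.eventually_nhds, hR, hsymm,
        eventually_all.2 fun k => eventually_all.2 fun i => eventually_all.2 fun j =>
          (hΓ k i j).eventually_analyticAt,
        eventually_all.2 fun i => (hω i).eventually_analyticAt] with z h1 h2 h3 h4 h5 k j l i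
      rw [curv_congr h1, curv_projChange h4 h5 h3, h2, zero_add]
    refine ⟨G, H, L, M, hL, hM,
      {z | (∀ j, AnalyticAt ℝ (G j) z) ∧ (∀ j a, AnalyticAt ℝ (H j a) z) ∧
        (∀ j a b, AnalyticAt ℝ (L j a b) z) ∧ (∀ a b, AnalyticAt ℝ (M a b) z) ∧
        ∀ k j l i, curv m (gaugeConn G H L M) k j l i z =
          traceCurv (fun a b => schoutenChange m Γ ω a b z) k j l i}, ?_,
      fun j z hz => hz.1 j, fun j a z hz => hz.2.1 j a, fun j a b z hz => hz.2.2.1 j a b,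
      fun a b z hz => hz.2.2.2.1 a b,
      ⟨_, (mapsToFree_iff_eq_cubicForm hM hL hZ hZF.1 hf).1 hZF, fun w hw => hw⟩,
      condsItoIV_of_curv_eq_traceCurv (fun z hz => hz.2.1) hL hM fun z hz => hz.2.2.2.2⟩
    filter_upwards [hR', eventually_all.2 fun j => (hGa j).eventually_analyticAt,
      eventually_all.2 fun j => eventually_all.2 fun a => (hHa j a).eventually_analyticAt,
      eventually_all.2 fun j => eventually_all.2 fun a => eventually_all.2 fun b =>
        (hLa j a b).eventually_analyticAt,
      eventually_all.2 fun a => eventually_all.2 fun b => (hMa a b).eventually_analyticAt]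
      with z h1 h2 h3 h4 h5
    exact ⟨h2, h3, h4, h5, h1⟩
  · rintro ⟨G, H, L, M, hL, hM, W, hW, hGa, hHa, hLa, hMa, ⟨V, hV, hFV⟩, hC⟩
    have h0 := mem_of_mem_nhds hW
    have hΓ := AnalyticAt.gaugeConn (fun j => hGa j 0 h0) (fun j a => hHa j a 0 h0)
      (fun j a b => hLa j a b 0 h0) (fun a b => hMa a b 0 h0)
    have o : Fin m := ⟨0, by omega⟩
    obtain ⟨Z, ω, hZ, hZ0, hf⟩ := exists_flat_coordinates hm hΓ (AnalyticAt.gaugeSchouten hΓ o)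
      (Eventually.of_forall fun w k i j => congrFun (gaugeConn_symm hL hM k i j) w)
      (by
        filter_upwards [hW] with w hw
        exact curv_eq_traceCurv_of_condsItoIV (fun j a => hHa j a w hw) hL hM hw hC o)
    exact ⟨Z, ⟨_, eventually_all.2 fun a => (hZ a).eventually_analyticAt, fun i z hz => hz i⟩,
      (mapsToFree_iff_eq_cubicForm hM hL hZ hZ0 hf).2 (mem_of_superset hV hFV)⟩
end

section
/- Let m ≥ 2 and let G₀^j, G_{1,l}^j, H_l^j (j, l ∈ {1, …, m}) be real-analytic functions of x near 0 ∈ ℝ. The (nonhomogeneous) linear system y_xx^j = G₀^j(x) + Σ_{l=1}^m y^l·G_{1,l}^j(x) + Σ_{l=1}^m y_x^l·H_l^j(x) is mapped to the free-particle system Y_XX^j = 0 by some point transformation in the sense of the context (with F^j(x,y,p) := G₀^j(x) + Σ_{l=1}^m y^l·G_{1,l}^j(x) + Σ_{l=1}^m p^l·H_l^j(x)) if and only if there exists a real-analytic function B(x) near 0 such that, for all j, l ∈ {1, …, m}, G_{1,l}^j(x) = (1/2)·(d/dx)H_l^j(x) − (1/4)·Σ_{k=1}^m H_k^j(x)·H_l^k(x)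 + δ^j_l·B(x), where δ is the Kronecker delta. -/
open Filter Topology

/-- Taylor coefficients of the solution of `Y' = Y * M + G`, `Y 0 = y₀`. -/
noncomputable def odeCoeff {𝔸 : Type*} [NormedRing 𝔸] [NormedAlgebra ℝ 𝔸]
    (M G : ℕ → 𝔸) (y₀ : 𝔸) : ℕ → 𝔸
  | 0 => y₀
  | n + 1 => ((n : ℝ) + 1)⁻¹ • (G n + ∑ i : Fin (n + 1), odeCoeff M G y₀ i * M (n - i))

theorem odeCoeff_succ {𝔸 : Type*} [NormedRing 𝔸] [NormedAlgebra ℝ 𝔸]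
    (M G : ℕ → 𝔸) (y₀ : 𝔸) (n : ℕ) :
    (n + 1) • odeCoeff M G y₀ (n + 1) =
      G n + ∑ kl ∈ Finset.HasAntidiagonal.antidiagonal n, odeCoeff M G y₀ kl.1 * M kl.2 := by
  rw [odeCoeff, Finset.Nat.sum_antidiagonal_eq_sum_range_succ
    (fun k l => odeCoeff M G y₀ k * M l), Finset.sum_range, ← Nat.cast_smul_eq_nsmul ℝ,
    smul_smul]
  push_cast
  rw [mul_inv_cancel₀ (by positivity), one_smul]

theorem norm_odeCoeff_le {𝔸 : Type*} [NormedRing 𝔸] [NormedAlgebra ℝ 𝔸]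
    {M G : ℕ → 𝔸} (y₀ : 𝔸) {C K a : ℝ} (hK : 1 ≤ K) (hyK : ‖y₀‖ ≤ K) (hC : 0 ≤ C)
    (ha : 2 * C ≤ a)
    (hM : ∀ n, ‖M n‖ ≤ C * a ^ n) (hG : ∀ n, ‖G n‖ ≤ C * a ^ n) (n : ℕ) :
    ‖odeCoeff M G y₀ n‖ ≤ K * a ^ n := by
  have ha0 : 0 ≤ a := by linarith
  induction n using Nat.strong_induction_on with
  | _ n ih =>
    rcases n with _ | n
    · simpa [odeCoeff] using hyK
    · have hsum : ‖∑ i : Fin (n + 1), odeCoeff M G y₀ i * M (n - i)‖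
          ≤ (n + 1) * (K * C * a ^ n) := by
        refine (norm_sum_le _ _).trans ?_
        refine (Finset.sum_le_card_nsmul _ _ (K * C * a ^ n) fun i _ => ?_).trans (by simp)
        have hi : (i : ℕ) + (n - i) = n := by have := i.2; omega
        calc ‖odeCoeff M G y₀ i * M (n - i)‖
            ≤ (K * a ^ (i : ℕ)) * (C * a ^ (n - (i : ℕ))) :=
              (norm_mul_le _ _).trans
                (mul_le_mul (ih i i.2) (hM _) (norm_nonneg _) (by positivity))
          _ = K * C * a ^ ((i : ℕ) + (n - i)) := by rw [pow_add]; ring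
          _ = K * C * a ^ n := by rw [hi]
      rw [odeCoeff, norm_smul, norm_inv, Real.norm_of_nonneg (by positivity),
        inv_mul_le_iff₀ (by positivity)]
      have hCa : 0 ≤ C * a ^ n := by positivity
      have hKn : 1 ≤ K * (n + 1) := by
        nlinarith [(Nat.cast_nonneg n : (0 : ℝ) ≤ n)]
      have h1 : C * a ^ n ≤ K * (n + 1) * (C * a ^ n) := le_mul_of_one_le_left hCa hKn
      have h2 : 2 * C * (K * (n + 1) * a ^ n) ≤ a * (K * (n + 1) * a ^ n) :=
        mul_le_mul_of_nonneg_right ha (by positivity)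
      calc _ ≤ C * a ^ n + (n + 1) * (K * C * a ^ n) :=
            (norm_add_le _ _).trans (add_le_add (hG n) hsum)
        _ ≤ (n + 1) * (K * a ^ (n + 1)) := by rw [pow_succ]; nlinarith

/-- A linear differential equation with analytic coefficients in a Banach algebra has an analytic
solution with prescribed initial value. -/
theorem exists_analyticAt_hasDerivAt_mul_add {𝔸 : Type*} [NormedRing 𝔸] [NormedAlgebra ℝ 𝔸]
    [CompleteSpace 𝔸] {M G : ℝ → 𝔸} (hM : AnalyticAt ℝ M 0) (hG : AnalyticAt ℝ G 0) (y₀ : 𝔸) :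
    ∃ Y : ℝ → 𝔸, AnalyticAt ℝ Y 0 ∧ Y 0 = y₀ ∧
      ∀ᶠ x in 𝓝 0, HasDerivAt Y (Y x * M x + G x) x := by
  obtain ⟨p, hp⟩ := hM
  obtain ⟨q, hq⟩ := hG
  obtain ⟨C₁, r₁, hC₁, hr₁, h₁⟩ := p.le_mul_pow_of_radius_pos hp.radius_pos
  obtain ⟨C₂, r₂, hC₂, hr₂, h₂⟩ := q.le_mul_pow_of_radius_pos hq.radius_pos
  set C := max C₁ C₂
  set a := max (2 * C) (max r₁ r₂) with ha
  have hC : 0 < C := lt_max_of_lt_left hC₁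
  have ha0 : 0 < a := lt_max_of_lt_left (by positivity)
  have hpa : ∀ n, ‖p.coeff n‖ ≤ C * a ^ n := fun n => by
    rw [← p.norm_apply_eq_norm_coef]
    exact (h₁ n).trans (by gcongr; exacts [le_max_left _ _, by simp [ha]])
  have hqa : ∀ n, ‖q.coeff n‖ ≤ C * a ^ n := fun n => by
    rw [← q.norm_apply_eq_norm_coef]
    exact (h₂ n).trans (by gcongr; exacts [le_max_right _ _, by simp [ha]])
  set y := odeCoeff p.coeff q.coeff y₀ with hy
  set K := max 1 ‖y₀‖
  have hya : ∀ n, ‖y n‖ ≤ K * a ^ n :=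
    norm_odeCoeff_le y₀ (le_max_left _ _) (le_max_right _ _) hC.le (le_max_left _ _) hpa hqa
  let s : FormalMultilinearSeries ℝ ℝ 𝔸 :=
    fun n => ContinuousMultilinearMap.mkPiRing ℝ (Fin n) (y n)
  have hs : ∀ n, s.coeff n = y n := fun n => by
    simp [s, FormalMultilinearSeries.coeff]
  have hsr : 0 < s.radius := by
    have := s.le_radius_of_bound (r := ⟨a⁻¹, by positivity⟩) K fun n => by
      rw [s.norm_apply_eq_norm_coef, hs]
      calc ‖y n‖ * a⁻¹ ^ n ≤ K * a ^ n * a⁻¹ ^ n := by gcongr; exact hya n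
        _ = K := by rw [mul_assoc, ← mul_pow, mul_inv_cancel₀ ha0.ne', one_pow, mul_one]
    refine lt_of_lt_of_le ?_ this
    exact ENNReal.coe_pos.2 (inv_pos.2 ha0 : (0 : ℝ) < a⁻¹)
  have hball := s.hasFPowerSeriesOnBall hsr
  have hsat : HasFPowerSeriesAt s.sum s 0 := hball.hasFPowerSeriesAt
  have hD : HasFPowerSeriesAt (fderiv ℝ s.sum) s.derivSeries 0 := hball.fderiv.hasFPowerSeriesAt
  refine ⟨s.sum, hsat.analyticAt, ?_, ?_⟩
  · rw [← hsat.coeff_zero 0]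
    simp [s, hy, odeCoeff]
  · rw [hasFPowerSeriesAt_iff] at hp hq hsat hD
    have hsmall : ∀ᶠ x : ℝ in 𝓝 0, ‖x‖ < a⁻¹ := by
      have : Tendsto (fun x : ℝ => ‖x‖) (𝓝 0) (𝓝 0) := by
        simpa using (continuous_norm (E := ℝ)).tendsto 0
      exact this.eventually_lt_const (by positivity)
    have hnorm : ∀ (K : ℝ) (f : ℕ → 𝔸), (∀ n, ‖f n‖ ≤ K * a ^ n) → ∀ x : ℝ, ‖x‖ < a⁻¹ →
        Summable fun n => ‖x ^ n • f n‖ := by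
      intro K f hf x hx
      have hxa : ‖x‖ * a < 1 := by rwa [← lt_div_iff₀ ha0, one_div]
      refine Summable.of_nonneg_of_le (fun _ => norm_nonneg _) (fun n => ?_)
        ((summable_geometric_of_lt_one (by positivity) hxa).mul_left K)
      rw [norm_smul, norm_pow, mul_pow]
      nlinarith [hf n, pow_nonneg (norm_nonneg x) n]
    filter_upwards [hp, hq, hsat, hD, hsmall,
      hball.analyticAt.eventually_analyticAt] with x hpx hqx hsx hDx hx hax
    simp only [zero_add, hs] at hpx hqx hsx hDx
    have hd := hax.differentiableAt.hasDerivAt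
    convert! hd using 1
    have h3 := hDx.mapL (ContinuousLinearMap.apply ℝ 𝔸 (1 : ℝ))
    simp only [map_smul, ContinuousLinearMap.apply_apply, s.derivSeries_coeff_one, hs,
      fderiv_eq_smul_deriv, one_smul] at h3
    refine HasSum.unique ?_ h3
    have h4 := summable_norm_sum_mul_antidiagonal_of_summable_norm
      (hnorm K y hya x hx) (hnorm C _ hpa x hx)
    have h5 := tsum_mul_tsum_eq_tsum_sum_antidiagonal_of_summable_norm
      (hnorm K y hya x hx) (hnorm C _ hpa x hx)
    rw [hsx.tsum_eq, hpx.tsum_eq] at h5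
    have h6 := h4.of_norm.hasSum
    rw [← h5] at h6
    convert! h6.add hqx using 2 with n
    rw [hy, odeCoeff_succ, smul_add, add_comm, Finset.smul_sum]
    congr 1
    refine Finset.sum_congr rfl fun kl hkl => ?_
    rw [smul_mul_smul_comm, ← pow_add, Finset.HasAntidiagonal.mem_antidiagonal.1 hkl]

theorem exists_analyticAt_hasDerivAt {g : ℝ → ℝ} (hg : AnalyticAt ℝ g 0) :
    ∃ f : ℝ → ℝ, AnalyticAt ℝ f 0 ∧ f 0 = 0 ∧ ∀ᶠ x in 𝓝 0, HasDerivAt f (g x) x := by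
  simpa using exists_analyticAt_hasDerivAt_mul_add (M := fun _ => (0 : ℝ)) analyticAt_const hg 0

open scoped Matrix.Norms.Operator in
/-- Existence of an analytic fundamental matrix for a linear system with analytic coefficients. -/
theorem exists_analyticAt_fundamentalMatrix {ι : Type*} [Fintype ι] [DecidableEq ι]
    {M : ι → ι → ℝ → ℝ} (hM : ∀ i j, AnalyticAt ℝ (M i j) 0) :
    ∃ c : ι → ι → ℝ → ℝ, (∀ i j, AnalyticAt ℝ (c i j) 0) ∧
      (∀ i j, c i j 0 = if i = j then 1 else 0) ∧
      ∀ᶠ x in 𝓝 0, ∀ i j, HasDerivAt (c i j) (∑ k, c i k x * M k j x) x := by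
  have hMat : AnalyticAt ℝ (fun x => ∑ i, ∑ j, M i j x • Matrix.single i j (1 : ℝ)) 0 :=
    Finset.analyticAt_fun_sum _ fun i _ => Finset.analyticAt_fun_sum _ fun j _ =>
      (hM i j).fun_smul analyticAt_const
  obtain ⟨Y, hY, hY0, hYd⟩ := exists_analyticAt_hasDerivAt_mul_add hMat analyticAt_const
    (G := fun _ => 0) (1 : Matrix ι ι ℝ)
  let entry (i j : ι) : Matrix ι ι ℝ →L[ℝ] ℝ :=
    LinearMap.toContinuousLinearMap (Matrix.entryLinearMap ℝ ℝ i j)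
  have hsum : ∀ x, (∑ i, ∑ j, M i j x • Matrix.single i j (1 : ℝ)) = Matrix.of fun i j => M i j x :=
    fun x => by
      rw [Matrix.matrix_eq_sum_single (Matrix.of fun i j => M i j x)]
      simp [Matrix.smul_single]
  refine ⟨fun i j x => Y x i j, fun i j => (entry i j).analyticAt _ |>.comp hY, fun i j => ?_, ?_⟩
  · simp [hY0, Matrix.one_apply]
  · filter_upwards [hYd] with x hx i j
    have := (entry i j).hasFDerivAt.comp_hasDerivAt x hx
    rw [hsum, add_zero] at this
    exact this

/-- The function `(x, y) ↦ α x + ∑ l, β l x * y l`. -/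
noncomputable def fiberAffine (m : ℕ) (α : ℝ → ℝ) (β : Fin m → ℝ → ℝ) (z : Fin (m + 1) → ℝ) : ℝ :=
  α (z 0) + ∑ l, β l (z 0) * z l.succ

section fiberAffine

variable {m : ℕ} {α α' : ℝ → ℝ} {β β' : Fin m → ℝ → ℝ} {z : Fin (m + 1) → ℝ}

theorem hasFDerivAt_fiberAffine (hα : HasDerivAt α (α' (z 0)) (z 0))
    (hβ : ∀ l, HasDerivAt (β l) (β' l (z 0)) (z 0)) :
    HasFDerivAt (fiberAffine m α β)
      (α' (z 0) • ContinuousLinearMap.proj (R := ℝ) (φ := fun _ : Fin (m + 1) => ℝ) 0 +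
        ∑ l : Fin m, (β l (z 0) • ContinuousLinearMap.proj l.succ +
          z l.succ • (β' l (z 0) • ContinuousLinearMap.proj 0))) z := by
  have h0 : ∀ i, HasFDerivAt (fun z : Fin (m + 1) → ℝ => z i)
      (ContinuousLinearMap.proj (R := ℝ) (φ := fun _ : Fin (m + 1) => ℝ) i) z :=
    fun i => hasFDerivAt_apply i z
  exact (hα.comp_hasFDerivAt z (h0 0)).add
    (HasFDerivAt.fun_sum fun l _ => ((hβ l).comp_hasFDerivAt z (h0 0)).mul (h0 l.succ))

theorem pd_zero_fiberAffine (hα : HasDerivAt α (α' (z 0)) (z 0))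
    (hβ : ∀ l, HasDerivAt (β l) (β' l (z 0)) (z 0)) :
    pd m 0 (fiberAffine m α β) z = fiberAffine m α' β' z := by
  simp [pd, fiberAffine, (hasFDerivAt_fiberAffine hα hβ).fderiv, mul_comm]

theorem pd_succ_fiberAffine (hα : HasDerivAt α (α' (z 0)) (z 0))
    (hβ : ∀ l, HasDerivAt (β l) (β' l (z 0)) (z 0)) (l : Fin m) :
    pd m l.succ (fiberAffine m α β) z = β l (z 0) := by
  simp [pd, (hasFDerivAt_fiberAffine hα hβ).fderiv, Pi.single_apply]

theorem Dop_fiberAffine (hα : HasDerivAt α (α' (z 0)) (z 0))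
    (hβ : ∀ l, HasDerivAt (β l) (β' l (z 0)) (z 0)) (p : Fin m → ℝ) :
    Dop m (fiberAffine m α β) z p = fiberAffine m α' β' z + ∑ l, p l * β l (z 0) := by
  simp [Dop, pd_zero_fiberAffine hα hβ, pd_succ_fiberAffine hα hβ]

theorem DDop_fiberAffine {α'' : ℝ → ℝ} {β'' : Fin m → ℝ → ℝ}
    (hα : ∀ᶠ x in 𝓝 (z 0), HasDerivAt α (α' x) x)
    (hβ : ∀ᶠ x in 𝓝 (z 0), ∀ l, HasDerivAt (β l) (β' l x) x)
    (hα' : HasDerivAt α' (α'' (z 0)) (z 0))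
    (hβ' : ∀ l, HasDerivAt (β' l) (β'' l (z 0)) (z 0)) (p q : Fin m → ℝ) :
    DDop m (fiberAffine m α β) z p q = fiberAffine m α'' β'' z +
      2 * ∑ l, p l * β' l (z 0) + ∑ l, q l * β l (z 0) := by
  have ht : Tendsto (fun z : Fin (m + 1) → ℝ => z 0) (𝓝 z) (𝓝 (z 0)) :=
    (continuous_apply 0).tendsto z
  have e0 : pd m 0 (fiberAffine m α β) =ᶠ[𝓝 z] fiberAffine m α' β' := by
    filter_upwards [ht.eventually hα, ht.eventually hβ] with x h1 h2
    exact pd_zero_fiberAffine h1 h2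
  have e1 : ∀ l : Fin m, pd m l.succ (fiberAffine m α β) =ᶠ[𝓝 z]
      fiberAffine m (β l) (fun _ _ => 0) := fun l => by
    filter_upwards [ht.eventually hα, ht.eventually hβ] with x h1 h2
    simp [pd_succ_fiberAffine h1 h2, fiberAffine]
  have hpd : ∀ {f g : (Fin (m + 1) → ℝ) → ℝ}, f =ᶠ[𝓝 z] g → ∀ i, pd m i f z = pd m i g z :=
    fun h i => by simp [pd, h.fderiv_eq]
  have h2 : ∀ l k : Fin m, pd m k.succ (pd m l.succ (fiberAffine m α β)) z = 0 := fun l k => by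
    rw [hpd (e1 l), pd_succ_fiberAffine (α' := β' l) (β' := fun _ _ => 0)
      (hβ.self_of_nhds l) fun _ => hasDerivAt_const _ _]
  simp only [DDop, h2, hpd e0, pd_zero_fiberAffine hα' hβ', pd_succ_fiberAffine hα' hβ',
    pd_succ_fiberAffine hα.self_of_nhds hβ.self_of_nhds]
  simp

theorem analyticAt_fiberAffine (hα : AnalyticAt ℝ α (z 0)) (hβ : ∀ l, AnalyticAt ℝ (β l) (z 0)) :
    AnalyticAt ℝ (fiberAffine m α β) z := by
  have h0 : ∀ i, AnalyticAt ℝ (fun z : Fin (m + 1) → ℝ => z i) z :=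
    fun i => (ContinuousLinearMap.proj (R := ℝ) (φ := fun _ : Fin (m + 1) => ℝ) i).analyticAt z
  exact (AnalyticAt.fun_comp_of_eq (g := α) (f := fun z => z 0) hα (h0 0) rfl).add <|
    Finset.analyticAt_fun_sum _ fun l _ =>
    (AnalyticAt.fun_comp_of_eq (g := β l) (f := fun z => z 0) (hβ l) (h0 0) rfl).mul (h0 l.succ)

end fiberAffine

/-- Criterion for `Y = α + ∑ l, β l * y l` to satisfy `Y'' = κ * Y'` along solutions of a linear
system, at the level of the values at a single point. -/
theorem affine_total_derivative_eq {m : ℕ} {α' α'' κ : ℝ} {β β' β'' g y p : Fin m → ℝ}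
    {G H : Fin m → Fin m → ℝ}
    (h0 : α'' + ∑ k, β k * g k = κ * α')
    (hy : ∀ l, β'' l + ∑ k, β k * G k l = κ * β' l)
    (hp : ∀ l, 2 * β' l + ∑ k, β k * H k l = κ * β l) :
    (α'' + ∑ l, β'' l * y l) + 2 * ∑ l, p l * β' l +
        ∑ k, (g k + (∑ l, y l * G k l) + ∑ l, p l * H k l) * β k =
      κ * ((α' + ∑ l, β' l * y l) + ∑ l, p l * β l) := by
  have hs : ∀ (A : Fin m → Fin m → ℝ) (v : Fin m → ℝ),
      ∑ k, (∑ l, v l * A k l) * β k = ∑ l, v l * ∑ k, β k * A k l := fun A v => by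
    simp only [Finset.sum_mul, Finset.mul_sum]
    rw [Finset.sum_comm]
    exact Finset.sum_congr rfl fun _ _ => Finset.sum_congr rfl fun _ _ => by ring
  have hy' : ∑ l, y l * (β'' l + ∑ k, β k * G k l) = ∑ l, y l * (κ * β' l) := by simp_rw [hy]
  have hp' : ∑ l, p l * (2 * β' l + ∑ k, β k * H k l) = ∑ l, p l * (κ * β l) := by simp_rw [hp]
  have e1 : ∑ k, g k * β k = ∑ k, β k * g k := Finset.sum_congr rfl fun _ _ => mul_comm _ _
  simp only [add_mul, Finset.sum_add_distrib, hs]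
  simp only [mul_add, Finset.sum_add_distrib, mul_left_comm _ κ, mul_left_comm _ (2 : ℝ),
    ← Finset.mul_sum, mul_comm (y _) (β'' _), mul_comm (y _) (β' _)] at hy' hp' ⊢
  linear_combination h0 + hy' + hp' + e1

theorem exists_mapsToFree_of_linear {m : ℕ} {G₀ : Fin m → ℝ → ℝ} {G₁ Hf : Fin m → Fin m → ℝ → ℝ}
    {B : ℝ → ℝ} (hG₀ : ∀ j, AnalyticAt ℝ (G₀ j) 0) (hHf : ∀ j l, AnalyticAt ℝ (Hf j l) 0)
    (hB : AnalyticAt ℝ B 0)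
    (h : ∀ᶠ x in 𝓝 0, ∀ j l : Fin m, G₁ j l x = (1/2) * deriv (Hf j l) x
      - (1/4) * ∑ k : Fin m, Hf j k x * Hf k l x + (if l = j then 1 else 0) * B x) :
    ∃ Z : Fin (m + 1) → (Fin (m + 1) → ℝ) → ℝ,
      (∃ W ∈ 𝓝 (0 : Fin (m + 1) → ℝ), ∀ i, AnalyticOnNhd ℝ (Z i) W) ∧
      MapsToFree m
        (fun j w => G₀ j (w.1 0) + (∑ l : Fin m, w.1 l.succ * G₁ j l (w.1 0))
          + ∑ l : Fin m, w.2 l * Hf j l (w.1 0)) Z := by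
  obtain ⟨c, hca, hc0, hcd⟩ := exists_analyticAt_fundamentalMatrix
    (M := fun k l x => -(1/2) * Hf k l x) fun k l => analyticAt_const.fun_mul (hHf k l)
  obtain ⟨f, hfa, hf0, hfd⟩ := exists_analyticAt_fundamentalMatrix (ι := Fin 2)
    (M := fun i j x => if i = 1 then (if j = 0 then 1 else 0) else if j = 0 then 0 else B x)
    fun i j => by split_ifs <;> first | exact hB | exact analyticAt_const
  set φ := f 0 0
  set ψ := f 0 1
  have hφ0 : φ 0 = 1 := by simp [φ, hf0]
  have hφa : AnalyticAt ℝ φ 0 := hfa 0 0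
  have hφd : ∀ᶠ x in 𝓝 0, HasDerivAt φ (ψ x) x := by
    filter_upwards [hfd] with x hx
    simpa [φ, ψ] using hx 0 0
  have hψd : ∀ᶠ x in 𝓝 0, HasDerivAt ψ (φ x * B x) x := by
    filter_upwards [hfd] with x hx
    simpa [φ, ψ] using hx 0 1
  have hφne : ∀ᶠ x in 𝓝 0, φ x ≠ 0 :=
    hφa.continuousAt.eventually_ne (by simp [hφ0])
  have hinv : AnalyticAt ℝ (fun x => (φ x)⁻¹) 0 := hφa.fun_inv (by simp [hφ0])
  obtain ⟨X, hXa, hX0, hXd⟩ := exists_analyticAt_hasDerivAt (hinv.fun_pow 2)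
  let β (j l : Fin m) (x : ℝ) : ℝ := c j l x * (φ x)⁻¹
  have hβa : ∀ j l, AnalyticAt ℝ (β j l) 0 := fun j l => (hca j l).fun_mul hinv
  have hδ := fun j => exists_analyticAt_hasDerivAt
    (g := fun x => -(φ x ^ 2 * ∑ k, β j k x * G₀ k x))
    ((hφa.fun_pow 2).fun_mul <|
      Finset.analyticAt_fun_sum _ fun k _ => (hβa j k).fun_mul (hG₀ k)).fun_neg
  choose δ hδa hδ0 hδd using hδ
  have hα := fun j => exists_analyticAt_hasDerivAt (g := fun x => (φ x)⁻¹ ^ 2 * δ j x)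
    ((hinv.fun_pow 2).fun_mul (hδa j))
  choose α hαa hα0 hαd using hα
  let e (j l : Fin m) (x : ℝ) : ℝ := ∑ k, c j k x * Hf k l x
  let β' (j l : Fin m) (x : ℝ) : ℝ := -(1/2) * e j l x * (φ x)⁻¹ - c j l x * ψ x * (φ x)⁻¹ ^ 2
  have hinvd : ∀ᶠ x in 𝓝 0, HasDerivAt (fun x => (φ x)⁻¹) (-ψ x * (φ x)⁻¹ ^ 2) x := by
    filter_upwards [hφd, hφne] with x h1 h2
    simpa [div_eq_mul_inv] using h1.fun_inv h2
  have hcd' : ∀ᶠ x in 𝓝 0, ∀ j l, HasDerivAt (c j l) (-(1/2) * e j l x) x := by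
    filter_upwards [hcd] with x h1 j l
    convert! h1 j l using 1
    simp only [e, Finset.mul_sum]
    exact Finset.sum_congr rfl fun _ _ => by ring
  have hβd : ∀ᶠ x in 𝓝 0, ∀ j l, HasDerivAt (β j l) (β' j l x) x := by
    filter_upwards [hcd', hinvd] with x h1 h2 j l
    convert! (h1 j l).fun_mul h2 using 1
    simp only [β']
    ring
  have hHd : ∀ᶠ x in 𝓝 0, ∀ j l, HasDerivAt (Hf j l) (deriv (Hf j l) x) x := by
    simp only [eventually_all]
    intro j l
    filter_upwards [(hHf j l).eventually_analyticAt] with x hx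
    exact hx.differentiableAt.hasDerivAt
  let e' (j l : Fin m) (x : ℝ) : ℝ :=
    ∑ k, (-(1/2) * e j k x * Hf k l x + c j k x * deriv (Hf k l) x)
  let β'' (j l : Fin m) (x : ℝ) : ℝ := -(1/2) * e' j l x * (φ x)⁻¹ + e j l x * ψ x * (φ x)⁻¹ ^ 2
    - c j l x * B x * (φ x)⁻¹ + 2 * c j l x * ψ x ^ 2 * (φ x)⁻¹ ^ 3
  have hβ'd : ∀ᶠ x in 𝓝 0, ∀ j l, HasDerivAt (β' j l) (β'' j l x) x := by
    filter_upwards [hcd', hinvd, hHd, hψd, hφne] with x h1 h2 h3 h4 h5 j l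
    have he : HasDerivAt (e j l) (e' j l x) x :=
      HasDerivAt.fun_sum fun k _ => (h1 j k).fun_mul (h3 k l)
    convert! ((he.const_mul (-(1/2))).fun_mul h2).fun_sub
      (((h1 j l).fun_mul h4).fun_mul (h2.fun_pow 2)) using 1
    simp only [β'', Nat.reduceSub, pow_one]
    field_simp
    ring
  let X'' (x : ℝ) : ℝ := -2 * ψ x * (φ x)⁻¹ ^ 3
  have hX'd : ∀ᶠ x in 𝓝 0, HasDerivAt (fun x => (φ x)⁻¹ ^ 2) (X'' x) x := by
    filter_upwards [hinvd] with x h2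
    convert! h2.fun_pow 2 using 1
    simp only [X'']
    ring
  let α'' (j : Fin m) (x : ℝ) : ℝ := X'' x * δ j x - ∑ k, β j k x * G₀ k x
  have hα'd : ∀ᶠ x in 𝓝 0, ∀ j, HasDerivAt (fun x => (φ x)⁻¹ ^ 2 * δ j x) (α'' j x) x := by
    filter_upwards [hX'd, eventually_all.2 hδd, hφne] with x h1 h2 h3 j
    convert! h1.fun_mul (h2 j) using 1
    simp only [α'']
    field_simp
    ring
  have hid : ∀ᶠ x in 𝓝 0, ∀ j,
      (α'' j x + ∑ k, β j k x * G₀ k x = -2 * ψ x * (φ x)⁻¹ * ((φ x)⁻¹ ^ 2 * δ j x)) ∧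
      (∀ l, β'' j l x + ∑ k, β j k x * G₁ k l x = -2 * ψ x * (φ x)⁻¹ * β' j l x) ∧
      (∀ l, 2 * β' j l x + ∑ k, β j k x * Hf k l x = -2 * ψ x * (φ x)⁻¹ * β j l x) := by
    filter_upwards [h] with x hx j
    refine ⟨?_, fun l => ?_, fun l => ?_⟩
    · simp only [α'', X'']
      ring
    · have h1 : ∑ k, β j k x * G₁ k l x =
          (φ x)⁻¹ * ((1/2) * ∑ k, c j k x * deriv (Hf k l) x
            - (1/4) * ∑ k, e j k x * Hf k l x + c j l x * B x) := by
        have h2 : ∑ k, e j k x * Hf k l x = ∑ k, c j k x * ∑ i, Hf k i x * Hf i l x := by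
          simp only [e, Finset.sum_mul, Finset.mul_sum]
          rw [Finset.sum_comm]
          exact Finset.sum_congr rfl fun _ _ => Finset.sum_congr rfl fun _ _ => by ring
        have h3 : c j l x * B x = ∑ k, c j k x * ((if l = k then 1 else 0) * B x) := by simp
        rw [h2, h3, Finset.mul_sum, Finset.mul_sum, ← Finset.sum_sub_distrib,
          ← Finset.sum_add_distrib, Finset.mul_sum]
        refine Finset.sum_congr rfl fun k _ => ?_
        rw [hx]
        simp only [β]
        ring
      rw [h1]
      have h4 : e' j l x = -(1/2) * ∑ k, e j k x * Hf k l x + ∑ k, c j k x * deriv (Hf k l) x := by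
        simp only [e', Finset.sum_add_distrib, Finset.mul_sum, mul_assoc]
      simp only [β'', β', h4]
      ring
    · have h1 : ∑ k, β j k x * Hf k l x = (φ x)⁻¹ * e j l x := by
        simp only [β, e, Finset.mul_sum]
        exact Finset.sum_congr rfl fun _ _ => by ring
      rw [h1]
      simp only [β', β]
      ring
  refine ⟨Fin.cons (fiberAffine m X fun _ _ => 0) fun j => fiberAffine m (α j) (β j), ?_, ?_, ?_⟩
  · have hev : ∀ᶠ z : Fin (m + 1) → ℝ in 𝓝 0, ∀ i, AnalyticAt ℝ
        ((Fin.cons (fiberAffine m X fun _ _ => 0) fun j => fiberAffine m (α j) (β j) :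
          Fin (m + 1) → (Fin (m + 1) → ℝ) → ℝ) i) z := by
      refine eventually_all.2 fun i => AnalyticAt.eventually_analyticAt ?_
      refine Fin.cases ?_ (fun i => ?_) i
      · exact analyticAt_fiberAffine hXa fun _ => analyticAt_const
      · exact analyticAt_fiberAffine (hαa i) (hβa i)
    obtain ⟨W, hW, hWa⟩ := hev.exists_mem
    exact ⟨W, hW, fun i z hz => hWa z hz i⟩
  · have hX := hXd.self_of_nhds
    have hα := fun j => (hαd j).self_of_nhds
    have hβ := hβd.self_of_nhds
    have h0 : ∀ l : Fin m, HasDerivAt (fun _ : ℝ => (0 : ℝ)) 0 0 := fun _ => hasDerivAt_const _ _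
    intro i j
    refine Fin.cases ?_ (fun i => ?_) i <;> refine Fin.cases ?_ (fun j => ?_) j
    · rw [Fin.cons_zero, pd_zero_fiberAffine (α' := fun x => (φ x)⁻¹ ^ 2)
        (β' := fun _ _ => 0) hX h0]
      simp [fiberAffine, hφ0]
    · rw [Fin.cons_zero, pd_succ_fiberAffine (α' := fun x => (φ x)⁻¹ ^ 2)
        (β' := fun _ _ => 0) hX h0]
      simp [(Fin.succ_ne_zero j).symm]
    · rw [Fin.cons_succ, pd_zero_fiberAffine (α' := fun x => (φ x)⁻¹ ^ 2 * δ i x) (hα i) (hβ i)]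
      simp [fiberAffine, hδ0]
    · rw [Fin.cons_succ, pd_succ_fiberAffine (α' := fun x => (φ x)⁻¹ ^ 2 * δ i x) (hα i) (hβ i)]
      simp [β, hc0, hφ0]
  · have ht : Tendsto (fun w : (Fin (m + 1) → ℝ) × (Fin m → ℝ) => w.1 0) (𝓝 0) (𝓝 0) :=
      ((continuous_apply 0).comp continuous_fst).tendsto' _ _ rfl
    refine Eventually.exists_mem ?_
    filter_upwards [ht.eventually hXd.eventually_nhds, ht.eventually hX'd,
      ht.eventually (eventually_all.2 hαd).eventually_nhds, ht.eventually hα'd,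
      ht.eventually hβd.eventually_nhds, ht.eventually hβ'd, ht.eventually hid]
      with w h1 h2 h3 h4 h5 h6 h7 j
    have h0 : ∀ᶠ x in 𝓝 (w.1 0), ∀ l : Fin m, HasDerivAt (fun _ : ℝ => (0 : ℝ)) 0 x :=
      Eventually.of_forall fun _ _ => hasDerivAt_const _ _
    obtain ⟨i1, i2, i3⟩ := h7 j
    have key := affine_total_derivative_eq (y := fun l => w.1 l.succ) (p := w.2) i1 i2 i3
    rw [Fin.cons_zero, Fin.cons_succ,
      Dop_fiberAffine (α' := fun x => (φ x)⁻¹ ^ 2) (β' := fun _ _ => 0)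
        h1.self_of_nhds h0.self_of_nhds,
      DDop_fiberAffine (α' := fun x => (φ x)⁻¹ ^ 2) (β' := fun _ _ => 0) (β'' := fun _ _ => 0)
        h1 h0 h2 h0.self_of_nhds,
      Dop_fiberAffine (α' := fun x => (φ x)⁻¹ ^ 2 * δ j x) (h3.self_of_nhds j) (h5.self_of_nhds j),
      DDop_fiberAffine (α' := fun x => (φ x)⁻¹ ^ 2 * δ j x) (h3.mono fun _ hx => hx j)
        (h5.mono fun _ hx => hx j) (h4 j) (h6 j)]
    simp only [fiberAffine]
    rw [key]
    simp only [X'', zero_mul, mul_zero, Finset.sum_const_zero, add_zero]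
    ring

theorem fderiv_fderiv_fderiv_eq_of_connection {E : Type*} [NormedAddCommGroup E] [NormedSpace ℝ E]
    [CompleteSpace E] {Φ : E → E} {Γ : E → E →L[ℝ] E →L[ℝ] E} {z : E} (hΦ : AnalyticAt ℝ Φ z)
    (hΓd : DifferentiableAt ℝ Γ z)
    (h : ∀ᶠ y in 𝓝 z, ∀ u v, fderiv ℝ (fderiv ℝ Φ) y u v = fderiv ℝ Φ y (Γ y u v)) (u v w : E) :
    fderiv ℝ (fderiv ℝ (fderiv ℝ Φ)) z w u v =
      fderiv ℝ Φ z (fderiv ℝ Γ z w u v + Γ z w (Γ z u v)) := by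
  have hJ : AnalyticAt ℝ (fderiv ℝ Φ) z := hΦ.fderiv
  have e : (fun z => fderiv ℝ (fderiv ℝ Φ) z u v) =ᶠ[𝓝 z] fun z => fderiv ℝ Φ z (Γ z u v) := by
    filter_upwards [h] with y hy using hy u v
  have h1 : HasFDerivAt (fun z => fderiv ℝ (fderiv ℝ Φ) z u v) _ z :=
    (hJ.fderiv.differentiableAt.hasFDerivAt.clm_apply (hasFDerivAt_const u z)).clm_apply
      (hasFDerivAt_const v z)
  have h2 : HasFDerivAt (fun z => fderiv ℝ Φ z (Γ z u v)) _ z :=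
    hJ.differentiableAt.hasFDerivAt.clm_apply
      ((hΓd.hasFDerivAt.clm_apply (hasFDerivAt_const u z)).clm_apply (hasFDerivAt_const v z))
  have h3 := DFunLike.congr_fun (h1.unique (h2.congr_of_eventuallyEq e)) w
  simpa [h.self_of_nhds, add_comm] using h3

/-- A local diffeomorphism `Φ` of a Banach space pulls the flat connection back to
a flat torsion-free connection `Γ`. -/
theorem exists_flat_connection_s16 {E : Type*} [NormedAddCommGroup E] [NormedSpace ℝ E]
    [CompleteSpace E] {Φ : E → E} {z₀ : E} (hΦ : AnalyticAt ℝ Φ z₀)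
    (hu : IsUnit (fderiv ℝ Φ z₀)) :
    ∃ Γ : E → E →L[ℝ] E →L[ℝ] E, ∀ᶠ z in 𝓝 z₀, IsUnit (fderiv ℝ Φ z) ∧ DifferentiableAt ℝ Γ z ∧
      (∀ u v, fderiv ℝ (fderiv ℝ Φ) z u v = fderiv ℝ Φ z (Γ z u v)) ∧
      (∀ u v, Γ z u v = Γ z v u) ∧
      ∀ u v w, fderiv ℝ Γ z w u v + Γ z w (Γ z u v) = fderiv ℝ Γ z u w v + Γ z u (Γ z w v) := by
  let Γ : E → E →L[ℝ] E →L[ℝ] E := fun z =>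
    (ContinuousLinearMap.compL ℝ E E E (Ring.inverse (fderiv ℝ Φ z))).comp
      (fderiv ℝ (fderiv ℝ Φ) z)
  have hunit : ∀ᶠ z in 𝓝 z₀, IsUnit (fderiv ℝ Φ z) :=
    hΦ.fderiv.continuousAt.eventually (Units.isOpen.mem_nhds hu)
  have hΓ : ∀ z, IsUnit (fderiv ℝ Φ z) → ∀ u v,
      fderiv ℝ (fderiv ℝ Φ) z u v = fderiv ℝ Φ z (Γ z u v) := fun z hz u v => by
    change _ = (fderiv ℝ Φ z * Ring.inverse (fderiv ℝ Φ z)) _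
    rw [Ring.mul_inverse_cancel _ hz]
    rfl
  refine ⟨Γ, ?_⟩
  filter_upwards [hunit.eventually_nhds, hΦ.eventually_analyticAt] with z hz hΦz
  have hzu := hz.self_of_nhds
  have hinj : Function.Injective (fderiv ℝ Φ z) :=
    (ContinuousLinearMap.isUnit_iff_bijective.1 hzu).1
  have hJ : AnalyticAt ℝ (fderiv ℝ Φ) z := hΦz.fderiv
  have hinv : DifferentiableAt ℝ (fun z => Ring.inverse (fderiv ℝ Φ z)) z := by
    obtain ⟨U, hU⟩ := hzu
    have := analyticAt_inverse (𝕜 := ℝ) U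
    rw [hU] at this
    exact DifferentiableAt.fun_comp' z this.differentiableAt hJ.differentiableAt
  have hΓd : DifferentiableAt ℝ Γ z :=
    ((ContinuousLinearMap.compL ℝ E E E).differentiableAt.comp z hinv).clm_comp
      hJ.fderiv.differentiableAt
  refine ⟨hzu, hΓd, hΓ z hzu, fun u v => hinj ?_, fun u v w => hinj ?_⟩
  · rw [← hΓ z hzu, ← hΓ z hzu]
    exact (hΦz.contDiffAt (n := 2)).isSymmSndFDerivAt (by simp) u v
  · have hev : ∀ᶠ y in 𝓝 z, ∀ u v,
        fderiv ℝ (fderiv ℝ Φ) y u v = fderiv ℝ Φ y (Γ y u v) := hz.mono hΓ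
    rw [← fderiv_fderiv_fderiv_eq_of_connection hΦz hΓd hev,
      ← fderiv_fderiv_fderiv_eq_of_connection hΦz hΓd hev]
    exact DFunLike.congr_fun
      ((hJ.contDiffAt (n := 2)).isSymmSndFDerivAt (by simp) w u) v

/-- The inclusion of the fibre directions `y` into `ℝ^{1+m}`. -/
def vert (m : ℕ) : (Fin m → ℝ) →ₗ[ℝ] (Fin (m + 1) → ℝ) where
  toFun u := Fin.cons 0 u
  map_add' u v := by ext i; refine Fin.cases ?_ (fun i => ?_) i <;> simp
  map_smul' c u := by ext i; refine Fin.cases ?_ (fun i => ?_) i <;> simp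

@[simp] theorem vert_zero_apply {m : ℕ} (u : Fin m → ℝ) : vert m u 0 = 0 := rfl

@[simp] theorem vert_succ_apply {m : ℕ} (u : Fin m → ℝ) (j : Fin m) : vert m u j.succ = u j := rfl

theorem vert_single {m : ℕ} (l : Fin m) : vert m (Pi.single l 1) = Pi.single l.succ 1 := by
  ext i; refine Fin.cases ?_ (fun i => ?_) i <;> simp [Pi.single_apply, (Fin.succ_ne_zero _).symm]

theorem eq_smul_single_add_vert {m : ℕ} (w : Fin (m + 1) → ℝ) :
    w = w 0 • Pi.single 0 1 + vert m (fun l => w l.succ) := by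
  ext i; refine Fin.cases ?_ (fun i => ?_) i <;> simp

theorem map_vert {m : ℕ} {F : Type*} [NormedAddCommGroup F] [NormedSpace ℝ F]
    (L : (Fin (m + 1) → ℝ) →L[ℝ] F) (u : Fin m → ℝ) :
    L (vert m u) = ∑ l, u l • L (Pi.single l.succ 1) := by
  conv_lhs => rw [pi_eq_sum_univ' u]
  simp only [map_sum, map_smul, vert_single]

theorem Dop_eq_fderiv {m : ℕ} (X : (Fin (m + 1) → ℝ) → ℝ) (z : Fin (m + 1) → ℝ) (p : Fin m → ℝ) :
    Dop m X z p = fderiv ℝ X z (Pi.single 0 1 + vert m p) := by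
  simp [Dop, pd, map_vert]

theorem DDop_eq_fderiv {m : ℕ} {X : (Fin (m + 1) → ℝ) → ℝ} {z : Fin (m + 1) → ℝ}
    (hX : AnalyticAt ℝ X z) (p q : Fin m → ℝ) :
    DDop m X z p q = fderiv ℝ (fderiv ℝ X) z (Pi.single 0 1 + vert m p) (Pi.single 0 1 + vert m p)
      + fderiv ℝ X z (vert m q) := by
  have h2 : ∀ i j, pd m j (pd m i X) z =
      fderiv ℝ (fderiv ℝ X) z (Pi.single j 1) (Pi.single i 1) := fun i j => by
    have := hX.fderiv.differentiableAt.hasFDerivAt.clm_apply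
      (hasFDerivAt_const (Pi.single i (1 : ℝ)) z)
    change fderiv ℝ (fun z => fderiv ℝ X z (Pi.single i 1)) z (Pi.single j 1) = _
    simp [this.fderiv]
  have hsymm : ∀ u v, fderiv ℝ (fderiv ℝ X) z u v = fderiv ℝ (fderiv ℝ X) z v u :=
    (hX.contDiffAt (n := 2)).isSymmSndFDerivAt (by simp)
  have h3 : fderiv ℝ (fderiv ℝ X) z (vert m p) (vert m p) = ∑ l₁ : Fin m, ∑ l₂ : Fin m,
      p l₁ * p l₂ * fderiv ℝ (fderiv ℝ X) z (Pi.single l₂.succ 1) (Pi.single l₁.succ 1) := by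
    rw [map_vert (fderiv ℝ (fderiv ℝ X) z (vert m p))]
    refine Finset.sum_congr rfl fun l₁ _ => ?_
    rw [hsymm, map_vert, smul_eq_mul, Finset.mul_sum]
    refine Finset.sum_congr rfl fun l₂ _ => ?_
    rw [hsymm, smul_eq_mul, mul_assoc]
  simp only [DDop, h2]
  simp only [map_add, add_apply, h3, map_vert _ q, pd, hsymm (Pi.single 0 1) (vert m p)]
  have h4 : fderiv ℝ (fderiv ℝ X) z (vert m p) (Pi.single 0 1) =
      ∑ l, p l * fderiv ℝ (fderiv ℝ X) z (Pi.single l.succ 1) (Pi.single 0 1) := by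
    rw [hsymm, map_vert]
    simp only [smul_eq_mul, hsymm (Pi.single 0 1)]
  rw [h4]
  simp only [smul_eq_mul]
  ring

theorem cubic_coeff_eq_zero {c₀ c₁ c₂ c₃ : ℝ}
    (h : ∀ᶠ t : ℝ in 𝓝 0, c₀ + c₁ * t + c₂ * t ^ 2 + c₃ * t ^ 3 = 0) :
    c₀ = 0 ∧ c₁ = 0 ∧ c₂ = 0 := by
  obtain ⟨ε, hε, hb⟩ := Metric.eventually_nhds_iff_ball.1 h
  have hs : ∀ k : ℝ, |k| ≤ 2 → c₀ + c₁ * (k * (ε / 3)) + c₂ * (k * (ε / 3)) ^ 2 +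
      c₃ * (k * (ε / 3)) ^ 3 = 0 := fun k hk => hb _ <| by
    rw [mem_ball_zero_iff, Real.norm_eq_abs, abs_mul, abs_of_pos (by positivity : 0 < ε / 3)]
    nlinarith
  have e0 := hs 0 (by norm_num)
  have e1 := hs 1 (by norm_num)
  have e2 := hs (-1) (by norm_num)
  have e3 := hs 2 (by norm_num)
  have h0 : c₀ = 0 := by linarith
  have h2 : c₂ * ε ^ 2 = 0 := by linarith
  have h1 : c₁ * ε = 0 := by linarith
  exact ⟨h0, (mul_eq_zero.1 h1).resolve_right hε.ne',
    (mul_eq_zero.1 h2).resolve_right (by positivity)⟩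

section connection

variable {m : ℕ} {Γ : (Fin (m + 1) → ℝ) →L[ℝ] (Fin (m + 1) → ℝ) →L[ℝ] (Fin (m + 1) → ℝ)}
  {g : Fin m → ℝ} {H : Fin m → Fin m → ℝ}

theorem connection_coeff_of_geodesic (hΓ : ∀ u v, Γ u v = Γ v u)
    (h : ∀ᶠ p in 𝓝 (0 : Fin m → ℝ), ∀ j,
      Γ (Pi.single 0 1 + vert m p) (Pi.single 0 1 + vert m p) j.succ + (g j + ∑ l, p l * H j l) =
        p j * Γ (Pi.single 0 1 + vert m p) (Pi.single 0 1 + vert m p) 0) (j : Fin m)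
    (u : Fin m → ℝ) :
    Γ (Pi.single 0 1) (Pi.single 0 1) j.succ = -g j ∧
    ∑ l, u l * H j l = u j * Γ (Pi.single 0 1) (Pi.single 0 1) 0 -
      2 * Γ (Pi.single 0 1) (vert m u) j.succ ∧
    Γ (vert m u) (vert m u) j.succ = 2 * u j * Γ (Pi.single 0 1) (vert m u) 0 := by
  have ht : Tendsto (fun t : ℝ => t • u) (𝓝 0) (𝓝 0) :=
    (continuous_id.smul continuous_const).tendsto' _ _ (by simp)
  have hc := cubic_coeff_eq_zero
    (c₀ := Γ (Pi.single 0 1) (Pi.single 0 1) j.succ + g j)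
    (c₁ := 2 * Γ (Pi.single 0 1) (vert m u) j.succ + ∑ l, u l * H j l -
      u j * Γ (Pi.single 0 1) (Pi.single 0 1) 0)
    (c₂ := Γ (vert m u) (vert m u) j.succ - 2 * u j * Γ (Pi.single 0 1) (vert m u) 0)
    (c₃ := -(u j * Γ (vert m u) (vert m u) 0)) (by
      filter_upwards [ht.eventually h] with t h1
      have h2 := h1 j
      simp only [map_add, map_smul, add_apply, Pi.add_apply, Pi.smul_apply,
        smul_apply, hΓ (vert m u) (Pi.single 0 1), smul_eq_mul, mul_assoc,
        ← Finset.mul_sum] at h2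
      linear_combination h2)
  obtain ⟨h0, h1, h2⟩ := hc
  exact ⟨by linarith, by linarith, by linarith⟩

theorem linear_coeff_eq_of_flat {Γd₀ : (Fin (m + 1) → ℝ)} {b' G₁ H' : ℝ} {j l : Fin m}
    {Γdl : (Fin (m + 1) → ℝ)} (hΓ : ∀ u v, Γ u v = Γ v u)
    (hg : ∀ j, Γ (Pi.single 0 1) (Pi.single 0 1) j.succ = -g j)
    (hH : ∀ j u, ∑ l, u l * H j l = u j * Γ (Pi.single 0 1) (Pi.single 0 1) 0 -
      2 * Γ (Pi.single 0 1) (vert m u) j.succ)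
    (hq : ∀ j u, Γ (vert m u) (vert m u) j.succ = 2 * u j * Γ (Pi.single 0 1) (vert m u) 0)
    (hd : Γdl j.succ = -G₁)
    (hd' : Γd₀ j.succ = (1/2) * ((if l = j then 1 else 0) * b' - H'))
    (hflat : Γdl + Γ (Pi.single l.succ 1) (Γ (Pi.single 0 1) (Pi.single 0 1)) =
      Γd₀ + Γ (Pi.single 0 1) (Γ (Pi.single l.succ 1) (Pi.single 0 1))) :
    G₁ = (1/2) * H' - (1/4) * ∑ k, H j k * H k l + (if l = j then 1 else 0) *
      ((1/4) * Γ (Pi.single 0 1) (Pi.single 0 1) 0 ^ 2 - Γ (Pi.single 0 1) (vert m g) 0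
        - (1/2) * b') := by
  set b := Γ (Pi.single 0 1) (Pi.single 0 1) 0
  have hpol : ∀ u w, Γ (vert m u) (vert m w) j.succ =
      u j * Γ (Pi.single 0 1) (vert m w) 0 + w j * Γ (Pi.single 0 1) (vert m u) 0 := by
    intro u w
    have h1 := hq j (u + w)
    have h2 := hq j u
    have h3 := hq j w
    simp only [map_add, add_apply, Pi.add_apply,
      hΓ (vert m w) (vert m u)] at h1
    linarith
  have h00 : Γ (Pi.single 0 1) (Pi.single 0 1) = b • Pi.single 0 1 - vert m g := by
    conv_lhs => rw [eq_smul_single_add_vert (Γ (Pi.single 0 1) (Pi.single 0 1))]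
    have : (fun l => -g l) = -g := rfl
    simp only [hg, this, map_neg, sub_eq_add_neg, b]
  have hl : ∀ k, Γ (Pi.single 0 1) (Pi.single l.succ 1) k.succ =
      (1/2) * ((if l = k then 1 else 0) * b - H k l) := fun k => by
    have := hH k (Pi.single l 1)
    rw [vert_single] at this
    simp only [Pi.single_apply, ite_mul, one_mul, zero_mul, Finset.sum_ite_eq', Finset.mem_univ,
      if_true, eq_comm (a := k)] at this ⊢
    linarith
  set h : Fin m → ℝ := fun k => (1/2) * ((if l = k then 1 else 0) * b - H k l) with hh
  have hl0 : Γ (Pi.single 0 1) (Pi.single l.succ 1) =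
      Γ (Pi.single 0 1) (Pi.single l.succ 1) 0 • Pi.single 0 1 + vert m h := by
    conv_lhs => rw [eq_smul_single_add_vert (Γ (Pi.single 0 1) (Pi.single l.succ 1))]
    simp only [hl, hh]
  have e1 := congrFun hflat j.succ
  rw [h00, hΓ (Pi.single l.succ 1) (Pi.single 0 1), hl0] at e1
  simp only [map_add, map_sub, map_smul, Pi.add_apply, Pi.sub_apply, Pi.smul_apply, smul_eq_mul,
    hd, hd', hg] at e1
  rw [hΓ (Pi.single l.succ 1) (Pi.single 0 1), hl, ← vert_single, hpol] at e1
  have e2 := hH j h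
  have e3 : ∑ k, h k * H j k = (1/2) * (b * H j l - ∑ k, H j k * H k l) := by
    simp only [hh, mul_assoc, ← Finset.mul_sum, sub_mul, Finset.sum_sub_distrib, ite_mul, one_mul,
      zero_mul, Finset.sum_ite_eq, Finset.mem_univ, if_true]
    congr 2
    exact Finset.sum_congr rfl fun _ _ => mul_comm _ _
  rw [e3] at e2
  simp only [hh, Pi.single_apply, eq_comm (a := j)] at e1 e2
  split_ifs at e1 e2 ⊢ <;> linarith

end connection

theorem fderiv_pi_apply {ι E : Type*} [Fintype ι] [NormedAddCommGroup E] [NormedSpace ℝ E]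
    {Z : ι → E → ℝ} {z : E} (hZ : ∀ i, AnalyticAt ℝ (Z i) z) (v : E) (i : ι) :
    fderiv ℝ (fun z i => Z i z) z v i = fderiv ℝ (Z i) z v := by
  rw [fderiv_pi fun i => (hZ i).differentiableAt]
  rfl

theorem fderiv_fderiv_pi_apply {ι E : Type*} [Fintype ι] [NormedAddCommGroup E] [NormedSpace ℝ E]
    [CompleteSpace E] {Z : ι → E → ℝ} {z : E} (hZ : ∀ i, AnalyticAt ℝ (Z i) z) (u v : E) (i : ι) :
    fderiv ℝ (fderiv ℝ (fun z i => Z i z)) z u v i = fderiv ℝ (fderiv ℝ (Z i)) z u v := by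
  have hΦ : AnalyticAt ℝ (fun z i => Z i z) z := analyticAt_pi_iff.2 hZ
  have e : (fun y => fderiv ℝ (fun z i => Z i z) y v i) =ᶠ[𝓝 z] fun y => fderiv ℝ (Z i) y v := by
    filter_upwards [eventually_all.2 fun i => (hZ i).eventually_analyticAt] with y hy
    exact fderiv_pi_apply hy v i
  have h1 : HasFDerivAt (fun y => fderiv ℝ (fun z i => Z i z) y v i) _ z :=
    (ContinuousLinearMap.proj (R := ℝ) (φ := fun _ : ι => ℝ) i).hasFDerivAt.comp z
      (hΦ.fderiv.differentiableAt.hasFDerivAt.clm_apply (hasFDerivAt_const v z))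
  have h2 : HasFDerivAt (fun y => fderiv ℝ (Z i) y v) _ z :=
    (hZ i).fderiv.differentiableAt.hasFDerivAt.clm_apply (hasFDerivAt_const v z)
  simpa using DFunLike.congr_fun (h1.unique (h2.congr_of_eventuallyEq e)) u

/-- A curve with velocity `(1, p)` and acceleration `(0, q)` whose image under `Z` is straight
satisfies the geodesic equation of the connection induced by `Z`. -/
theorem geodesic_equation_of_straight {m : ℕ} {Z : Fin (m + 1) → (Fin (m + 1) → ℝ) → ℝ}
    {z : Fin (m + 1) → ℝ} {p q : Fin m → ℝ}
    {Γ : (Fin (m + 1) → ℝ) →L[ℝ] (Fin (m + 1) → ℝ) →L[ℝ] (Fin (m + 1) → ℝ)}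
    (hZ : ∀ i, AnalyticAt ℝ (Z i) z) (hu : IsUnit (fderiv ℝ (fun z i => Z i z) z))
    (hΓ : ∀ u v, fderiv ℝ (fderiv ℝ (fun z i => Z i z)) z u v =
      fderiv ℝ (fun z i => Z i z) z (Γ u v))
    (hne : Dop m (Z 0) z p ≠ 0)
    (h : ∀ j : Fin m, Dop m (Z 0) z p * DDop m (Z j.succ) z p q -
      Dop m (Z j.succ) z p * DDop m (Z 0) z p q = 0) (j : Fin m) :
    Γ (Pi.single 0 1 + vert m p) (Pi.single 0 1 + vert m p) j.succ + q j =
      p j * Γ (Pi.single 0 1 + vert m p) (Pi.single 0 1 + vert m p) 0 := by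
  set J := fderiv ℝ (fun z i => Z i z) z with hJ
  set v : Fin (m + 1) → ℝ := Pi.single 0 1 + vert m p with hv
  have hD : ∀ i, Dop m (Z i) z p = J v i := fun i => by
    rw [Dop_eq_fderiv, hJ, fderiv_pi_apply hZ]
  have hDD : ∀ i, DDop m (Z i) z p q = J (Γ v v + vert m q) i := fun i => by
    rw [DDop_eq_fderiv (hZ i), map_add J, ← hΓ, Pi.add_apply, fderiv_fderiv_pi_apply hZ, hJ,
      fderiv_pi_apply hZ]
  simp only [hD, hDD] at h hne
  have hinj : Function.Injective J := (ContinuousLinearMap.isUnit_iff_bijective.1 hu).1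
  have hpar : J v 0 • (Γ v v + vert m q) = J (Γ v v + vert m q) 0 • v := hinj <| by
    rw [map_smul, map_smul]
    ext i
    refine Fin.cases ?_ (fun k => ?_) i
    · simp [mul_comm]
    · simpa [mul_comm, sub_eq_zero] using h k
  have h0 := congrFun hpar 0
  have h1 := congrFun hpar j.succ
  simp only [hv, Pi.smul_apply, Pi.add_apply, vert_zero_apply, vert_succ_apply, smul_eq_mul,
    Pi.single_eq_same, Pi.single_eq_of_ne (Fin.succ_ne_zero j), add_zero, zero_add, mul_one]
    at h0 h1
  rw [← h0, mul_assoc] at h1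
  linarith [mul_left_cancel₀ hne h1]

theorem exists_connection_of_mapsToFree {m : ℕ}
    {F : Fin m → ((Fin (m + 1) → ℝ) × (Fin m → ℝ)) → ℝ}
    {Z : Fin (m + 1) → (Fin (m + 1) → ℝ) → ℝ} (hZ : ∀ i, AnalyticAt ℝ (Z i) 0)
    (h : MapsToFree m F Z) :
    ∃ Γ : (Fin (m + 1) → ℝ) → (Fin (m + 1) → ℝ) →L[ℝ] (Fin (m + 1) → ℝ) →L[ℝ] (Fin (m + 1) → ℝ),
      ∀ᶠ z in 𝓝 0, DifferentiableAt ℝ Γ z ∧ (∀ u v, Γ z u v = Γ z v u) ∧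
        (∀ u v w, fderiv ℝ Γ z w u v + Γ z w (Γ z u v) =
          fderiv ℝ Γ z u w v + Γ z u (Γ z w v)) ∧
        ∀ᶠ p in 𝓝 (0 : Fin m → ℝ), ∀ j,
          Γ z (Pi.single 0 1 + vert m p) (Pi.single 0 1 + vert m p) j.succ + F j (z, p) =
            p j * Γ z (Pi.single 0 1 + vert m p) (Pi.single 0 1 + vert m p) 0 := by
  obtain ⟨hjac, V, hV, hfree⟩ := h
  have hΦ : AnalyticAt ℝ (fun z i => Z i z) 0 := analyticAt_pi_iff.2 hZ
  have hone : fderiv ℝ (fun z i => Z i z) 0 = 1 := by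
    refine ContinuousLinearMap.coe_injective <| LinearMap.pi_ext' fun j =>
      LinearMap.ext_ring <| funext fun i => ?_
    simpa [fderiv_pi_apply hZ, pd, Pi.single_apply] using hjac i j
  obtain ⟨Γ, hΓ⟩ := exists_flat_connection_s16 hΦ (hone ▸ isUnit_one)
  have hne : ∀ᶠ w in 𝓝 (0 : (Fin (m + 1) → ℝ) × (Fin m → ℝ)), Dop m (Z 0) w.1 w.2 ≠ 0 := by
    have hpd : ∀ i, ContinuousAt (fun w : (Fin (m + 1) → ℝ) × (Fin m → ℝ) => pd m i (Z 0) w.1) 0 :=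
      fun i => ContinuousAt.comp (f := Prod.fst) (g := pd m i (Z 0))
        ((hZ 0).fderiv.continuousAt.clm_apply continuousAt_const) continuousAt_fst
    have hl : ∀ l : Fin m, ContinuousAt
        (fun w : (Fin (m + 1) → ℝ) × (Fin m → ℝ) => w.2 l) 0 := fun l => by fun_prop
    refine ContinuousAt.eventually_ne
      (g := fun w : (Fin (m + 1) → ℝ) × (Fin m → ℝ) => Dop m (Z 0) w.1 w.2)
      ((hpd 0).add <| tendsto_finsetSum _ fun l _ => (hl l).mul (hpd l.succ)) ?_
    simp [Dop, hjac]
  have hev := hne.and hV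
  rw [Prod.zero_eq_mk, nhds_prod_eq] at hev
  refine ⟨Γ, ?_⟩
  filter_upwards [hΓ, eventually_all.2 fun i => (hZ i).eventually_analyticAt, hev.curry]
    with z ⟨hu, hd, hc, hs, hf⟩ hz hp
  refine ⟨hd, hs, hf, ?_⟩
  filter_upwards [hp] with p hp j
  exact geodesic_equation_of_straight hz hu hc hp.1 (hfree _ hp.2) j

/-- The coefficients of a linear second order system which is equivalent to the free particle. -/
theorem linear_coeff_eq_of_mapsToFree {m : ℕ} {G₀ : Fin m → ℝ → ℝ} {G₁ Hf : Fin m → Fin m → ℝ → ℝ}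
    (hG₀ : ∀ j, AnalyticAt ℝ (G₀ j) 0) (hG₁ : ∀ j l, AnalyticAt ℝ (G₁ j l) 0)
    (hHf : ∀ j l, AnalyticAt ℝ (Hf j l) 0) {Z : Fin (m + 1) → (Fin (m + 1) → ℝ) → ℝ}
    (hZ : ∀ i, AnalyticAt ℝ (Z i) 0)
    (h : MapsToFree m
      (fun j w => G₀ j (w.1 0) + (∑ l : Fin m, w.1 l.succ * G₁ j l (w.1 0))
        + ∑ l : Fin m, w.2 l * Hf j l (w.1 0)) Z) :
    ∃ B : ℝ → ℝ, ∀ᶠ x in 𝓝 0, ∀ j l : Fin m, G₁ j l x = (1/2) * deriv (Hf j l) x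
      - (1/4) * ∑ k : Fin m, Hf j k x * Hf k l x + (if l = j then 1 else 0) * B x := by
  obtain ⟨Γ, hΓ⟩ := exists_connection_of_mapsToFree hZ h
  have hcoeff : ∀ᶠ z in 𝓝 (0 : Fin (m + 1) → ℝ), ∀ j u,
      Γ z (Pi.single 0 1) (Pi.single 0 1) j.succ = -fiberAffine m (G₀ j) (G₁ j) z ∧
      ∑ l, u l * Hf j l (z 0) = u j * Γ z (Pi.single 0 1) (Pi.single 0 1) 0 -
        2 * Γ z (Pi.single 0 1) (vert m u) j.succ ∧
      Γ z (vert m u) (vert m u) j.succ = 2 * u j * Γ z (Pi.single 0 1) (vert m u) 0 := by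
    filter_upwards [hΓ] with z ⟨_, hs, _, hp⟩ j u
    refine connection_coeff_of_geodesic (g := fun j => fiberAffine m (G₀ j) (G₁ j) z)
      (H := fun j l => Hf j l (z 0)) hs ?_ j u
    simpa only [fiberAffine, mul_comm (G₁ _ _ _)] using hp
  have hx : Tendsto (fun x : ℝ => (Pi.single 0 x : Fin (m + 1) → ℝ)) (𝓝 0) (𝓝 0) :=
    (continuous_single 0).tendsto' _ _ (by simp)
  refine ⟨fun x => (1/4) * Γ (Pi.single 0 x) (Pi.single 0 1) (Pi.single 0 1) 0 ^ 2 -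
    Γ (Pi.single 0 x) (Pi.single 0 1)
      (vert m fun j => fiberAffine m (G₀ j) (G₁ j) (Pi.single 0 x)) 0 -
    (1/2) * fderiv ℝ Γ (Pi.single 0 x) (Pi.single 0 1) (Pi.single 0 1) (Pi.single 0 1) 0, ?_⟩
  filter_upwards [hx.eventually hΓ.eventually_nhds, hx.eventually hcoeff.eventually_nhds,
    eventually_all.2 fun j => (hG₀ j).eventually_analyticAt,
    eventually_all.2 fun j => eventually_all.2 fun l => (hG₁ j l).eventually_analyticAt,
    eventually_all.2 fun j => eventually_all.2 fun l => (hHf j l).eventually_analyticAt]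
    with x hΓx hc h0 h1 hH j l
  obtain ⟨hd, hs, hf, -⟩ := hΓx.self_of_nhds
  set z : Fin (m + 1) → ℝ := Pi.single 0 x with hz
  have hz0 : z 0 = x := by simp [hz]
  clear_value z
  subst hz0
  have hΓd : ∀ u v w i, HasFDerivAt (fun z => Γ z u v i) (fderiv ℝ (fun z => Γ z u v i) z) z ∧
      fderiv ℝ (fun z => Γ z u v i) z w = fderiv ℝ Γ z w u v i := fun u v w i => by
    have : HasFDerivAt (fun z => Γ z u v i) _ z :=
      (ContinuousLinearMap.proj (R := ℝ) (φ := fun _ : Fin (m + 1) => ℝ) i).hasFDerivAt.comp z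
        ((hd.hasFDerivAt.clm_apply (hasFDerivAt_const u z)).clm_apply (hasFDerivAt_const v z))
    exact ⟨this.differentiableAt.hasFDerivAt, by simp [this.fderiv]⟩
  refine linear_coeff_eq_of_flat (H := fun j l => Hf j l (z 0)) hs
    (fun j => (hc.self_of_nhds j 0).1) (fun j u => (hc.self_of_nhds j u).2.1)
    (fun j u => (hc.self_of_nhds j u).2.2) ?_ ?_
    (hf (Pi.single 0 1) (Pi.single 0 1) (Pi.single l.succ 1))
  · have e : (fun z => Γ z (Pi.single 0 1) (Pi.single 0 1) j.succ) =ᶠ[𝓝 z]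
        -fiberAffine m (G₀ j) (G₁ j) := hc.mono fun y hy => (hy j 0).1
    rw [← (hΓd _ _ _ _).2, e.fderiv_eq, fderiv_neg, neg_apply, neg_inj]
    exact pd_succ_fiberAffine (α' := deriv (G₀ j)) (β' := fun l => deriv (G₁ j l))
      (h0 j).differentiableAt.hasDerivAt (fun l => (h1 j l).differentiableAt.hasDerivAt) l
  · have e : (fun z => Γ z (Pi.single l.succ 1) (Pi.single 0 1) j.succ) =ᶠ[𝓝 z] fun z =>
        (1/2) * ((if l = j then 1 else 0) * Γ z (Pi.single 0 1) (Pi.single 0 1) 0 -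
          Hf j l (z 0)) := by
      filter_upwards [hc, hΓx] with y hy ⟨_, hsy, _⟩
      have := (hy j (Pi.single l 1)).2.1
      rw [vert_single] at this
      simp only [Pi.single_apply, ite_mul, one_mul, zero_mul, Finset.sum_ite_eq', Finset.mem_univ,
        if_true, eq_comm (a := j)] at this ⊢
      rw [hsy]
      linarith
    have hz1 : HasFDerivAt (fun z : Fin (m + 1) → ℝ => z 0)
        (ContinuousLinearMap.proj (R := ℝ) (φ := fun _ : Fin (m + 1) => ℝ) 0) z :=
      hasFDerivAt_apply 0 z
    have hH0 : HasFDerivAt (fun z : Fin (m + 1) → ℝ => Hf j l (z 0)) _ z :=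
      (hH j l).differentiableAt.hasDerivAt.comp_hasFDerivAt z hz1
    have hr := ((((hΓd (Pi.single 0 1) (Pi.single 0 1) 0 0).1.const_mul
      (if l = j then 1 else 0)).sub hH0).const_mul (1/2)).congr_of_eventuallyEq e
    rw [← (hΓd _ _ _ _).2, hr.fderiv, ← (hΓd _ _ _ _).2]
    split_ifs <;> simp

/-- **Corollary 1.8 (González-López)**: for `m ≥ 2`, the linear (nonhomogeneous)
system `y_xx^j = G₀^j(x) + Σ_l y^l G_{1,l}^j(x) + Σ_l y_x^l H_l^j(x)` is
equivalent to the free-particle system `Y_XX^j = 0` if and only if there exists a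
function `B(x)` with
`G_{1,l}^j = (1/2)(H_l^j)' − (1/4) Σ_k H_k^j H_l^k + δ^j_l B`. -/
theorem gonzalez_lopez_linear_criterion (m : ℕ) (hm : 2 ≤ m)
    (G₀ : Fin m → ℝ → ℝ) (G₁ : Fin m → Fin m → ℝ → ℝ) (Hf : Fin m → Fin m → ℝ → ℝ)
    (W₀ : Set ℝ) (hW₀ : W₀ ∈ nhds (0 : ℝ))
    (hG₀ : ∀ j, AnalyticOnNhd ℝ (G₀ j) W₀)
    (hG₁ : ∀ j l, AnalyticOnNhd ℝ (G₁ j l) W₀)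
    (hHf : ∀ j l, AnalyticOnNhd ℝ (Hf j l) W₀) :
    (∃ Z : Fin (m + 1) → (Fin (m + 1) → ℝ) → ℝ,
      (∃ W ∈ nhds (0 : Fin (m + 1) → ℝ), ∀ i, AnalyticOnNhd ℝ (Z i) W) ∧
      MapsToFree m
        (fun j w => G₀ j (w.1 0) + (∑ l : Fin m, w.1 l.succ * G₁ j l (w.1 0))
          + ∑ l : Fin m, w.2 l * Hf j l (w.1 0)) Z)
    ↔
    (∃ B : ℝ → ℝ, (∃ WB ∈ nhds (0 : ℝ), AnalyticOnNhd ℝ B WB) ∧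
      ∃ W' ∈ nhds (0 : ℝ), ∀ x ∈ W', ∀ j l : Fin m,
        G₁ j l x = (1/2) * deriv (Hf j l) x
          - (1/4) * ∑ k : Fin m, Hf j k x * Hf k l x
          + (if l = j then 1 else 0) * B x) := by
  have hG₀' : ∀ j, AnalyticAt ℝ (G₀ j) 0 := fun j => hG₀ j 0 (mem_of_mem_nhds hW₀)
  have hG₁' : ∀ j l, AnalyticAt ℝ (G₁ j l) 0 := fun j l => hG₁ j l 0 (mem_of_mem_nhds hW₀)
  have hHf' : ∀ j l, AnalyticAt ℝ (Hf j l) 0 := fun j l => hHf j l 0 (mem_of_mem_nhds hW₀)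
  constructor
  · rintro ⟨Z, ⟨W, hW, hZ⟩, hmap⟩
    obtain ⟨B, hB⟩ := linear_coeff_eq_of_mapsToFree hG₀' hG₁' hHf'
      (fun i => hZ i 0 (mem_of_mem_nhds hW)) hmap
    let i₀ : Fin m := ⟨0, by lia⟩
    have hB₀ : AnalyticAt ℝ (fun x => G₁ i₀ i₀ x - (1/2) * deriv (Hf i₀ i₀) x
        + (1/4) * ∑ k : Fin m, Hf i₀ k x * Hf k i₀ x) 0 :=
      ((hG₁' i₀ i₀).sub (analyticAt_const.mul (hHf' i₀ i₀).deriv)).add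
        (analyticAt_const.mul (Finset.analyticAt_fun_sum _ fun k _ => (hHf' _ k).mul (hHf' k _)))
    refine ⟨_, hB₀.eventually_analyticAt.exists_mem, _, hB, fun x hx j l => ?_⟩
    have h₀ := hx i₀ i₀
    rw [if_pos rfl, one_mul] at h₀
    rw [hx j l, h₀]
    ring
  · rintro ⟨B, ⟨WB, hWB, hB⟩, W', hW', h⟩
    exact exists_mapsToFree_of_linear hG₀' hHf' (hB 0 (mem_of_mem_nhds hWB))
      (mem_of_superset hW' h)
end
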